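/- Suppose there are constants C > 0 and 0 < ε < 1 such that w(n) ≤ C·n^ε for all n ≥ 1. Then there is a constant c > 0 such that G(N) ≥ c·N/log log N for all sufficiently large N. -/

import Mathlib

/-- `G w N` counts the pairs `(n, m)` with `1 ≤ n, m ≤ N`, `n ≠ m` and
`n + w n = m + w m`. -/
noncomputable def G (w : ℕ → ℕ) (N : ℕ) : ℕ :=
  {q : ℕ × ℕ | q.1 ∈ Set.Icc 1 N ∧ q.2 ∈ Set.Icc 1 N ∧
    q.1 + w q.1 = q.2 + w q.2 ∧ q.1 ≠ q.2}.ncard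

noncomputable def avg (A : ℕ) (f : ℕ → ℝ) : ℝ := (∑ y ∈ Finset.range A, f y) / A

inductive PC : (ℕ → ℝ) → ℝ → Prop
  | base (f : ℕ → ℝ) (d : ℕ) (B : ℝ) : 0 < d → Function.Periodic f d → (∀ y, |f y| ≤ B) → PC f (d * B)
  | add (f g : ℕ → ℝ) (W V : ℝ) : PC f W → PC g V → PC (fun y => f y + g y) (W + V)

lemma sum_range_periodic (f : ℕ → ℝ) (d : ℕ) (hf : Function.Periodic f d) (q : ℕ) :
    ∑ y ∈ Finset.range (d * q), f y = q * ∑ y ∈ Finset.range d, f y := by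
  induction q with
  | zero => simp
  | succ q ih =>
    rw [Nat.mul_succ, Finset.sum_range_add, ih]
    have : ∀ x, f (d * q + x) = f x := by
      intro x
      have := hf.nat_mul q x
      rw [← this]; congr 1; push_cast; ring
    simp only [this]; push_cast; ring

lemma avg_eq_of_periodic (f : ℕ → ℝ) (d Q : ℕ) (hQ : 0 < Q) (h : d ∣ Q) (hf : Function.Periodic f d) :
    avg Q f = avg d f := by
  obtain ⟨q, rfl⟩ := h
  have hd : 0 < d := Nat.pos_of_mul_pos_right hQ
  have hq : 0 < q := Nat.pos_of_mul_pos_left hQ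
  unfold avg
  rw [sum_range_periodic f d hf]
  push_cast
  field_simp

lemma PC.nonneg {f : ℕ → ℝ} {W : ℝ} (h : PC f W) : 0 ≤ W := by
  induction h with
  | base f d B hd hf hB => 
    have := (abs_nonneg _).trans (hB 0)
    positivity
  | add f g W V _ _ h1 h2 => linarith

lemma PC.mean {f : ℕ → ℝ} {W : ℝ} (h : PC f W) :
    ∃ m, ∀ A : ℕ, |∑ y ∈ Finset.range A, f y - A * m| ≤ 2 * W := by
  induction h with
  | base f d B hd hf hB =>
    refine ⟨avg d f, fun A => ?_⟩
    have hB0 : 0 ≤ B := (abs_nonneg _).trans (hB 0)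
    have hm : |avg d f| ≤ B := by
      unfold avg
      rw [abs_div, Nat.abs_cast, div_le_iff₀ (by positivity)]
      refine (Finset.abs_sum_le_sum_abs _ _).trans ((Finset.sum_le_card_nsmul _ _ B (fun i _ => hB i)).trans ?_)
      simp [mul_comm]
    have hA := Nat.div_add_mod A d
    set q := A / d
    set r := A % d with hr
    have hrd : r < d := Nat.mod_lt _ hd
    rw [← hA, Finset.sum_range_add, sum_range_periodic f d hf]
    have e1 : (∑ y ∈ Finset.range d, f y) = d * avg d f := by
      unfold avg; field_simp
    rw [e1]
    have : (q:ℝ) * (d * avg d f) + ∑ x ∈ Finset.range r, f (d * q + x) - ((d * q + r : ℕ):ℝ) * avg d f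
        = ∑ x ∈ Finset.range r, (f (d * q + x) - avg d f) := by
      rw [Finset.sum_sub_distrib]; simp; ring
    rw [this]
    refine (Finset.abs_sum_le_sum_abs _ _).trans ((Finset.sum_le_card_nsmul _ _ (2*B) (fun i _ => ?_)).trans ?_)
    · exact (abs_sub _ _).trans (by linarith [hB (d*q+i)])
    · simp
      have : (r:ℝ) ≤ d := by exact_mod_cast hrd.le
      nlinarith
  | add f g W V _ _ h1 h2 =>
    obtain ⟨m1, h1⟩ := h1
    obtain ⟨m2, h2⟩ := h2
    refine ⟨m1 + m2, fun A => ?_⟩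
    rw [Finset.sum_add_distrib]
    have := abs_add_le (∑ y ∈ Finset.range A, f y - A * m1) (∑ y ∈ Finset.range A, g y - A * m2)
    have e : ∑ y ∈ Finset.range A, f y + ∑ y ∈ Finset.range A, g y - A * (m1 + m2) =
      (∑ y ∈ Finset.range A, f y - A * m1) + (∑ y ∈ Finset.range A, g y - A * m2) := by ring
    rw [e]; linarith [h1 A, h2 A]

lemma PC.avg_le {f : ℕ → ℝ} {W : ℝ} (h : PC f W) (Q : ℕ) (hQ : 0 < Q) (hf : Function.Periodic f Q)
    (A : ℕ) (hA : 0 < A) : |avg A f - avg Q f| ≤ 2 * W / A := by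
  obtain ⟨m, hm⟩ := h.mean
  have hmQ : avg Q f = m := by
    by_contra hne
    have hpos : 0 < |avg Q f - m| := abs_pos.mpr (sub_ne_zero.mpr hne)
    obtain ⟨q, hq⟩ := exists_nat_gt (2 * W / |avg Q f - m|)
    rw [div_lt_iff₀ hpos] at hq
    have := hm (Q * q)
    rw [sum_range_periodic f Q hf] at this
    have e : (q:ℝ) * ∑ y ∈ Finset.range Q, f y - ((Q * q : ℕ):ℝ) * m = Q * q * (avg Q f - m) := by
      unfold avg; push_cast; field_simp
    rw [e, abs_mul, abs_of_nonneg (by positivity)] at this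
    have hQ1 : (1:ℝ) ≤ Q := by exact_mod_cast hQ
    have : (q:ℝ) * |avg Q f - m| ≤ Q * q * |avg Q f - m| := by
      have : 0 ≤ (q:ℝ) * |avg Q f - m| := by positivity
      nlinarith
    linarith
  rw [hmQ]
  have hA' : (0:ℝ) < A := by exact_mod_cast hA
  rw [le_div_iff₀ hA']
  have := hm A
  have e : |avg A f - m| * A = |∑ y ∈ Finset.range A, f y - A * m| := by
    rw [← abs_of_pos hA', ← abs_mul, abs_of_pos hA']; unfold avg; congr 1; field_simp
  linarith

lemma PC.mul {f g : ℕ → ℝ} {W V : ℝ} (hf : PC f W) (hg : PC g V) : PC (fun y => f y * g y) (W * V) := by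
  induction hf with
  | base f d B hd hf hB =>
    induction hg with
    | base g e B' he hg hB' =>
      have := PC.base (fun y => f y * g y) (d * e) (B * B') (by positivity) ?_ ?_
      · convert this using 1; push_cast; ring
      · intro y
        have h1 := hf.nat_mul e y
        have h2 := hg.nat_mul d y
        simp only
        have e1 : y + d * e = y + (e:ℕ) * d := by ring
        simp at h1 h2
        rw [h2, e1, h1]
      · intro y; rw [abs_mul]; exact mul_le_mul (hB y) (hB' y) (abs_nonneg _) ((abs_nonneg _).trans (hB 0))
    | add g1 g2 W V _ _ h1 h2 =>
      have := PC.add _ _ _ _ h1 h2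
      convert this using 1
      · funext y; ring
      · ring
  | add f1 f2 W V _ _ h1 h2 =>
      have := PC.add _ _ _ _ h1 h2
      convert this using 1
      · funext y; ring
      · ring

lemma PC.const (c : ℝ) : PC (fun _ => c) |c| := by
  have := PC.base (fun _ => c) 1 |c| one_pos (fun _ => rfl) (fun _ => le_rfl)
  simpa using this

lemma PC.smul {f : ℕ → ℝ} {W : ℝ} (c : ℝ) (hf : PC f W) : PC (fun y => c * f y) (|c| * W) :=
  (PC.const c).mul hf

lemma PC.sum {ι : Type*} (s : Finset ι) (f : ι → ℕ → ℝ) (W : ι → ℝ) (h : ∀ i ∈ s, PC (f i) (W i)) :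
    PC (fun y => ∑ i ∈ s, f i y) (∑ i ∈ s, W i) := by
  classical
  induction s using Finset.induction_on with
  | empty => simpa using PC.const 0
  | insert a s ha ih =>
    simp only [Finset.sum_insert ha]
    exact PC.add _ _ _ _ (h a (by simp)) (ih (fun i hi => h i (by simp [hi])))

lemma avg_add (A : ℕ) (f g : ℕ → ℝ) : avg A (fun y => f y + g y) = avg A f + avg A g := by
  unfold avg; rw [Finset.sum_add_distrib, add_div]

lemma avg_smul (A : ℕ) (c : ℝ) (f : ℕ → ℝ) : avg A (fun y => c * f y) = c * avg A f := by
  unfold avg; rw [← Finset.mul_sum, mul_div_assoc]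

lemma avg_sum {ι : Type*} (A : ℕ) (s : Finset ι) (f : ι → ℕ → ℝ) :
    avg A (fun y => ∑ i ∈ s, f i y) = ∑ i ∈ s, avg A (f i) := by
  unfold avg; rw [Finset.sum_comm, Finset.sum_div]

lemma avg_const (A : ℕ) (hA : 0 < A) (c : ℝ) : avg A (fun _ => c) = c := by
  unfold avg; simp; field_simp

lemma avg_mono (A : ℕ) (f g : ℕ → ℝ) (h : ∀ y, f y ≤ g y) : avg A f ≤ avg A g := by
  unfold avg; gcongr; exact h _

lemma abs_avg_le (A : ℕ) (f : ℕ → ℝ) : |avg A f| ≤ avg A (fun y => |f y|) := by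
  unfold avg; rw [abs_div, Nat.abs_cast]; gcongr; exact Finset.abs_sum_le_sum_abs _ _

lemma sum_mul_coprime (f g : ℕ → ℝ) (a b : ℕ) (ha : 0 < a) (hb : 0 < b) (hab : Nat.Coprime a b)
    (hf : Function.Periodic f a) (hg : Function.Periodic g b) :
    ∑ y ∈ Finset.range (a * b), f y * g y = (∑ y ∈ Finset.range a, f y) * (∑ y ∈ Finset.range b, g y) := by
  rw [Finset.sum_mul_sum, ← Finset.sum_product']
  refine Finset.sum_bij (fun y _ => (y % a, y % b)) ?_ ?_ ?_ ?_
  · intro y _; simp [Nat.mod_lt _ ha, Nat.mod_lt _ hb]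
  · intro y hy z hz h
    simp only [Prod.mk.injEq] at h
    have : y ≡ z [MOD a * b] := (Nat.modEq_and_modEq_iff_modEq_mul hab).mp ⟨h.1, h.2⟩
    exact this.eq_of_lt_of_lt (by simpa using hy) (by simpa using hz)
  · rintro ⟨i, j⟩ hij
    simp at hij
    refine ⟨Nat.chineseRemainder hab i j, ?_, ?_⟩
    · simpa using Nat.chineseRemainder_lt_mul hab i j ha.ne' hb.ne'
    · have := (Nat.chineseRemainder hab i j).2
      simp only [Prod.mk.injEq]
      exact ⟨by rw [this.1, Nat.mod_eq_of_lt hij.1], by rw [this.2, Nat.mod_eq_of_lt hij.2]⟩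
  · intro y _
    simp [hf.map_mod_nat, hg.map_mod_nat]

lemma periodic_of_dvd (f : ℕ → ℝ) (a Q : ℕ) (h : a ∣ Q) (hf : Function.Periodic f a) :
    Function.Periodic f Q := by
  obtain ⟨q, rfl⟩ := h
  have := hf.nat_mul q
  simpa [mul_comm] using this

lemma avg_indep (f g : ℕ → ℝ) (a b Q : ℕ) (hQ : 0 < Q) (hab : Nat.Coprime a b) (hQd : a * b ∣ Q)
    (hf : Function.Periodic f a) (hg : Function.Periodic g b) :
    avg Q (fun y => f y * g y) = avg Q f * avg Q g := by
  have hpos : 0 < a * b := Nat.pos_of_dvd_of_pos hQd hQ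
  have ha : 0 < a := Nat.pos_of_mul_pos_right hpos
  have hb : 0 < b := Nat.pos_of_mul_pos_left hpos
  rw [avg_eq_of_periodic _ (a*b) Q hQ hQd, avg_eq_of_periodic f a Q hQ (dvd_of_mul_right_dvd hQd) hf,
    avg_eq_of_periodic g b Q hQ (dvd_of_mul_left_dvd hQd) hg]
  · unfold avg; rw [sum_mul_coprime f g a b ha hb hab hf hg]; push_cast; field_simp
  · intro y
    simp only
    rw [periodic_of_dvd f a (a*b) (dvd_mul_right _ _) hf y, periodic_of_dvd g b (a*b) (dvd_mul_left _ _) hg y]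


lemma indepS (P S : Finset ℕ) (hP : ∀ p ∈ P, p.Prime) (hS : S ⊆ P) (p : ℕ) (hp : p ∈ P) (hpS : p ∉ S)
    (f g : ℕ → ℝ) (hf : Function.Periodic f (∏ q ∈ S, q)) (hg : Function.Periodic g p) :
    avg (∏ q ∈ P, q) (fun y => f y * g y) = avg (∏ q ∈ P, q) f * avg (∏ q ∈ P, q) g := by
  apply avg_indep f g (∏ q ∈ S, q) p _ (Finset.prod_pos fun q hq => (hP q hq).pos) _ _ hf hg
  · refine Nat.Coprime.prod_left fun q hq => ?_
    exact (Nat.coprime_primes (hP q (hS hq)) (hP p hp)).mpr (by rintro rfl; exact hpS hq)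
  · rw [mul_comm, ← Finset.prod_insert (f := fun q => q) hpS]
    apply Finset.prod_dvd_prod_of_subset
    intro q hq
    rcases Finset.mem_insert.mp hq with rfl | h
    · exact hp
    · exact hS h

lemma periodic_sumS (S : Finset ℕ) (h : ℕ → ℕ → ℝ) (hh : ∀ p ∈ S, Function.Periodic (h p) p) :
    Function.Periodic (fun y => ∑ p ∈ S, h p y) (∏ q ∈ S, q) := by
  intro y
  refine Finset.sum_congr rfl fun p hp => ?_
  exact periodic_of_dvd _ _ _ (Finset.dvd_prod_of_mem _ hp) (hh p hp) y

lemma periodic_comp {f : ℕ → ℝ} {Q : ℕ} (hf : Function.Periodic f Q) (F : ℝ → ℝ) :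
    Function.Periodic (fun y => F (f y)) Q := fun y => by simp [hf y]

lemma mom2 (P S : Finset ℕ) (hP : ∀ p ∈ P, p.Prime) (hS : S ⊆ P) (h g : ℕ → ℕ → ℝ)
    (hh : ∀ p ∈ P, Function.Periodic (h p) p) (hg : ∀ p ∈ P, Function.Periodic (g p) p)
    (h0 : ∀ p ∈ P, avg (∏ q ∈ P, q) (h p) = 0) (g0 : ∀ p ∈ P, avg (∏ q ∈ P, q) (g p) = 0) :
    avg (∏ q ∈ P, q) (fun y => (∑ p ∈ S, h p y) * (∑ p ∈ S, g p y)) =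
      ∑ p ∈ S, avg (∏ q ∈ P, q) (fun y => h p y * g p y) := by
  induction S using Finset.induction_on with
  | empty => simp [avg]
  | insert p S hpS ih =>
    have hS' : S ⊆ P := fun q hq => hS (Finset.mem_insert_of_mem hq)
    have hp : p ∈ P := hS (Finset.mem_insert_self _ _)
    have ph := periodic_sumS S h (fun q hq => hh q (hS' hq))
    have pg := periodic_sumS S g (fun q hq => hg q (hS' hq))
    simp only [Finset.sum_insert hpS]
    rw [← ih hS']
    have e : (fun y => (h p y + ∑ p ∈ S, h p y) * (g p y + ∑ p ∈ S, g p y)) = fun y =>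
      ((h p y * g p y + (∑ p ∈ S, h p y) * (∑ p ∈ S, g p y)) + ((∑ p ∈ S, h p y) * g p y +
        (∑ p ∈ S, g p y) * h p y)) := by funext y; ring
    rw [e, avg_add, avg_add, avg_add, indepS P S hP hS' p hp hpS _ _ ph (hg p hp),
      indepS P S hP hS' p hp hpS _ _ pg (hh p hp), h0 p hp, g0 p hp]
    ring

lemma mom1 (P S : Finset ℕ) (hS : S ⊆ P) (h : ℕ → ℕ → ℝ)
    (h0 : ∀ p ∈ P, avg (∏ q ∈ P, q) (h p) = 0) :
    avg (∏ q ∈ P, q) (fun y => (∑ p ∈ S, h p y)) = 0 := by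
  rw [avg_sum]; exact Finset.sum_eq_zero fun p hp => h0 p (hS hp)

lemma mom4 (P S : Finset ℕ) (hP : ∀ p ∈ P, p.Prime) (hS : S ⊆ P) (h : ℕ → ℕ → ℝ)
    (hh : ∀ p ∈ P, Function.Periodic (h p) p)
    (h0 : ∀ p ∈ P, avg (∏ q ∈ P, q) (h p) = 0) :
    avg (∏ q ∈ P, q) (fun y => (∑ p ∈ S, h p y) ^ 4) ≤
      3 * (∑ p ∈ S, avg (∏ q ∈ P, q) (fun y => h p y ^ 2)) ^ 2 +
      ∑ p ∈ S, avg (∏ q ∈ P, q) (fun y => h p y ^ 4) := by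
  induction S using Finset.induction_on with
  | empty => simp [avg]
  | insert p S hpS ih =>
    have hS' : S ⊆ P := fun q hq => hS (Finset.mem_insert_of_mem hq)
    have hp : p ∈ P := hS (Finset.mem_insert_self _ _)
    have ph := periodic_sumS S h (fun q hq => hh q (hS' hq))
    have m2 := mom2 P S hP hS' h h hh hh h0 h0
    have m1 := mom1 P S hS' h h0
    simp only [Finset.sum_insert hpS]
    have ih := ih hS'
    have e : (fun y => (h p y + ∑ p ∈ S, h p y) ^ 4) = fun y =>
      (((∑ p ∈ S, h p y) ^ 4 + h p y ^ 4) + (4 * ((∑ p ∈ S, h p y) ^ 3 * h p y) +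
        (6 * (((∑ p ∈ S, h p y) * (∑ p ∈ S, h p y)) * h p y ^ 2) + 4 * ((∑ p ∈ S, h p y) * h p y ^ 3)))) := by
      funext y; ring
    rw [e, avg_add, avg_add, avg_add, avg_add, avg_smul, avg_smul, avg_smul,
      indepS P S hP hS' p hp hpS _ _ (periodic_comp ph (fun t => t ^ 3)) (hh p hp),
      indepS P S hP hS' p hp hpS _ _ (periodic_comp ph (fun t => t * t)) (periodic_comp (hh p hp) (fun t => t ^ 2)),
      indepS P S hP hS' p hp hpS _ _ ph (periodic_comp (hh p hp) (fun t => t ^ 3)), h0 p hp, m1, m2]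
    have e2 : ∀ q, (fun y => h q y * h q y) = fun y => h q y ^ 2 := fun q => by funext y; ring
    simp only [e2]
    nlinarith [sq_nonneg (avg (∏ q ∈ P, q) (fun y => h p y ^ 2))]


open Classical in
noncomputable def xi (a : ℤ) (D p y : ℕ) : ℝ := (if (p:ℤ) ∣ a + D * y then 1 else 0) - 1 / p

lemma xi_periodic (a : ℤ) (D p : ℕ) : Function.Periodic (xi a D p) p := by
  intro y
  unfold xi
  have : (p:ℤ) ∣ a + D * ((y + p : ℕ):ℤ) ↔ (p:ℤ) ∣ a + D * y := by
    push_cast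
    rw [mul_add, ← add_assoc]
    exact (Int.dvd_add_left (Dvd.intro_left _ rfl))
  simp only [this]

lemma xi_abs_le (a : ℤ) (D p y : ℕ) (hp : 0 < p) : |xi a D p y| ≤ 1 := by
  have h1 : (1:ℝ) ≤ p := by exact_mod_cast hp
  have h2 : (1:ℝ) / p ≤ 1 := by rw [div_le_one (by linarith)]; exact h1
  have h3 : (0:ℝ) ≤ 1 / p := by positivity
  unfold xi
  split_ifs <;> rw [abs_le] <;> constructor <;> linarith

open Classical in
lemma avg_ind (a : ℤ) (D p : ℕ) (hp : p.Prime) (hD : Nat.Coprime p D) :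
    avg p (fun y => if (p:ℤ) ∣ a + D * y then (1:ℝ) else 0) = 1 / p := by
  unfold avg
  congr 1
  rw [Finset.sum_boole]
  norm_cast
  have : Fact p.Prime := ⟨hp⟩
  rw [Finset.card_eq_one]
  have hDu : (D : ZMod p) ≠ 0 := by
    intro h
    rw [ZMod.natCast_eq_zero_iff] at h
    exact (hp.coprime_iff_not_dvd.mp hD) h
  refine ⟨((- (a : ZMod p)) / D).val, ?_⟩
  ext y
  simp only [Finset.mem_filter, Finset.mem_range, Finset.mem_singleton]
  rw [← ZMod.intCast_zmod_eq_zero_iff_dvd]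
  push_cast
  constructor
  · rintro ⟨hy, h⟩
    have : (y : ZMod p) = (- (a : ZMod p)) / D := by
      field_simp; linear_combination h
    rw [← this, ZMod.val_natCast, Nat.mod_eq_of_lt hy]
  · rintro rfl
    refine ⟨ZMod.val_lt _, ?_⟩
    rw [ZMod.natCast_zmod_val]
    field_simp; ring

lemma avg_xi (a : ℤ) (D p Q : ℕ) (hp : p.Prime) (hD : Nat.Coprime p D) (hQ : 0 < Q) (hpQ : p ∣ Q) :
    avg Q (xi a D p) = 0 := by
  classical
  rw [avg_eq_of_periodic _ p Q hQ hpQ (xi_periodic a D p)]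
  have e : xi a D p = fun y : ℕ => (if (p:ℤ) ∣ a + D * y then (1:ℝ) else 0) + (- (1 / p)) := by
    funext y; unfold xi; split_ifs <;> ring
  rw [e, avg_add, avg_ind a D p hp hD, avg_const _ hp.pos]; ring

lemma avg_xi_xi (a b : ℤ) (D p Q : ℕ) (hp : p.Prime) (hD : Nat.Coprime p D) (hQ : 0 < Q) (hpQ : p ∣ Q)
    (hab : |a - b| < p) :
    avg Q (fun y => xi a D p y * xi b D p y) = (if a = b then 1 / (p:ℝ) else 0) - 1 / (p:ℝ) ^ 2 := by
  classical
  have per : Function.Periodic (fun y => xi a D p y * xi b D p y) p := by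
    intro y; simp only; rw [xi_periodic a D p y, xi_periodic b D p y]
  have key : ∀ y : ℕ, xi a D p y * xi b D p y = (if a = b then 1 else 0) * 
      (if (p:ℤ) ∣ a + D * y then (1:ℝ) else 0) + ((-(1/p)) * (if (p:ℤ) ∣ a + D * y then (1:ℝ) else 0) +
      ((-(1/p)) * (if (p:ℤ) ∣ b + D * y then (1:ℝ) else 0) + 1 / (p:ℝ)^2)) := by
    intro y
    unfold xi
    by_cases h : a = b
    · subst h; by_cases h2 : (p:ℤ) ∣ a + D * y <;> simp [h2] <;> ring
    · by_cases h2 : (p:ℤ) ∣ a + D * y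
      · have h3 : ¬ (p:ℤ) ∣ b + D * y := by
          intro h3
          have := dvd_sub h2 h3
          have h4 : (a + D * y - (b + D * y) : ℤ) = a - b := by ring
          rw [h4] at this
          exact h (sub_eq_zero.mp (Int.eq_zero_of_abs_lt_dvd this hab))
        simp [h, h2, h3]; ring
      · by_cases h3 : (p:ℤ) ∣ b + D * y <;> simp [h, h2, h3] <;> ring
  rw [avg_eq_of_periodic _ p Q hQ hpQ per]
  simp_rw [key]
  rw [avg_add, avg_add, avg_add, avg_smul, avg_smul, avg_smul, avg_ind a D p hp hD, avg_ind b D p hp hD,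
    avg_const _ hp.pos]
  split_ifs <;> ring

noncomputable def Yp (a : ℤ) (D R : ℕ) (ψ : ℤ → ℝ) (p y : ℕ) : ℝ :=
  ∑ k ∈ Finset.Icc (-(R:ℤ)) R, ψ k * xi (a + k) D p y

lemma Yp_periodic (a : ℤ) (D R : ℕ) (ψ : ℤ → ℝ) (p : ℕ) : Function.Periodic (Yp a D R ψ p) p := by
  intro y; unfold Yp; simp only [fun k => xi_periodic (a+k) D p y]

lemma avg_Yp (a : ℤ) (D R : ℕ) (ψ : ℤ → ℝ) (p Q : ℕ) (hp : p.Prime) (hD : Nat.Coprime p D) (hQ : 0 < Q)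
    (hpQ : p ∣ Q) : avg Q (Yp a D R ψ p) = 0 := by
  unfold Yp
  rw [show (fun y => ∑ k ∈ Finset.Icc (-(R:ℤ)) R, ψ k * xi (a + k) D p y) =
    fun y => ∑ k ∈ Finset.Icc (-(R:ℤ)) R, (fun y => ψ k * xi (a + k) D p y) y from rfl, avg_sum]
  exact Finset.sum_eq_zero fun k _ => by rw [avg_smul, avg_xi _ _ _ _ hp hD hQ hpQ, mul_zero]

lemma abs_sub_lt_of_mem {R p : ℕ} (hR : 2 * R + 1 ≤ p) {k l : ℤ} (hk : k ∈ Finset.Icc (-(R:ℤ)) R)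
    (hl : l ∈ Finset.Icc (-(R:ℤ)) R) (a : ℤ) : |(a + k) - (a + l)| < p := by
  rw [Finset.mem_Icc] at hk hl
  rw [abs_lt]; constructor <;> omega

lemma avg_Yp_sq (a : ℤ) (D R : ℕ) (ψ : ℤ → ℝ) (p Q : ℕ) (hp : p.Prime) (hD : Nat.Coprime p D) (hQ : 0 < Q)
    (hpQ : p ∣ Q) (hR : 2 * R + 1 ≤ p) : avg Q (fun y => Yp a D R ψ p y ^ 2) =
      (∑ k ∈ Finset.Icc (-(R:ℤ)) R, ψ k ^ 2) / p - (∑ k ∈ Finset.Icc (-(R:ℤ)) R, ψ k) ^ 2 / p ^ 2 := by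
  have e : (fun y => Yp a D R ψ p y ^ 2) = fun y => ∑ k ∈ Finset.Icc (-(R:ℤ)) R, 
      (fun y => ∑ l ∈ Finset.Icc (-(R:ℤ)) R, (fun y => (ψ k * ψ l) * (xi (a + k) D p y * xi (a + l) D p y)) y) y := by
    funext y; unfold Yp; rw [sq, Finset.sum_mul_sum]
    refine Finset.sum_congr rfl fun k _ => Finset.sum_congr rfl fun l _ => by ring
  rw [e, avg_sum]
  have : ∀ k ∈ Finset.Icc (-(R:ℤ)) R, avg Q (fun y => ∑ l ∈ Finset.Icc (-(R:ℤ)) R, 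
      (fun y => (ψ k * ψ l) * (xi (a + k) D p y * xi (a + l) D p y)) y) = 
      ψ k ^ 2 / p - ψ k * (∑ l ∈ Finset.Icc (-(R:ℤ)) R, ψ l) / p ^ 2 := by
    intro k hk
    rw [avg_sum]
    have : ∀ l ∈ Finset.Icc (-(R:ℤ)) R, avg Q (fun y => (ψ k * ψ l) * (xi (a + k) D p y * xi (a + l) D p y)) 
       = (if k = l then ψ k * ψ l / p else 0) - ψ k * ψ l / p ^ 2 := by
      intro l hl
      rw [avg_smul, avg_xi_xi _ _ _ _ _ hp hD hQ hpQ (abs_sub_lt_of_mem hR hk hl a)]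
      by_cases h : k = l
      · simp [h]; ring
      · simp [h]; ring
    rw [Finset.sum_congr rfl this, Finset.sum_sub_distrib, Finset.sum_ite_eq, if_pos hk, Finset.mul_sum,
      Finset.sum_div]
    ring
  rw [Finset.sum_congr rfl this, Finset.sum_sub_distrib, ← Finset.sum_div, ← Finset.sum_div, ← Finset.sum_mul]
  ring

lemma sum_sq_le_card (R : ℕ) (ψ : ℤ → ℝ) : (∑ k ∈ Finset.Icc (-(R:ℤ)) R, ψ k) ^ 2 ≤
    (2 * R + 1) * ∑ k ∈ Finset.Icc (-(R:ℤ)) R, ψ k ^ 2 := by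
  have := sq_sum_le_card_mul_sum_sq (s := Finset.Icc (-(R:ℤ)) R) (f := ψ)
  have hc : (Finset.Icc (-(R:ℤ)) R).card = 2 * R + 1 := by simp; omega
  rw [hc] at this; push_cast at this; exact this

lemma Yp_abs_le (a : ℤ) (D R : ℕ) (ψ : ℤ → ℝ) (p y : ℕ) (hp : 0 < p) (hR : 2 * R + 1 ≤ p) (B : ℝ) 
    (hB : ∀ k, |ψ k| ≤ B) : |Yp a D R ψ p y| ≤ 2 * B := by
  classical
  have hB0 : 0 ≤ B := (abs_nonneg _).trans (hB 0)
  have hpp : (0:ℝ) < p := by exact_mod_cast hp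
  have hc : (Finset.Icc (-(R:ℤ)) R).card = 2 * R + 1 := by simp; omega
  have e : Yp a D R ψ p y = (∑ k ∈ Finset.Icc (-(R:ℤ)) R with (p:ℤ) ∣ a + k + D * y, ψ k) - 
     ∑ k ∈ Finset.Icc (-(R:ℤ)) R, ψ k * (1 / p) := by
    unfold Yp xi
    rw [Finset.sum_filter, ← Finset.sum_sub_distrib]
    refine Finset.sum_congr rfl fun k _ => ?_
    split_ifs <;> ring
  have h1 : |∑ k ∈ Finset.Icc (-(R:ℤ)) R with (p:ℤ) ∣ a + k + D * y, ψ k| ≤ B := by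
    refine (Finset.abs_sum_le_sum_abs _ _).trans ((Finset.sum_le_card_nsmul _ _ B (fun i _ => hB i)).trans ?_)
    have : ((Finset.Icc (-(R:ℤ)) R).filter (fun k => (p:ℤ) ∣ a + k + D * y)).card ≤ 1 := by
      rw [Finset.card_le_one]
      intro k hk l hl
      rw [Finset.mem_filter] at hk hl
      have h := dvd_sub hk.2 hl.2
      have h4 : (a + k + D * y - (a + l + D * y) : ℤ) = (a + k) - (a + l) := by ring
      rw [h4] at h
      have := Int.eq_zero_of_abs_lt_dvd h (abs_sub_lt_of_mem hR hk.1 hl.1 a)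
      omega
    rw [nsmul_eq_mul]
    have : ((((Finset.Icc (-(R:ℤ)) R).filter (fun k => (p:ℤ) ∣ a + k + D * y)).card : ℕ) : ℝ) ≤ 1 := by exact_mod_cast this
    nlinarith
  have h2 : |∑ k ∈ Finset.Icc (-(R:ℤ)) R, ψ k * (1 / p)| ≤ B := by
    refine (Finset.abs_sum_le_sum_abs _ _).trans ((Finset.sum_le_card_nsmul _ _ (B * (1/p)) (fun i _ => ?_)).trans ?_)
    · rw [abs_mul, abs_of_pos (a := (1:ℝ)/p) (by positivity)]
      exact mul_le_mul_of_nonneg_right (hB i) (by positivity)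
    · rw [nsmul_eq_mul, hc]
      have : ((2 * R + 1 : ℕ) : ℝ) ≤ p := by exact_mod_cast hR
      have h5 : ((2 * R + 1 : ℕ) : ℝ) * (1 / p) ≤ 1 := by rw [mul_one_div, div_le_one hpp]; exact this
      nlinarith
  rw [e]
  exact (abs_sub _ _).trans (by linarith)


lemma Y_mean (P : Finset ℕ) (hP : ∀ p ∈ P, p.Prime) (a : ℤ) (D R : ℕ) (hD : ∀ p ∈ P, Nat.Coprime p D)
    (ψ : ℤ → ℝ) : avg (∏ q ∈ P, q) (fun y => ∑ p ∈ P, Yp a D R ψ p y) = 0 :=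
  mom1 P P (Finset.Subset.refl _) _ fun p hp => avg_Yp a D R ψ p _ (hP p hp) (hD p hp)
    (Finset.prod_pos fun q hq => (hP q hq).pos) (Finset.dvd_prod_of_mem _ hp)

lemma Y_sq (P : Finset ℕ) (hP : ∀ p ∈ P, p.Prime) (a : ℤ) (D R : ℕ) (hD : ∀ p ∈ P, Nat.Coprime p D)
    (hR : ∀ p ∈ P, 2 * (2 * R + 1) ≤ p) (ψ : ℤ → ℝ) :
    avg (∏ q ∈ P, q) (fun y => (∑ p ∈ P, Yp a D R ψ p y) ^ 2) =
    ∑ p ∈ P, avg (∏ q ∈ P, q) (fun y => (Yp a D R ψ p y) ^ 2) := by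
  have hQ : 0 < ∏ q ∈ P, q := Finset.prod_pos fun q hq => (hP q hq).pos
  have h0 := fun p hp => avg_Yp a D R ψ p (∏ q ∈ P, q) (hP p hp) (hD p hp) hQ (Finset.dvd_prod_of_mem _ hp)
  have := mom2 P P hP (Finset.Subset.refl _) (Yp a D R ψ) (Yp a D R ψ) (fun p _ => Yp_periodic a D R ψ p)
    (fun p _ => Yp_periodic a D R ψ p) h0 h0
  simp only [← sq] at this
  exact this

lemma Yp_sq_bounds (P : Finset ℕ) (hP : ∀ p ∈ P, p.Prime) (a : ℤ) (D R : ℕ) (hD : ∀ p ∈ P, Nat.Coprime p D)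
    (hR : ∀ p ∈ P, 2 * (2 * R + 1) ≤ p) (ψ : ℤ → ℝ) (p : ℕ) (hp : p ∈ P) :
    (1 / p) * (∑ k ∈ Finset.Icc (-(R:ℤ)) R, ψ k ^ 2) / 2 ≤ avg (∏ q ∈ P, q) (fun y => (Yp a D R ψ p y) ^ 2) ∧
    avg (∏ q ∈ P, q) (fun y => (Yp a D R ψ p y) ^ 2) ≤ (1 / p) * (∑ k ∈ Finset.Icc (-(R:ℤ)) R, ψ k ^ 2) := by
  have hQ : 0 < ∏ q ∈ P, q := Finset.prod_pos fun q hq => (hP q hq).pos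
  have hpp : (0:ℝ) < p := by exact_mod_cast (hP p hp).pos
  rw [avg_Yp_sq a D R ψ p _ (hP p hp) (hD p hp) hQ (Finset.dvd_prod_of_mem _ hp) (by linarith [hR p hp])]
  have h1 := sum_sq_le_card R ψ
  have h2 : (2:ℝ) * (2 * R + 1) ≤ p := by exact_mod_cast hR p hp
  set s := ∑ k ∈ Finset.Icc (-(R:ℤ)) R, ψ k ^ 2
  have hs : 0 ≤ s := Finset.sum_nonneg fun _ _ => sq_nonneg _
  set t := ∑ k ∈ Finset.Icc (-(R:ℤ)) R, ψ k
  have h3 : t ^ 2 / p ^ 2 ≤ s / p / 2 := by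
    rw [div_div, div_le_div_iff₀ (by positivity) (by positivity)]
    nlinarith [mul_nonneg hs hpp.le]
  have h4 : 0 ≤ t ^ 2 / (p:ℝ) ^ 2 := by positivity
  have h5 : 1 / (p:ℝ) * s = s / p := by ring
  rw [h5]
  constructor <;> linarith

lemma Y_sq_bounds (P : Finset ℕ) (hP : ∀ p ∈ P, p.Prime) (a : ℤ) (D R : ℕ) (hD : ∀ p ∈ P, Nat.Coprime p D)
    (hR : ∀ p ∈ P, 2 * (2 * R + 1) ≤ p) (ψ : ℤ → ℝ) :
    (∑ p ∈ P, 1 / (p:ℝ)) * (∑ k ∈ Finset.Icc (-(R:ℤ)) R, ψ k ^ 2) / 2 ≤ 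
      avg (∏ q ∈ P, q) (fun y => (∑ p ∈ P, Yp a D R ψ p y) ^ 2) ∧
    ∑ p ∈ P, avg (∏ q ∈ P, q) (fun y => (Yp a D R ψ p y) ^ 2) ≤ 
      (∑ p ∈ P, 1 / (p:ℝ)) * (∑ k ∈ Finset.Icc (-(R:ℤ)) R, ψ k ^ 2) := by
  rw [Y_sq P hP a D R hD hR, Finset.sum_mul, Finset.sum_div]
  exact ⟨Finset.sum_le_sum fun p hp => (Yp_sq_bounds P hP a D R hD hR ψ p hp).1,
    Finset.sum_le_sum fun p hp => (Yp_sq_bounds P hP a D R hD hR ψ p hp).2⟩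

lemma Y_four (P : Finset ℕ) (hP : ∀ p ∈ P, p.Prime) (a : ℤ) (D R : ℕ) (hD : ∀ p ∈ P, Nat.Coprime p D)
    (hR : ∀ p ∈ P, 2 * (2 * R + 1) ≤ p) (ψ : ℤ → ℝ) (B : ℝ) (hB : ∀ k, |ψ k| ≤ B) :
    avg (∏ q ∈ P, q) (fun y => (∑ p ∈ P, Yp a D R ψ p y) ^ 4) ≤
    3 * ((∑ p ∈ P, 1 / (p:ℝ)) * (∑ k ∈ Finset.Icc (-(R:ℤ)) R, ψ k ^ 2)) ^ 2 +
    4 * B ^ 2 * ((∑ p ∈ P, 1 / (p:ℝ)) * (∑ k ∈ Finset.Icc (-(R:ℤ)) R, ψ k ^ 2)) := by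
  have hQ : 0 < ∏ q ∈ P, q := Finset.prod_pos fun q hq => (hP q hq).pos
  have h0 := fun p hp => avg_Yp a D R ψ p (∏ q ∈ P, q) (hP p hp) (hD p hp) hQ (Finset.dvd_prod_of_mem _ hp)
  refine (mom4 P P hP (Finset.Subset.refl _) (Yp a D R ψ) (fun p _ => Yp_periodic a D R ψ p) h0).trans ?_
  have hs := (Y_sq_bounds P hP a D R hD hR ψ).2
  have hs0 : 0 ≤ ∑ p ∈ P, avg (∏ q ∈ P, q) (fun y => (Yp a D R ψ p y) ^ 2) := 
    Finset.sum_nonneg fun p _ => div_nonneg (Finset.sum_nonneg fun _ _ => sq_nonneg _) (Nat.cast_nonneg _)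
  have h4 : ∑ p ∈ P, avg (∏ q ∈ P, q) (fun y => (Yp a D R ψ p y) ^ 4) ≤ 
      4 * B ^ 2 * ∑ p ∈ P, avg (∏ q ∈ P, q) (fun y => (Yp a D R ψ p y) ^ 2) := by
    rw [Finset.mul_sum]
    refine Finset.sum_le_sum fun p hp => ?_
    rw [← avg_smul]
    refine avg_mono _ _ _ fun y => ?_
    have := Yp_abs_le a D R ψ p y (hP p hp).pos (by linarith [hR p hp]) B hB
    have h2 : Yp a D R ψ p y ^ 2 ≤ (2 * B) ^ 2 := sq_le_sq' (by linarith [(abs_le.mp this).1]) (abs_le.mp this).2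
    nlinarith [sq_nonneg (Yp a D R ψ p y)]
  have : 0 ≤ 4 * B ^ 2 := by positivity
  gcongr
  exact h4.trans (by gcongr)

noncomputable def Zs (a : ℤ) (D R : ℕ) (χ : ℤ → ℝ) (S : Finset ℕ) (y : ℕ) : ℝ :=
  ∑ k ∈ Finset.Icc (-(R:ℤ)) R, χ k * (∑ p ∈ S, xi (a + k) D p y) ^ 2

lemma avg_sub_const (Q : ℕ) (hQ : 0 < Q) (f : ℕ → ℝ) (c : ℝ) : avg Q (fun y => f y - c) = avg Q f - c := by
  have : (fun y => f y - c) = fun y => f y + (fun _ => -c) y := by funext y; ring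
  rw [this, avg_add, avg_const _ hQ]; ring

lemma Z_W (P S : Finset ℕ) (hP : ∀ p ∈ P, p.Prime) (a : ℤ) (D R : ℕ) (hD : ∀ p ∈ P, Nat.Coprime p D)
    (hR : ∀ p ∈ P, 2 * (2 * R + 1) ≤ p) (χ : ℤ → ℝ) (hS : S ⊆ P) (p : ℕ) (hp : p ∈ P) (hpS : p ∉ S) :
    avg (∏ q ∈ P, q) (fun y => (∑ k ∈ Finset.Icc (-(R:ℤ)) R, χ k * (∑ q ∈ S, xi (a + k) D q y) * xi (a + k) D p y) ^ 2) ≤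
      2 * (∑ k ∈ Finset.Icc (-(R:ℤ)) R, χ k ^ 2) * (∑ q ∈ S, 1 / (q:ℝ)) * (1 / p) := by
  have hQ : 0 < ∏ q ∈ P, q := Finset.prod_pos fun q hq => (hP q hq).pos
  set Q := ∏ q ∈ P, q with hQdef
  set J := Finset.Icc (-(R:ℤ)) R with hJ
  have e : (fun y => (∑ k ∈ J, χ k * (∑ q ∈ S, xi (a + k) D q y) * xi (a + k) D p y) ^ 2) = 
     fun y => ∑ k ∈ J, (fun y => ∑ l ∈ J, (fun y => (χ k * χ l) * 
      (((∑ q ∈ S, xi (a + k) D q y) * (∑ q ∈ S, xi (a + l) D q y)) * (xi (a + k) D p y * xi (a + l) D p y))) y) y := by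
    funext y; rw [sq, Finset.sum_mul_sum]
    refine Finset.sum_congr rfl fun k _ => Finset.sum_congr rfl fun l _ => by ring
  rw [e, avg_sum]
  have key : ∀ k ∈ J, ∀ l ∈ J, avg Q (fun y => (χ k * χ l) * 
      (((∑ q ∈ S, xi (a + k) D q y) * (∑ q ∈ S, xi (a + l) D q y)) * (xi (a + k) D p y * xi (a + l) D p y))) =
      ∑ q ∈ S, (χ k * χ l) * (((if k = l then 1 / (q:ℝ) else 0) - 1 / (q:ℝ) ^ 2) * ((if k = l then 1 / (p:ℝ) else 0) - 1 / (p:ℝ) ^ 2)) := by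
    intro k hk l hl
    have p1 := periodic_sumS S (fun q => xi (a + k) D q) (fun q _ => xi_periodic _ _ _)
    have p2 := periodic_sumS S (fun q => xi (a + l) D q) (fun q _ => xi_periodic _ _ _)
    have per : Function.Periodic (fun y => (∑ q ∈ S, xi (a + k) D q y) * (∑ q ∈ S, xi (a + l) D q y)) (∏ q ∈ S, q) := by
      intro y; have := p1 y; have := p2 y; simp_all
    have per2 : Function.Periodic (fun y => xi (a + k) D p y * xi (a + l) D p y) p := by
      intro y; simp only; rw [xi_periodic _ D p y, xi_periodic _ D p y]
    rw [avg_smul, indepS P S hP hS p hp hpS _ _ per per2,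
      mom2 P S hP hS (fun q => xi (a + k) D q) (fun q => xi (a + l) D q) (fun q _ => xi_periodic _ _ _) (fun q _ => xi_periodic _ _ _)
      (fun q hq => avg_xi _ _ _ _ (hP q hq) (hD q hq) hQ (Finset.dvd_prod_of_mem _ hq))
      (fun q hq => avg_xi _ _ _ _ (hP q hq) (hD q hq) hQ (Finset.dvd_prod_of_mem _ hq)),
      avg_xi_xi _ _ _ _ _ (hP p hp) (hD p hp) hQ (Finset.dvd_prod_of_mem _ hp) (abs_sub_lt_of_mem (by linarith [hR p hp]) hk hl a),
      Finset.sum_mul, Finset.mul_sum]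
    refine Finset.sum_congr rfl fun q hq => ?_
    rw [avg_xi_xi _ _ _ _ _ (hP q (hS hq)) (hD q (hS hq)) hQ (Finset.dvd_prod_of_mem _ (hS hq)) (abs_sub_lt_of_mem (by linarith [hR q (hS hq)]) hk hl a)]
    simp
  have e2 : ∑ k ∈ J, avg Q (fun y => ∑ l ∈ J, (fun y => (χ k * χ l) * 
      (((∑ q ∈ S, xi (a + k) D q y) * (∑ q ∈ S, xi (a + l) D q y)) * (xi (a + k) D p y * xi (a + l) D p y))) y) =
      ∑ q ∈ S, ∑ k ∈ J, ∑ l ∈ J, (χ k * χ l) * (((if k = l then 1 / (q:ℝ) else 0) - 1 / (q:ℝ) ^ 2) * ((if k = l then 1 / (p:ℝ) else 0) - 1 / (p:ℝ) ^ 2)) := by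
    rw [Finset.sum_comm]
    refine Finset.sum_congr rfl fun k hk => ?_
    rw [avg_sum, Finset.sum_comm]
    exact Finset.sum_congr rfl fun l hl => key k hk l hl
  rw [e2, mul_assoc, Finset.sum_mul, Finset.mul_sum]
  refine Finset.sum_le_sum fun q hq => ?_
  have hpp : (0:ℝ) < p := by exact_mod_cast (hP p hp).pos
  have hqq : (0:ℝ) < q := by exact_mod_cast (hP q (hS hq)).pos
  have e3 : ∑ k ∈ J, ∑ l ∈ J, (χ k * χ l) * (((if k = l then 1 / (q:ℝ) else 0) - 1 / (q:ℝ) ^ 2) * ((if k = l then 1 / (p:ℝ) else 0) - 1 / (p:ℝ) ^ 2))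
     = (∑ k ∈ J, χ k ^ 2) * (1 / (q * p) - 1 / (q * p ^ 2) - 1 / (q ^ 2 * p)) + (∑ k ∈ J, χ k) ^ 2 / (q ^ 2 * p ^ 2) := by
    have : ∀ k ∈ J, ∑ l ∈ J, (χ k * χ l) * (((if k = l then 1 / (q:ℝ) else 0) - 1 / (q:ℝ) ^ 2) * ((if k = l then 1 / (p:ℝ) else 0) - 1 / (p:ℝ) ^ 2))
      = χ k ^ 2 * (1 / (q * p) - 1 / (q * p ^ 2) - 1 / (q ^ 2 * p)) + χ k * (∑ l ∈ J, χ l) / (q ^ 2 * p ^ 2) := by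
      intro k hk
      have : ∀ l ∈ J, (χ k * χ l) * (((if k = l then 1 / (q:ℝ) else 0) - 1 / (q:ℝ) ^ 2) * ((if k = l then 1 / (p:ℝ) else 0) - 1 / (p:ℝ) ^ 2))
       = (if k = l then χ k * χ l * (1 / (q * p) - 1 / (q * p ^ 2) - 1 / (q ^ 2 * p)) else 0) + χ k * χ l / (q ^ 2 * p ^ 2) := by
        intro l hl
        split_ifs <;> field_simp <;> ring
      rw [Finset.sum_congr rfl this, Finset.sum_add_distrib, Finset.sum_ite_eq, if_pos hk, Finset.mul_sum, Finset.sum_div]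
      ring
    rw [Finset.sum_congr rfl this, Finset.sum_add_distrib, ← Finset.sum_mul, ← Finset.sum_div, ← Finset.sum_mul]
    ring
  rw [e3]
  have h1 := sum_sq_le_card R χ
  set X := ∑ k ∈ J, χ k ^ 2
  have hX : 0 ≤ X := Finset.sum_nonneg fun _ _ => sq_nonneg _
  have h2 : (2:ℝ) * (2 * R + 1) ≤ p := by exact_mod_cast hR p hp
  have hq1 : (1:ℝ) ≤ q := by exact_mod_cast (hP q (hS hq)).pos
  have h3 : (∑ k ∈ J, χ k) ^ 2 / ((q:ℝ) ^ 2 * p ^ 2) ≤ X * (1 / (q * p)) := by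
    rw [mul_one_div, div_le_div_iff₀ (by positivity) (by positivity)]
    have hR0 : (0:ℝ) ≤ R := Nat.cast_nonneg _
    have h6 : (2 * (R:ℝ) + 1) * X ≤ (q * p) * X := by
      apply mul_le_mul_of_nonneg_right _ hX; nlinarith
    have : (∑ k ∈ J, χ k) ^ 2 ≤ X * (q * p) := by linarith
    calc (∑ k ∈ J, χ k) ^ 2 * (q * p) ≤ X * (q * p) * (q * p) := by gcongr
      _ = _ := by ring
  have h4 : X * (1 / (q * p) - 1 / (q * p ^ 2) - 1 / (q ^ 2 * p)) ≤ X * (1 / ((q:ℝ) * p)) := by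
    apply mul_le_mul_of_nonneg_left _ hX
    have : 0 ≤ 1 / ((q:ℝ) * p ^ 2) := by positivity
    have : 0 ≤ 1 / ((q:ℝ) ^ 2 * p) := by positivity
    linarith
  have : 2 * X * (1 / (q:ℝ) * (1 / p)) = 2 * (X * (1 / (q * p))) := by field_simp
  linarith

lemma Z_var (P S : Finset ℕ) (hP : ∀ p ∈ P, p.Prime) (a : ℤ) (D R : ℕ) (hD : ∀ p ∈ P, Nat.Coprime p D)
    (hR : ∀ p ∈ P, 2 * (2 * R + 1) ≤ p) (χ : ℤ → ℝ) (hS : S ⊆ P) :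
    avg (∏ q ∈ P, q) (fun y => (Zs a D R χ S y - avg (∏ q ∈ P, q) (Zs a D R χ S)) ^ 2) ≤
      (∑ k ∈ Finset.Icc (-(R:ℤ)) R, χ k ^ 2) * (8 * (∑ q ∈ S, 1 / (q:ℝ)) ^ 2 + ∑ q ∈ S, 1 / (q:ℝ)) := by
  have hQ : 0 < ∏ q ∈ P, q := Finset.prod_pos fun q hq => (hP q hq).pos
  induction S using Finset.induction_on with
  | empty => simp [Zs, avg]
  | insert p S hpS ih =>
    have hS' : S ⊆ P := fun q hq => hS (Finset.mem_insert_of_mem hq)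
    have hp : p ∈ P := hS (Finset.mem_insert_self _ _)
    have ih := ih hS'
    have hW := Z_W P S hP a D R hD hR χ hS' p hp hpS
    have hV := (Yp_sq_bounds P hP a D R hD hR χ p hp).2
    have hpp : (0:ℝ) < p := by exact_mod_cast (hP p hp).pos
    set Q := ∏ q ∈ P, q with hQdef
    set J := Finset.Icc (-(R:ℤ)) R with hJ
    set W : ℕ → ℝ := fun y => ∑ k ∈ J, χ k * (∑ q ∈ S, xi (a + k) D q y) * xi (a + k) D p y with hWd
    set c := (∑ k ∈ J, χ k) * (1 / p - 1 / (p:ℝ)^2)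
    have step : ∀ y, Zs a D R χ (insert p S) y = Zs a D R χ S y + (2 * W y + ((1 - 2 / p) * Yp a D R χ p y + c)) := by
      intro y
      simp only [Zs, W, Yp, c, Finset.mul_sum, Finset.sum_mul, ← hJ, ← Finset.sum_add_distrib]
      refine Finset.sum_congr rfl fun k _ => ?_
      rw [Finset.sum_insert hpS]
      have : xi (a + k) D p y ^ 2 = (1 - 2 / p) * xi (a + k) D p y + (1 / p - 1 / (p:ℝ)^2) := by
        unfold xi; split_ifs <;> field_simp <;> ring
      have e2 : ∑ i ∈ S, 2 * (χ k * xi (a + k) D i y * xi (a + k) D p y) = 2 * χ k * (∑ i ∈ S, xi (a + k) D i y) * xi (a + k) D p y := by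
        rw [Finset.mul_sum, Finset.sum_mul]; exact Finset.sum_congr rfl fun _ _ => by ring
      first
        | rw [e2]; linear_combination (χ k) * this
        | (simp only [← Finset.mul_sum, ← Finset.sum_mul]; linear_combination (χ k) * this)
    have perZ : Function.Periodic (Zs a D R χ S) (∏ q ∈ S, q) := by
      intro y
      unfold Zs
      refine Finset.sum_congr rfl fun k _ => ?_
      have := periodic_sumS S (fun q => xi (a + k) D q) (fun q _ => xi_periodic _ _ _) y
      simp only at this; rw [this]
    have avW0 : ∀ f : ℕ → ℝ, Function.Periodic f (∏ q ∈ S, q) → avg Q (fun y => f y * W y) = 0 := by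
      intro f hf
      have e : (fun y => f y * W y) = fun y => ∑ k ∈ J, (fun y => χ k * ((f y * (∑ q ∈ S, xi (a + k) D q y)) * xi (a + k) D p y)) y := by
        funext y; simp only [W, Finset.mul_sum (s := J)]; exact Finset.sum_congr rfl fun _ _ => by ring
      rw [e, avg_sum]
      refine Finset.sum_eq_zero fun k _ => ?_
      have per : Function.Periodic (fun y => f y * (∑ q ∈ S, xi (a + k) D q y)) (∏ q ∈ S, q) := by
        intro y
        have := periodic_sumS S (fun q => xi (a + k) D q) (fun q _ => xi_periodic _ _ _) y
        simp only at this; simp only; rw [this, hf y]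
      rw [avg_smul, indepS P S hP hS' p hp hpS _ _ per (xi_periodic _ _ _), 
        avg_xi _ _ _ _ (hP p hp) (hD p hp) hQ (Finset.dvd_prod_of_mem _ hp)]; ring
    have avY := avg_Yp a D R χ p Q (hP p hp) (hD p hp) hQ (Finset.dvd_prod_of_mem _ hp)
    have avW : avg Q W = 0 := by
      have := avW0 (fun _ => 1) (fun _ => rfl)
      simpa using this
    have avZY : avg Q (fun y => (Zs a D R χ S y - avg Q (Zs a D R χ S)) * Yp a D R χ p y) = 0 := by
      rw [indepS P S hP hS' p hp hpS (fun y => Zs a D R χ S y - avg Q (Zs a D R χ S)) _ 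
        (periodic_comp perZ (fun t => t - avg Q (Zs a D R χ S))) (Yp_periodic _ _ _ _ _), avY, mul_zero]
    have avZW := avW0 (fun y => Zs a D R χ S y - avg Q (Zs a D R χ S)) (periodic_comp perZ (fun t => t - avg Q (Zs a D R χ S)))
    have avWY : avg Q (fun y => W y * Yp a D R χ p y) = 0 := by
      have e : (fun y => W y * Yp a D R χ p y) = fun y => ∑ k ∈ J, (fun y => χ k * ((∑ q ∈ S, xi (a + k) D q y) * (xi (a + k) D p y * Yp a D R χ p y))) y := by
        funext y; simp only [W, Finset.sum_mul (s := J)]; exact Finset.sum_congr rfl fun _ _ => by ring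
      rw [e, avg_sum]
      refine Finset.sum_eq_zero fun k _ => ?_
      have per : Function.Periodic (fun y => xi (a + k) D p y * Yp a D R χ p y) p := by
        intro y; simp only; rw [xi_periodic _ D p y, Yp_periodic _ D R χ p y]
      rw [avg_smul, indepS P S hP hS' p hp hpS _ _ (periodic_sumS S (fun q => xi (a + k) D q) (fun q _ => xi_periodic _ _ _)) per,
        mom1 P S hS' (fun q => xi (a + k) D q) (fun q hq => avg_xi _ _ _ _ (hP q hq) (hD q hq) hQ (Finset.dvd_prod_of_mem _ hq))]
      ring
    have avZ : avg Q (Zs a D R χ (insert p S)) = avg Q (Zs a D R χ S) + c := by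
      have : Zs a D R χ (insert p S) = fun y => Zs a D R χ S y + (2 * W y + ((1 - 2 / p) * Yp a D R χ p y + (fun _ => c) y)) := funext step
      rw [this, avg_add, avg_add, avg_add, avg_smul, avg_smul, avW, avg_const _ hQ]
      rw [show avg Q (fun y => Yp a D R χ p y) = 0 from avY]; ring
    have e : (fun y => (Zs a D R χ (insert p S) y - avg Q (Zs a D R χ (insert p S))) ^ 2) = fun y =>
       ((Zs a D R χ S y - avg Q (Zs a D R χ S)) ^ 2 + (4 * (W y) ^ 2 + (1 - 2 / p) ^ 2 * (Yp a D R χ p y) ^ 2)) +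
       (4 * ((Zs a D R χ S y - avg Q (Zs a D R χ S)) * W y) + ((2 * (1 - 2 / p)) * ((Zs a D R χ S y - avg Q (Zs a D R χ S)) * Yp a D R χ p y)
         + (4 * (1 - 2 / p)) * (W y * Yp a D R χ p y))) := by
      funext y; rw [avZ, step y]; ring
    rw [e, avg_add, avg_add, avg_add, avg_add, avg_add, avg_smul, avg_smul, avg_smul, avg_smul, avg_smul, avZY, avZW, avWY]
    rw [Finset.sum_insert hpS]
    have hp2 : (2:ℝ) ≤ p := by exact_mod_cast (hP p hp).two_le
    have hf : (1 - 2 / (p:ℝ)) ^ 2 ≤ 1 := by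
      have h1 : 2 / (p:ℝ) ≤ 1 := by rw [div_le_one hpp]; exact hp2
      have h2 : 0 ≤ 2 / (p:ℝ) := by positivity
      nlinarith
    have hV0 : 0 ≤ avg Q (fun y => (Yp a D R χ p y) ^ 2) := 
       div_nonneg (Finset.sum_nonneg fun _ _ => sq_nonneg _) (Nat.cast_nonneg _)
    have h5 : (1 - 2 / (p:ℝ)) ^ 2 * avg Q (fun y => (Yp a D R χ p y) ^ 2) ≤ avg Q (fun y => (Yp a D R χ p y) ^ 2) :=
      mul_le_of_le_one_left hV0 hf
    have hX : 0 ≤ ∑ k ∈ J, χ k ^ 2 := Finset.sum_nonneg fun _ _ => sq_nonneg _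
    have hl : 0 ≤ ∑ q ∈ S, 1 / (q:ℝ) := Finset.sum_nonneg fun _ _ => by positivity
    have h6 : 0 ≤ (∑ k ∈ J, χ k ^ 2) * (1 / p) ^ 2 := by positivity
    have h7 : 0 ≤ (∑ k ∈ J, χ k ^ 2) * (∑ q ∈ S, 1 / (q:ℝ)) * (1 / p) := by positivity
    nlinarith


lemma PC_Y (P : Finset ℕ) (hP : ∀ p ∈ P, p.Prime) (a : ℤ) (D R z : ℕ)
    (hR : ∀ p ∈ P, 2 * (2 * R + 1) ≤ p) (hz : ∀ p ∈ P, p ≤ z) (ψ : ℤ → ℝ) (B : ℝ) (hB : ∀ k, |ψ k| ≤ B) :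
    ∃ W, W ≤ 2 * B * z ^ 2 ∧ PC (fun y => ∑ p ∈ P, Yp a D R ψ p y) W := by
  have hB0 : 0 ≤ B := (abs_nonneg _).trans (hB 0)
  refine ⟨_, ?_, PC.sum P (Yp a D R ψ) (fun p => p * (2 * B)) fun p hp => 
    PC.base _ p _ (hP p hp).pos (Yp_periodic a D R ψ p) (fun y => ?_)⟩
  · have hc : (P.card : ℝ) ≤ z := by
      have : P ⊆ Finset.Icc 1 z := fun p hp => Finset.mem_Icc.2 ⟨(hP p hp).pos, hz p hp⟩
      have := Finset.card_le_card this
      simp at this; exact_mod_cast this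
    calc ∑ p ∈ P, (p:ℝ) * (2 * B) ≤ ∑ p ∈ P, (z:ℝ) * (2 * B) := by
          refine Finset.sum_le_sum fun p hp => mul_le_mul_of_nonneg_right ?_ (by linarith)
          exact_mod_cast hz p hp
      _ = P.card * (z * (2 * B)) := by rw [Finset.sum_const, nsmul_eq_mul]
      _ ≤ z * (z * (2 * B)) := by gcongr
      _ = _ := by ring
  · apply Yp_abs_le <;> first | exact hB | exact hP p hp | exact hR p hp | (have := hR p hp; omega)

lemma PC_Z (P : Finset ℕ) (hP : ∀ p ∈ P, p.Prime) (a : ℤ) (D R z : ℕ)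
    (hz : ∀ p ∈ P, p ≤ z) (χ : ℤ → ℝ) (B : ℝ) (hB : ∀ k, |χ k| ≤ B) :
    ∃ W, W ≤ (2 * R + 1) * B * z ^ 4 ∧ PC (Zs a D R χ P) W := by
  have hB0 : 0 ≤ B := (abs_nonneg _).trans (hB 0)
  have hc : (P.card : ℝ) ≤ z := by
      have : P ⊆ Finset.Icc 1 z := fun p hp => Finset.mem_Icc.2 ⟨(hP p hp).pos, hz p hp⟩
      have := Finset.card_le_card this
      simp at this; exact_mod_cast this
  have h1 : ∀ k, PC (fun y => ∑ p ∈ P, xi (a + k) D p y) (∑ p ∈ P, (p:ℝ) * 1) := fun k =>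
    PC.sum P (xi (a + k) D) _ fun p hp => PC.base _ p _ (hP p hp).pos (xi_periodic _ D p) 
      (fun y => xi_abs_le _ _ _ _ (hP p hp).pos)
  have hW : ∑ p ∈ P, (p:ℝ) * 1 ≤ z ^ 2 := by
    calc ∑ p ∈ P, (p:ℝ) * 1 ≤ ∑ p ∈ P, (z:ℝ) := by
          refine Finset.sum_le_sum fun p hp => ?_
          rw [mul_one]; exact_mod_cast hz p hp
      _ = P.card * z := by rw [Finset.sum_const, nsmul_eq_mul]
      _ ≤ z * z := by gcongr
      _ = _ := by ring
  have hW0 : 0 ≤ ∑ p ∈ P, (p:ℝ) * 1 := Finset.sum_nonneg fun _ _ => by positivity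
  have h2 : ∀ k, PC (fun y => χ k * (∑ p ∈ P, xi (a + k) D p y) ^ 2) (|χ k| * ((∑ p ∈ P, (p:ℝ) * 1) * (∑ p ∈ P, (p:ℝ) * 1))) := by
    intro k
    have := PC.smul (χ k) (PC.mul (h1 k) (h1 k))
    simpa only [sq] using this
  refine ⟨_, ?_, PC.sum (Finset.Icc (-(R:ℤ)) R) (fun k y => χ k * (∑ p ∈ P, xi (a + k) D p y) ^ 2) _ fun k _ => h2 k⟩
  calc _ ≤ ∑ k ∈ Finset.Icc (-(R:ℤ)) R, B * (z^2 * z^2 : ℝ) := by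
        refine Finset.sum_le_sum fun k _ => ?_
        gcongr
        exact hB k
    _ = _ := by
      rw [Finset.sum_const, nsmul_eq_mul, Int.card_Icc]
      have : ((((R:ℤ) + 1 - -(R:ℤ)).toNat : ℕ) : ℝ) = 2 * R + 1 := by
        have : ((R:ℤ) + 1 - -(R:ℤ)).toNat = 2 * R + 1 := by omega
        rw [this]; push_cast; ring
      rw [this]; ring

lemma PC.abs_le {f : ℕ → ℝ} {W : ℝ} (h : PC f W) (y : ℕ) : |f y| ≤ W := by
  induction h with
  | base f d B hd _ hB => 
    have h0 := (abs_nonneg _).trans (hB 0)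
    have : (1:ℝ) ≤ d := by exact_mod_cast hd
    nlinarith [hB y]
  | add f g W V _ _ h1 h2 => exact (abs_add_le _ _).trans (add_le_add h1 h2)

lemma Zs_periodic (P : Finset ℕ) (a : ℤ) (D R : ℕ) (χ : ℤ → ℝ) : Function.Periodic (Zs a D R χ P) (∏ q ∈ P, q) := by
  intro y
  unfold Zs
  refine Finset.sum_congr rfl fun k _ => ?_
  have := periodic_sumS P (xi (a+k) D) (fun p _ => xi_periodic _ _ _) y
  simp only at this
  rw [this]

lemma abs_le_half_sq (t : ℝ) : |t| ≤ (1/2) * t ^ 2 + 1 / 2 := by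
  nlinarith [sq_abs t, sq_nonneg (|t| - 1)]

lemma r_ineq : ∀ r : ℝ, 0 ≤ r → r^2 - r^4/4 ≤ r := by
  intro r hr
  have : 0 ≤ r * (1 - r + r^3/4) := by
    apply mul_nonneg hr
    nlinarith [sq_nonneg (r - 1), mul_nonneg hr (sq_nonneg (r-1)), sq_nonneg (r - 1.15), mul_nonneg hr (sq_nonneg (r-1.15))]
  nlinarith

set_option maxHeartbeats 1000000 in
lemma Y_lower (P : Finset ℕ) (hP : ∀ p ∈ P, p.Prime) (a : ℤ) (D R z A : ℕ) (hD : ∀ p ∈ P, Nat.Coprime p D)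
    (hR : ∀ p ∈ P, 2 * (2 * R + 1) ≤ p) (hz : ∀ p ∈ P, p ≤ z) (hz1 : 1 ≤ z) (hA : 0 < A)
    (ψ χ : ℤ → ℝ) (B : ℝ) (hB0 : 0 < B) (hB1 : B ≤ 1) (hψ : ∀ k, |ψ k| ≤ B) (hχ : ∀ k, |χ k| ≤ B) (c : ℝ) :
    5 / 64 * √((∑ p ∈ P, 1 / (p:ℝ)) * (∑ k ∈ Finset.Icc (-(R:ℤ)) R, ψ k ^ 2)) - 2
     - (∑ k ∈ Finset.Icc (-(R:ℤ)) R, χ k ^ 2) * (8 * (∑ q ∈ P, 1 / (q:ℝ)) ^ 2 + ∑ q ∈ P, 1 / (q:ℝ))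
     - 5 * (32 * (2 * R + 1) ^ 2 * z ^ 8 / A) / B ^ 3
    ≤ avg A (fun y => |c + (∑ p ∈ P, Yp a D R ψ p y) + Zs a D R χ P y|) := by
  have hQ : 0 < ∏ q ∈ P, q := Finset.prod_pos fun q hq => (hP q hq).pos
  obtain ⟨WY, hWY, pY⟩ := PC_Y P hP a D R z hR hz ψ B hψ
  obtain ⟨WZ, hWZ, pZ⟩ := PC_Z P hP a D R z hz χ B hχ
  have hY1 := Y_mean P hP a D R hD ψ
  have hY2 := (Y_sq_bounds P hP a D R hD hR ψ).1
  have hY4 := Y_four P hP a D R hD hR ψ B hψ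
  have hZ := Z_var P P hP a D R hD hR χ (Finset.Subset.refl _)
  set lam := ∑ p ∈ P, 1 / (p:ℝ) with hlam
  have hl0 : 0 ≤ lam := Finset.sum_nonneg fun _ _ => by positivity
  set S := ∑ k ∈ Finset.Icc (-(R:ℤ)) R, ψ k ^ 2
  have hS0 : 0 ≤ S := Finset.sum_nonneg fun _ _ => sq_nonneg _
  set X := (∑ k ∈ Finset.Icc (-(R:ℤ)) R, χ k ^ 2) * (8 * lam ^ 2 + lam)
  set Q := ∏ q ∈ P, q with hQdef
  have perY : Function.Periodic (fun y => ∑ p ∈ P, Yp a D R ψ p y) Q := 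
    periodic_sumS P (Yp a D R ψ) (fun p _ => Yp_periodic _ _ _ _ _)
  set Y := fun y => ∑ p ∈ P, Yp a D R ψ p y with hYdef
  have perZ : Function.Periodic (Zs a D R χ P) Q := Zs_periodic P a D R χ
  set Z := Zs a D R χ P
  set m := avg Q Z with hm
  have hA' : (0:ℝ) < A := by exact_mod_cast hA
  have hz1' : (1:ℝ) ≤ z := by exact_mod_cast hz1
  have hR1 : (1:ℝ) ≤ 2 * R + 1 := by have : (0:ℝ) ≤ R := by positivity
                                     linarith
  set e := 32 * (2 * (R:ℝ) + 1) ^ 2 * z ^ 8 / A with he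
  have he0 : 0 ≤ e := by positivity
  have hWY0 := pY.nonneg
  have hWZ0 := pZ.nonneg
  have hz24 : (z:ℝ)^2 ≤ z^8 := pow_le_pow_right₀ hz1' (by norm_num)
  have hz48 : (z:ℝ)^4 ≤ z^8 := pow_le_pow_right₀ hz1' (by norm_num)
  have hRR : (1:ℝ) ≤ (2 * R + 1)^2 := one_le_pow₀ hR1
  have toe : ∀ W : ℝ, W ≤ 16 * (2 * (R:ℝ) + 1) ^ 2 * z ^ 8 → 2 * W / A ≤ e := by
    intro W hW
    rw [he]; exact div_le_div_of_nonneg_right (by linarith) hA'.le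
  have hz8 : (0:ℝ) ≤ z^8 := by positivity
  have hWY' : WY ≤ 2 * z^2 := hWY.trans (by nlinarith [sq_nonneg (z:ℝ)])
  have w1 : WY ≤ 16 * (2 * (R:ℝ) + 1) ^ 2 * z ^ 8 := by nlinarith
  have w2 : WY * WY ≤ 16 * (2 * (R:ℝ) + 1) ^ 2 * z ^ 8 := by
    calc WY * WY ≤ (2 * z^2) * (2*z^2) := by gcongr
      _ = 4 * z^4 := by ring
      _ ≤ 16 * 1 * z^8 := by linarith
      _ ≤ _ := by gcongr
  have w4 : (WY * WY) * (WY * WY) ≤ 16 * (2 * (R:ℝ) + 1) ^ 2 * z ^ 8 := by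
    calc (WY * WY) * (WY * WY) ≤ ((2 * z^2) * (2*z^2)) * ((2 * z^2) * (2*z^2)) := by gcongr
      _ = 16 * 1 * z^8 := by ring
      _ ≤ _ := by gcongr
  have e1 : |avg A Y| ≤ e := by
    have := (pY.avg_le Q hQ perY A hA).trans (toe _ w1)
    rwa [hY1, sub_zero] at this
  have e2 : lam * S / 2 - e ≤ avg A (fun y => Y y ^ 2) := by
    have p2 := (PC.mul pY pY)
    have := (p2.avg_le Q hQ (fun y => by simp only [perY y]) A hA).trans (toe _ w2)
    simp only [← sq] at this
    have := (abs_le.1 this).1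
    linarith
  have e4 : avg A (fun y => Y y ^ 4) ≤ 3 * (lam * S)^2 + 4 * B^2 * (lam * S) + e := by
    have p2 := (PC.mul (PC.mul pY pY) (PC.mul pY pY))
    have := (p2.avg_le Q hQ (fun y => by simp only [perY y]) A hA).trans (toe _ w4)
    have e : ∀ x : ℝ, x * x * (x * x) = x ^ 4 := fun x => by ring
    simp only [e] at this
    have := (abs_le.1 this).2
    linarith
  have hmW : |m| ≤ WZ := by
    refine (abs_avg_le _ _).trans ((avg_mono _ _ (fun _ => WZ) fun y => pZ.abs_le y).trans ?_)
    rw [avg_const _ hQ]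
  have eZ : avg A (fun y => (Z y - m)^2) ≤ X + e := by
    have p1 : PC (fun y => Z y + (fun _ => -m) y) (WZ + |-m|) := PC.add _ _ _ _ pZ (PC.const _)
    have p2 := PC.mul p1 p1
    have hw : (WZ + |-m|) * (WZ + |-m|) ≤ 16 * (2 * (R:ℝ) + 1) ^ 2 * z ^ 8 := by
      rw [abs_neg]
      have hz4 : (0:ℝ) ≤ (2 * R + 1) * z^4 := by positivity
      have : WZ ≤ (2 * R + 1) * z^4 := hWZ.trans (by nlinarith)
      have : WZ + |m| ≤ 2 * ((2 * R + 1) * z^4) := by linarith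
      calc (WZ + |m|) * (WZ + |m|) ≤ (2 * ((2 * R + 1) * z^4)) * (2 * ((2 * R + 1) * z^4)) := by gcongr
        _ = 4 * (2 * (R:ℝ) + 1) ^ 2 * z ^ 8 := by ring
        _ ≤ _ := by gcongr; norm_num
    have := (p2.avg_le Q hQ (fun y => by simp only [perZ y]) A hA).trans (toe _ hw)
    simp only [← sq, ← sub_eq_add_neg] at this
    have := (abs_le.1 this).2
    linarith
  have eZ1 : avg A (fun y => |Z y - m|) ≤ (X + e + 1) / 2 := by
    have h1 : avg A (fun y => |Z y - m|) ≤ avg A (fun y => (1/2) * ((Z y - m)^2) + (fun _ => (1/2)) y) := by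
      apply avg_mono; intro y
      simp only
      exact abs_le_half_sq (Z y - m)
    rw [avg_add, avg_smul, avg_const _ hA] at h1
    linarith
  have hB3 : B ^ 3 ≤ B := pow_le_of_le_one hB0.le hB1 (by norm_num)
  have hB3' : B ^ 3 ≤ 1 := by linarith
  have hB30 : 0 < B ^ 3 := by positivity
  have heB : e ≤ e / B ^ 3 := by rw [le_div_iff₀ hB30]; exact mul_le_of_le_one_right he0 hB3'
  have EY : 5 / 32 * √(lam * S) - 1 - 2 * (e / B^3) ≤ avg A (fun y => |Y y|) := by
    set v := √(lam * S) with hv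
    have hv0 : 0 ≤ v := Real.sqrt_nonneg _
    have hv2 : lam * S = v ^ 2 := (Real.sq_sqrt (mul_nonneg hl0 hS0)).symm
    rw [hv2] at e2 e4
    by_cases hvB : v < B
    · have : 0 ≤ avg A (fun y => |Y y|) := by
        have := avg_mono A (fun _ => 0) (fun y => |Y y|) (fun y => abs_nonneg _)
        rwa [avg_const _ hA] at this
      have : 0 ≤ e / B ^ 3 := by positivity
      linarith
    · push Not at hvB
      have hv1 : 0 < v := hB0.trans_le hvB
      have h1 := r_ineq
      have h2 : avg A (fun y => (1/(2*v)) * (Y y ^ 2) + (-(1/(32*v^3))) * (Y y)^4) ≤ avg A (fun y => |Y y|) := by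
        apply avg_mono; intro y
        have h := h1 (|Y y| / (2 * v)) (by positivity)
        rw [div_pow, div_pow, sq_abs, (by rw [← abs_pow, abs_of_nonneg (by positivity)] : |Y y|^4 = Y y ^ 4)] at h
        have h' := mul_le_mul_of_nonneg_left h (by positivity : 0 ≤ 2 * v)
        calc _ = 2 * v * (Y y ^ 2 / (2 * v) ^ 2 - Y y ^ 4 / (2 * v) ^ 4 / 4) := by field_simp; ring
          _ ≤ _ := h'
          _ = _ := by field_simp
      rw [avg_add (f := fun y => (1/(2*v)) * (Y y ^ 2)) (g := fun y => (-(1/(32*v^3))) * (Y y)^4), avg_smul (f := fun y => Y y ^ 2), avg_smul (f := fun y => Y y ^ 4)] at h2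
      have h3 : (1/(2*v)) * (v^2/2 - e) ≤ (1/(2*v)) * avg A (fun y => Y y ^ 2) := by gcongr
      have h4 : (1/(32*v^3)) * avg A (fun y => Y y ^ 4) ≤ (1/(32*v^3)) * (3 * (v^2)^2 + 4 * B^2 * v^2 + e) := by gcongr
      have h5 : (1/(2*v)) * (v^2/2 - e) = v / 4 - e / v / 2 := by field_simp; ring
      have h6 : (1/(32*v^3)) * (3 * (v^2)^2 + 4 * B^2 * v^2 + e) = 3 * v / 32 + B^2 / v / 8 + e / v^3 / 32 := by
        field_simp; ring
      have h7 : B^2 / v ≤ 1 := by rw [div_le_one hv1]; nlinarith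
      have h8 : e / v ≤ e / B^3 := by gcongr; linarith
      have h9 : e / v^3 ≤ e / B^3 := by gcongr
      have : 0 ≤ e / B ^ 3 := by positivity
      linarith
  have fin1 : avg A (fun y => |(c + m) + Y y|) - avg A (fun y => |Z y - m|) ≤ avg A (fun y => |c + Y y + Z y|) := by
    have : avg A (fun y => |(c + m) + Y y|) ≤ avg A (fun y => |c + Y y + Z y| + |Z y - m|) := by
      apply avg_mono; intro y
      have := abs_sub (c + Y y + Z y) (Z y - m)
      rwa [(by ring : c + Y y + Z y - (Z y - m) = (c + m) + Y y)] at this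
    rw [avg_add] at this
    linarith
  have fin2 : avg A (fun y => |Y y|) ≤ avg A (fun y => |(c + m) + Y y|) + |c + m| := by
    have : avg A (fun y => |Y y|) ≤ avg A (fun y => |(c + m) + Y y| + (fun _ => |c + m|) y) := by
      apply avg_mono; intro y
      have := abs_sub ((c + m) + Y y) (c + m)
      rwa [(by ring : (c + m) + Y y - (c + m) = Y y)] at this
    rwa [avg_add, avg_const _ hA] at this
  have fin3 : |c + m| ≤ avg A (fun y => |(c + m) + Y y|) + e := by
    have h1 := abs_avg_le A (fun y => (c + m) + Y y)
    have h2 : avg A (fun y => (c + m) + Y y) = (c + m) + avg A Y := by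
      have := avg_add A (fun _ => c + m) Y
      rwa [avg_const _ hA] at this
    rw [h2] at h1
    have := abs_sub (c + m + avg A Y) (avg A Y)
    rw [add_sub_cancel_right] at this
    linarith
  have hX0 : 0 ≤ X := mul_nonneg (Finset.sum_nonneg fun _ _ => sq_nonneg _) (by positivity)
  have e5 : 5 * e / B^3 = 5 * (e / B^3) := by ring
  rw [e5]
  linarith


lemma cube_le (t s : ℝ) (hs : 0 < s) : |t| ^ 3 ≤ (s / 2) * t ^ 2 + (1 / (2 * s)) * t ^ 4 := by
  have h : (s / 2) * t ^ 2 + (1 / (2 * s)) * t ^ 4 - |t| ^ 3 = t ^ 2 * (s - |t|) ^ 2 / (2 * s) := by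
    have h4 : t ^ 4 = |t| ^ 4 := by rw [← abs_pow, abs_of_nonneg (by positivity)]
    rw [h4, ← sq_abs t]; field_simp; ring
  have : 0 ≤ t ^ 2 * (s - |t|) ^ 2 / (2 * s) := by positivity
  linarith

lemma U3 (P : Finset ℕ) (hP : ∀ p ∈ P, p.Prime) (z A : ℕ) (hz : ∀ p ∈ P, p ≤ z) (hz1 : 1 ≤ z) (hA : 0 < A)
    (s : ℝ) (hs : 0 < s) :
    avg A (fun y => |∑ p ∈ P, xi 0 1 p y| ^ 3) ≤ 
      (s / 2) * ((∑ p ∈ P, 1 / (p:ℝ)) + 32 * z ^ 8 / A) + 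
      (1 / (2 * s)) * (3 * (∑ p ∈ P, 1 / (p:ℝ)) ^ 2 + 4 * (∑ p ∈ P, 1 / (p:ℝ)) + 32 * z ^ 8 / A) := by
  have hQ : 0 < ∏ q ∈ P, q := Finset.prod_pos fun q hq => (hP q hq).pos
  have hD : ∀ p ∈ P, Nat.Coprime p 1 := fun p _ => Nat.coprime_one_right p
  have hR : ∀ p ∈ P, 2 * (2 * 0 + 1) ≤ p := fun p hp => by simpa using (hP p hp).two_le
  obtain ⟨WY, hWY, pY⟩ := PC_Y P hP 0 1 0 z hR hz (fun _ => 1) 1 (by simp)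
  have hY2 := (Y_sq_bounds P hP 0 1 0 hD hR (fun _ => 1)).2
  rw [← Y_sq P hP 0 1 0 hD hR (fun _ => 1)] at hY2
  have hY4 := Y_four P hP 0 1 0 hD hR (fun _ => 1) 1 (by simp)
  have eY : ∀ p y, Yp 0 1 0 (fun _ => 1) p y = xi 0 1 p y := by
    intro p y; simp [Yp]
  have perY : Function.Periodic (fun y => ∑ p ∈ P, Yp 0 1 0 (fun _ => 1) p y) (∏ q ∈ P, q) := 
    periodic_sumS P (Yp 0 1 0 (fun _ => 1)) (fun p _ => Yp_periodic _ _ _ _ _)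
  simp only [eY] at hY2 hY4 pY perY
  simp only [CharP.cast_eq_zero, neg_zero, Finset.Icc_self, Finset.sum_singleton, one_pow, mul_one] at hY2 hY4
  set lam := ∑ p ∈ P, 1 / (p:ℝ) with hlam
  set Q := ∏ q ∈ P, q with hQdef
  set Y := fun y => ∑ p ∈ P, xi 0 1 p y with hYdef
  have hA' : (0:ℝ) < A := by exact_mod_cast hA
  have hz1' : (1:ℝ) ≤ z := by exact_mod_cast hz1
  set e := 32 * (z:ℝ) ^ 8 / A with he
  have hWY0 := pY.nonneg
  have hz48 : (z:ℝ)^4 ≤ z^8 := pow_le_pow_right₀ hz1' (by norm_num)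
  have toe : ∀ W : ℝ, W ≤ 16 * z ^ 8 → 2 * W / A ≤ e := by
    intro W hW
    rw [he]; exact div_le_div_of_nonneg_right (by linarith) hA'.le
  rw [mul_one] at hWY
  have w2 : WY * WY ≤ 16 * z ^ 8 := by
    calc WY * WY ≤ (2 * z^2) * (2*z^2) := by gcongr
      _ = 4 * z^4 := by ring
      _ ≤ 16 * z^8 := by have : (0:ℝ) ≤ z ^ 4 := by positivity
                         linarith
  have w4 : (WY * WY) * (WY * WY) ≤ 16 * z ^ 8 := by
    calc (WY * WY) * (WY * WY) ≤ ((2 * z^2) * (2*z^2)) * ((2 * z^2) * (2*z^2)) := by gcongr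
      _ = 16 * z^8 := by ring
  have e2 : avg A (fun y => Y y ^ 2) ≤ lam + e := by
    have p2 := (PC.mul pY pY)
    have := (p2.avg_le Q hQ (fun y => by simp only [perY y]) A hA).trans (toe _ w2)
    simp only [← sq] at this
    have := (abs_le.1 this).2
    linarith
  have e4 : avg A (fun y => Y y ^ 4) ≤ 3 * lam^2 + 4 * lam + e := by
    have p2 := (PC.mul (PC.mul pY pY) (PC.mul pY pY))
    have := (p2.avg_le Q hQ (fun y => by simp only [perY y]) A hA).trans (toe _ w4)
    have e : ∀ x : ℝ, x * x * (x * x) = x ^ 4 := fun x => by ring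
    simp only [e] at this
    have := (abs_le.1 this).2
    linarith
  have h2 : avg A (fun y => |Y y| ^ 3) ≤ avg A (fun y => (s/2) * (Y y ^ 2) + (1/(2*s)) * (Y y)^4) := 
    avg_mono _ _ _ fun y => cube_le _ _ hs
  rw [avg_add (f := fun y => (s/2) * (Y y ^ 2)) (g := fun y => (1/(2*s)) * (Y y)^4), avg_smul (f := fun y => Y y ^ 2), avg_smul (f := fun y => Y y ^ 4)] at h2
  refine h2.trans ?_
  gcongr



noncomputable def rr (w : ℕ → ℕ) (N v : ℕ) : ℕ := ((Finset.Icc 1 N).filter fun n => n + w n = v).card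

lemma G_eq (w : ℕ → ℕ) (N E : ℕ) (hE : ∀ n ∈ Finset.Icc 1 N, n + w n ≤ N + E) :
    (G w N : ℤ) = ∑ v ∈ Finset.Icc 1 (N + E), ((rr w N v : ℤ) * rr w N v - rr w N v) := by
  classical
  have h1 : G w N = (((Finset.Icc 1 N) ×ˢ (Finset.Icc 1 N)).filter 
      (fun q : ℕ × ℕ => q.1 + w q.1 = q.2 + w q.2 ∧ q.1 ≠ q.2)).card := by
    unfold G
    rw [← Set.ncard_coe_finset]
    congr 1
    ext q
    simp only [Set.mem_setOf_eq, Set.mem_Icc, Finset.coe_filter, Finset.mem_product, Finset.mem_Icc]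
    tauto
  rw [h1, Finset.card_eq_sum_card_fiberwise (f := fun q : ℕ × ℕ => q.1 + w q.1) (t := Finset.Icc 1 (N + E))]
  · push_cast
    refine Finset.sum_congr rfl fun v _ => ?_
    have : Finset.filter (fun q : ℕ × ℕ => q.1 + w q.1 = v) (((Finset.Icc 1 N) ×ˢ (Finset.Icc 1 N)).filter 
      (fun q : ℕ × ℕ => q.1 + w q.1 = q.2 + w q.2 ∧ q.1 ≠ q.2)) = 
        ((Finset.Icc 1 N).filter fun n => n + w n = v).offDiag := by
      ext q
      simp only [Finset.mem_filter, Finset.mem_product, Finset.mem_offDiag]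
      constructor
      · rintro ⟨⟨⟨a, b⟩, c, d⟩, e⟩
        exact ⟨⟨a, e⟩, ⟨b, by rw [← c, e]⟩, d⟩
      · rintro ⟨⟨a, e⟩, ⟨b, c⟩, d⟩
        exact ⟨⟨⟨a, b⟩, by rw [e, c], d⟩, e⟩
    rw [this, Finset.offDiag_card]
    unfold rr
    rw [Nat.cast_sub (Nat.le_mul_self _)]
    push_cast; ring
  · intro q hq
    simp only [Finset.coe_filter, Finset.mem_product, Set.mem_setOf_eq] at hq
    have := hE q.1 hq.1.1
    have h2 := (Finset.mem_Icc.1 hq.1.1).1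
    simp only [Finset.coe_Icc, Set.mem_Icc]
    omega

lemma sum_rr (w : ℕ → ℕ) (N E : ℕ) (hE : ∀ n ∈ Finset.Icc 1 N, n + w n ≤ N + E) :
    ∑ v ∈ Finset.Icc 1 (N + E), (rr w N v : ℤ) = N := by
  have := Finset.card_eq_sum_card_fiberwise (s := Finset.Icc 1 N) (f := fun n => n + w n) (t := Finset.Icc 1 (N + E)) (by
    intro n hn
    have h1 := hE n hn
    have h2 := (Finset.mem_Icc.1 (Finset.mem_coe.1 hn)).1
    simp only [Finset.coe_Icc, Set.mem_Icc]
    omega)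
  simp only [Nat.card_Icc, add_tsub_cancel_right] at this
  unfold rr
  exact_mod_cast this.symm

lemma sum_abs_rr (w : ℕ → ℕ) (N E : ℕ) (hE : ∀ n ∈ Finset.Icc 1 N, n + w n ≤ N + E) :
    ∑ v ∈ Finset.Icc 1 N, |(rr w N v : ℝ) - 1| ≤ 2 * G w N + E := by
  have hZ : ∑ v ∈ Finset.Icc 1 N, |(rr w N v : ℤ) - 1| ≤ 2 * G w N + E := by
    calc _ ≤ ∑ v ∈ Finset.Icc 1 (N + E), |(rr w N v : ℤ) - 1| := 
          Finset.sum_le_sum_of_subset_of_nonneg (Finset.Icc_subset_Icc_right (by omega)) (fun _ _ _ => abs_nonneg _)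
      _ ≤ ∑ v ∈ Finset.Icc 1 (N + E), (2 * ((rr w N v : ℤ) * rr w N v - rr w N v) - (rr w N v - 1)) := by
          refine Finset.sum_le_sum fun v _ => ?_
          generalize rr w N v = r
          rcases r with _ | r
          · simp
          · push_cast
            rw [abs_of_nonneg (by linarith [Int.natCast_nonneg r])]
            have : (0:ℤ) ≤ r := Int.natCast_nonneg r
            nlinarith [Int.le_self_sq r]
      _ = _ := by
          rw [Finset.sum_sub_distrib, ← Finset.mul_sum, ← G_eq w N E hE, Finset.sum_sub_distrib, sum_rr w N E hE]
          simp
  exact_mod_cast hZ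

lemma F_sub (w : ℕ → ℕ) (N H x : ℕ) (Φ : ℤ → ℝ) (hΦ : ∀ k : ℤ, (H:ℤ) < |k| → Φ k = 0) (hx1 : H + 1 ≤ x) (hx2 : x + H ≤ N) :
    ∑ n ∈ Finset.Icc 1 N, Φ ((n:ℤ) + w n - x) - ∑ k ∈ Finset.Icc (-(H:ℤ)) H, Φ k = 
    ∑ v ∈ Finset.Icc 1 N, ((rr w N v : ℝ) - 1) * Φ ((v:ℤ) - x) := by
  classical
  simp only [sub_mul, Finset.sum_sub_distrib, one_mul]
  congr 1
  · have h1 : ∀ v, (rr w N v : ℝ) * Φ ((v:ℤ) - x) = ∑ n ∈ Finset.Icc 1 N, if n + w n = v then Φ ((n:ℤ) + w n - x) else 0 := by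
      intro v
      rw [← Finset.sum_filter]
      unfold rr
      rw [← nsmul_eq_mul, ← Finset.sum_const]
      refine Finset.sum_congr rfl fun n hn => ?_
      rw [← (Finset.mem_filter.1 hn).2]; push_cast; rfl
    simp only [h1]
    rw [Finset.sum_comm]
    refine Finset.sum_congr rfl fun n hn => ?_
    rw [Finset.sum_ite_eq]
    split_ifs with h
    · rfl
    · have hn := (Finset.mem_Icc.1 hn).1
      simp only [Finset.mem_Icc, not_and, not_le] at h
      have := h (by omega)
      apply hΦ
      rw [abs_of_nonneg (by omega)]
      omega
  · have : ∑ v ∈ Finset.Icc 1 N, Φ ((v:ℤ) - x) = ∑ v ∈ Finset.Icc (x - H) (x + H), Φ ((v:ℤ) - x) := by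
      symm
      apply Finset.sum_subset (Finset.Icc_subset_Icc (by omega) hx2)
      intro v _ hv
      apply hΦ
      simp only [Finset.mem_Icc, not_and, not_le] at hv
      by_cases h : x - H ≤ v
      · have := hv h
        rw [abs_of_nonneg (by omega)]; omega
      · rw [abs_of_neg (by omega)]; omega
    rw [this]
    symm
    refine Finset.sum_bij' (fun v _ => (v:ℤ) - x) (fun k _ => (k + x).toNat) ?_ ?_ ?_ ?_ ?_
    · intro v hv; simp only [Finset.mem_Icc] at *; omega
    · intro v hv; simp only [Finset.mem_Icc] at *; omega
    · intro v hv; simp only [Finset.mem_Icc] at *; omega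
    · intro v hv; simp only [Finset.mem_Icc] at *; omega
    · intro v hv; rfl

lemma F_sum (w : ℕ → ℕ) (N H E : ℕ) (Φ : ℤ → ℝ) (hΦ : ∀ k : ℤ, (H:ℤ) < |k| → Φ k = 0) (hΦ1 : ∀ k, |Φ k| ≤ 1)
    (hE : ∀ n ∈ Finset.Icc 1 N, n + w n ≤ N + E) (X : Finset ℕ) (hX : ∀ x ∈ X, H + 1 ≤ x ∧ x + H ≤ N) :
    ∑ x ∈ X, |∑ n ∈ Finset.Icc 1 N, Φ ((n:ℤ) + w n - x) - ∑ k ∈ Finset.Icc (-(H:ℤ)) H, Φ k| ≤ 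
    (2 * H + 1) * (2 * G w N + E) := by
  calc _ ≤ ∑ x ∈ X, ∑ v ∈ Finset.Icc 1 N, |(rr w N v : ℝ) - 1| * |Φ ((v:ℤ) - x)| := by
        refine Finset.sum_le_sum fun x hx => ?_
        rw [F_sub w N H x Φ hΦ (hX x hx).1 (hX x hx).2]
        refine (Finset.abs_sum_le_sum_abs _ _).trans (le_of_eq ?_)
        simp only [abs_mul]
    _ = ∑ v ∈ Finset.Icc 1 N, |(rr w N v : ℝ) - 1| * ∑ x ∈ X, |Φ ((v:ℤ) - x)| := by
        rw [Finset.sum_comm]; simp only [Finset.mul_sum]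
    _ ≤ ∑ v ∈ Finset.Icc 1 N, |(rr w N v : ℝ) - 1| * (2 * H + 1) := by
        refine Finset.sum_le_sum fun v _ => mul_le_mul_of_nonneg_left ?_ (abs_nonneg _)
        calc _ ≤ ∑ x ∈ X, if |(v:ℤ) - x| ≤ H then (1:ℝ) else 0 := by
              refine Finset.sum_le_sum fun x _ => ?_
              split_ifs with h
              · exact hΦ1 _
              · rw [hΦ _ (by omega), abs_zero]
          _ = ((X.filter fun x : ℕ => |(v:ℤ) - x| ≤ H).card : ℝ) := by
              rw [← Finset.sum_filter, Finset.sum_const, nsmul_eq_mul, mul_one]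
          _ ≤ ((Finset.Icc (v - H) (v + H)).card : ℝ) := by
              gcongr
              intro x hx
              have := (abs_le.1 (Finset.mem_filter.1 hx).2)
              rw [Finset.mem_Icc]; omega
          _ ≤ _ := by
              rw [Nat.card_Icc]
              have : v + H + 1 - (v - H) ≤ 2 * H + 1 := by omega
              exact_mod_cast this
    _ ≤ _ := by
        rw [← Finset.sum_mul, mul_comm]
        gcongr
        exact sum_abs_rr w N E hE


lemma w_one (w : ℕ → ℕ) (hw : ∀ m n : ℕ, 1 ≤ m → 1 ≤ n → Nat.Coprime m n → w (m * n) = w m + w n) : w 1 = 0 := by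
  have := hw 1 1 le_rfl le_rfl (by simp)
  simp at this; exact this

lemma w_sum (w : ℕ → ℕ) (hw : ∀ m n : ℕ, 1 ≤ m → 1 ≤ n → Nat.Coprime m n → w (m * n) = w m + w n) (n : ℕ) :
    1 ≤ n → w n = ∑ p ∈ n.primeFactors, w (p ^ n.factorization p) := by
  induction n using Nat.recOnPosPrimePosCoprime with
  | prime_pow p k hp hk => 
    intro _
    rw [Nat.primeFactors_prime_pow hk.ne' hp, Finset.sum_singleton, hp.factorization_pow]
    simp
  | zero => intro h; omega
  | one => intro _; simp [w_one w hw]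
  | coprime a b ha hb hab iha ihb =>
    intro _
    rw [hw a b ha.le hb.le hab, iha ha.le, ihb hb.le, hab.primeFactors_mul, 
      Finset.sum_union hab.disjoint_primeFactors]
    congr 1
    · refine Finset.sum_congr rfl fun p hp => ?_
      rw [Nat.factorization_mul (by omega) (by omega), Finsupp.add_apply]
      have : b.factorization p = 0 := by
        rw [← Finsupp.notMem_support_iff, Nat.support_factorization]
        exact Finset.disjoint_left.1 hab.disjoint_primeFactors hp
      rw [this, add_zero]
    · refine Finset.sum_congr rfl fun p hp => ?_
      rw [Nat.factorization_mul (by omega) (by omega), Finsupp.add_apply]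
      have : a.factorization p = 0 := by
        rw [← Finsupp.notMem_support_iff, Nat.support_factorization]
        exact Finset.disjoint_right.1 hab.disjoint_primeFactors hp
      rw [this, zero_add]

lemma pow_le_cube (n B p : ℕ) (hn : 1 ≤ n) (hsq : ∀ d, B < d → ¬ d ^ 2 ∣ n) (hp : p.Prime) (hv : 2 ≤ n.factorization p) :
    p ^ n.factorization p ≤ B ^ 3 := by
  set v := n.factorization p
  have h1 : (p ^ (v / 2)) ^ 2 ∣ n := by
    rw [← pow_mul]
    exact (pow_dvd_pow p (by omega)).trans (Nat.ordProj_dvd n p)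
  have h2 : p ^ (v / 2) ≤ B := by
    by_contra h
    exact hsq _ (not_le.1 h) h1
  calc p ^ v ≤ p ^ ((v / 2) * 3) := Nat.pow_le_pow_right hp.pos (by omega)
    _ = (p ^ (v/2)) ^ 3 := by rw [pow_mul]
    _ ≤ B ^ 3 := Nat.pow_le_pow_left h2 3

lemma w_le (w : ℕ → ℕ) (hw : ∀ m n : ℕ, 1 ≤ m → 1 ≤ n → Nat.Coprime m n → w (m * n) = w m + w n)
    (hq : ∀ q : ℕ, q.Prime → w q = 1) (C ε : ℝ) (hC : 0 < C) (hε : 0 < ε) (hε1 : ε < 1)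
    (hb : ∀ n : ℕ, 1 ≤ n → (w n : ℝ) ≤ C * (n:ℝ) ^ ε) (n B : ℕ) (hn : 1 ≤ n) (hsq : ∀ d, B < d → ¬ d ^ 2 ∣ n) :
    (w n : ℝ) ≤ n.primeFactors.card * (1 + C * (B:ℝ) ^ 3) := by
  rw [w_sum w hw n hn]
  push_cast
  rw [← nsmul_eq_mul]
  refine Finset.sum_le_card_nsmul _ _ _ fun p hp => ?_
  have hpp := Nat.prime_of_mem_primeFactors hp
  have hv : 1 ≤ n.factorization p := by
    rw [← Nat.support_factorization] at hp
    exact Nat.one_le_iff_ne_zero.2 (Finsupp.mem_support_iff.1 hp)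
  rcases hv.eq_or_lt with h | h
  · rw [← h, pow_one, hq p hpp]
    have : 0 ≤ C * (B:ℝ)^3 := by positivity
    push_cast; linarith
  · have h3 := pow_le_cube n B p hn hsq hpp h
    have h1 : 1 ≤ p ^ n.factorization p := Nat.one_le_pow _ _ hpp.pos
    have h1' : (1:ℝ) ≤ ((p ^ n.factorization p : ℕ):ℝ) := by exact_mod_cast h1
    refine (hb _ h1).trans ?_
    have h4 : (((p ^ n.factorization p : ℕ):ℝ)) ^ ε ≤ ((p ^ n.factorization p : ℕ):ℝ) := by
      simpa using Real.rpow_le_rpow_of_exponent_le h1' hε1.le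
    have h5 : ((p ^ n.factorization p : ℕ):ℝ) ≤ (B:ℝ) ^ 3 := by exact_mod_cast h3
    nlinarith

lemma w_decomp (w : ℕ → ℕ) (hw : ∀ m n : ℕ, 1 ≤ m → 1 ≤ n → Nat.Coprime m n → w (m * n) = w m + w n)
    (hq : ∀ q : ℕ, q.Prime → w q = 1) (n B M : ℕ) (hn : 1 ≤ n) (hsq : ∀ d, B < d → ¬ d ^ 2 ∣ n) (hB : 1 ≤ B) (hBM : B ^ 3 ≤ M) :
    w n = w (Nat.gcd n M.factorial) + (n.primeFactors.filter (fun p => M < p)).card := by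
  have hM0 : M.factorial ≠ 0 := Nat.factorial_ne_zero _
  have hg : 1 ≤ Nat.gcd n M.factorial := Nat.gcd_pos_of_pos_left _ hn
  rw [w_sum w hw n hn, w_sum w hw _ hg, ← Finset.sum_filter_add_sum_filter_not n.primeFactors (fun p => M < p), add_comm]
  congr 1
  · have e : (Nat.gcd n M.factorial).primeFactors = n.primeFactors.filter (fun p => ¬ M < p) := by
      rw [Nat.primeFactors_gcd (by omega) hM0]
      ext p
      simp only [Finset.mem_inter, Finset.mem_filter, Nat.mem_primeFactors, not_lt]
      constructor
      · rintro ⟨h1, h2⟩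
        exact ⟨h1, (h2.1.dvd_factorial).1 h2.2.1⟩
      · rintro ⟨h1, h2⟩
        exact ⟨h1, h1.1, (h1.1.dvd_factorial).2 h2, hM0⟩
    rw [e]
    refine Finset.sum_congr rfl fun p hp => ?_
    obtain ⟨hp1, hp2⟩ := Finset.mem_filter.1 hp
    have hpp := Nat.prime_of_mem_primeFactors hp1
    rw [Nat.factorization_gcd (by omega) hM0, Finsupp.inf_apply, min_eq_left]
    rw [← hpp.pow_dvd_iff_le_factorization hM0]
    apply Nat.dvd_factorial (pow_pos hpp.pos _)
    rcases lt_or_ge (n.factorization p) 2 with h | h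
    · calc p ^ n.factorization p ≤ p ^ 1 := Nat.pow_le_pow_right hpp.pos (by omega)
        _ ≤ M := by simpa using hp2
    · exact (pow_le_cube n B p hn hsq hpp h).trans hBM
  · rw [Finset.card_eq_sum_ones]
    refine Finset.sum_congr rfl fun p hp => ?_
    obtain ⟨hp1, hp2⟩ := Finset.mem_filter.1 hp
    have hpp := Nat.prime_of_mem_primeFactors hp1
    have hv : 1 ≤ n.factorization p := by
      rw [← Nat.support_factorization] at hp1
      exact Nat.one_le_iff_ne_zero.2 (Finsupp.mem_support_iff.1 hp1)
    have : n.factorization p < 2 := by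
      by_contra h
      refine hsq p ?_ ((pow_dvd_pow p (not_lt.1 h)).trans (Nat.ordProj_dvd n p))
      calc B ≤ B ^ 3 := Nat.le_self_pow (by norm_num) B
        _ ≤ M := hBM
        _ < p := hp2
    rw [(by omega : n.factorization p = 1), pow_one, hq p hpp]

lemma card_big (n z N : ℕ) (hn : 1 ≤ n) (hnN : n ≤ N) (hz : N < (z + 1) ^ 16) :
    (n.primeFactors.filter (fun p => z < p)).card ≤ 15 := by
  by_contra h
  have h1 : (z + 1) ^ (n.primeFactors.filter (fun p => z < p)).card ≤ ∏ p ∈ n.primeFactors.filter (fun p => z < p), p :=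
    Finset.pow_card_le_prod _ _ _ fun p hp => (Finset.mem_filter.1 hp).2
  have h2 : ∏ p ∈ n.primeFactors.filter (fun p => z < p), p ≤ n := by
    apply Nat.le_of_dvd hn
    exact (Finset.prod_dvd_prod_of_subset _ _ _ (Finset.filter_subset _ _)).trans (Nat.prod_primeFactors_dvd n)
  have h3 : (z + 1) ^ 16 ≤ (z + 1) ^ (n.primeFactors.filter (fun p => z < p)).card :=
    Nat.pow_le_pow_right (by omega) (by omega)
  omega

open Classical in
lemma count_sq (N B : ℕ) (hB : 1 ≤ B) :
    (((Finset.Icc 1 N).filter fun n => ∃ d, B < d ∧ d ^ 2 ∣ n).card : ℝ) ≤ N / B := by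
  have hsub : ((Finset.Icc 1 N).filter fun n => ∃ d, B < d ∧ d ^ 2 ∣ n) ⊆ 
      (Finset.Ioc B (max B N)).biUnion fun d => (Finset.Ioc 0 N).filter fun n => d ^ 2 ∣ n := by
    intro n hn
    simp only [Finset.mem_filter, Finset.mem_Icc] at hn
    obtain ⟨⟨h1, h2⟩, d, hd, hdn⟩ := hn
    simp only [Finset.mem_biUnion, Finset.mem_Ioc, Finset.mem_filter]
    refine ⟨d, ⟨hd, le_max_of_le_right ?_⟩, ⟨by omega, h2⟩, hdn⟩
    exact ((Nat.le_self_pow (by norm_num) d).trans (Nat.le_of_dvd (by omega) hdn)).trans h2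
  have h1 := (Finset.card_le_card hsub).trans Finset.card_biUnion_le
  have h2 : (((Finset.Icc 1 N).filter fun n => ∃ d, B < d ∧ d ^ 2 ∣ n).card : ℝ) ≤ 
      ∑ d ∈ Finset.Ioc B (max B N), (N:ℝ) * ((d:ℝ) ^ 2)⁻¹ := by
    calc _ ≤ ((∑ d ∈ Finset.Ioc B (max B N), ((Finset.Ioc 0 N).filter fun n => d ^ 2 ∣ n).card : ℕ) : ℝ) := by exact_mod_cast h1
      _ ≤ _ := by
        push_cast
        refine Finset.sum_le_sum fun d _ => ?_
        rw [Nat.Ioc_filter_dvd_card_eq_div, ← div_eq_mul_inv]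
        refine Nat.cast_div_le.trans (le_of_eq (by push_cast; rfl))
  refine h2.trans ?_
  rw [← Finset.mul_sum, div_eq_mul_inv]
  gcongr
  have := sum_Ioc_inv_sq_le_sub (α := ℝ) (by omega : B ≠ 0) (le_max_left B N)
  have h0 : (0:ℝ) ≤ ((max B N : ℕ):ℝ)⁻¹ := by positivity
  linarith

lemma sum_primes_le (M : ℕ) : ∑ p ∈ (Finset.Icc 1 M).filter Nat.Prime, 1 / (p:ℝ) ≤ 1 + Real.log M := by
  refine le_trans ?_ (harmonic_le_one_add_log M)
  rw [harmonic_eq_sum_Icc]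
  push_cast
  simp only [one_div]
  exact Finset.sum_le_sum_of_subset_of_nonneg (Finset.filter_subset _ _) (fun _ _ _ => by positivity)

lemma count_omega (N M : ℕ) (J : ℝ) (hJ : 0 < J) :
    (((Finset.Icc 1 N).filter fun n => J < ((n.primeFactors.filter (fun p => p ≤ M)).card : ℝ)).card : ℝ) ≤ 
      N * (1 + Real.log M) / J := by
  rw [le_div_iff₀ hJ, ← nsmul_eq_mul]
  calc _ ≤ ∑ n ∈ (Finset.Icc 1 N).filter fun n => J < ((n.primeFactors.filter (fun p => p ≤ M)).card : ℝ), 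
        ((n.primeFactors.filter (fun p => p ≤ M)).card : ℝ) := 
        Finset.card_nsmul_le_sum _ _ _ fun n hn => (Finset.mem_filter.1 hn).2.le
    _ ≤ ∑ n ∈ Finset.Icc 1 N, ((n.primeFactors.filter (fun p => p ≤ M)).card : ℝ) := 
        Finset.sum_le_sum_of_subset_of_nonneg (Finset.filter_subset _ _) (fun _ _ _ => by positivity)
    _ = ∑ n ∈ Finset.Icc 1 N, ∑ p ∈ (Finset.Icc 1 M).filter Nat.Prime, if p ∣ n then (1:ℝ) else 0 := by
        refine Finset.sum_congr rfl fun n hn => ?_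
        rw [← Finset.sum_filter, Finset.sum_const, nsmul_eq_mul, mul_one]
        congr 2
        ext p
        have := (Finset.mem_Icc.1 hn).1
        simp only [Finset.mem_filter, Nat.mem_primeFactors, Finset.mem_Icc]
        constructor
        · rintro ⟨⟨a, b, c⟩, d⟩; exact ⟨⟨⟨a.one_lt.le, d⟩, a⟩, b⟩
        · rintro ⟨⟨⟨a, b⟩, c⟩, d⟩; exact ⟨⟨c, d, by omega⟩, b⟩
    _ = ∑ p ∈ (Finset.Icc 1 M).filter Nat.Prime, ((N / p : ℕ) : ℝ) := by
        rw [Finset.sum_comm]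
        refine Finset.sum_congr rfl fun p _ => ?_
        rw [← Nat.Ioc_filter_dvd_card_eq_div, ← Finset.sum_filter, Finset.sum_const, nsmul_eq_mul, mul_one]
        rfl
    _ ≤ ∑ p ∈ (Finset.Icc 1 M).filter Nat.Prime, (N:ℝ) * (1 / p) := by
        refine Finset.sum_le_sum fun p _ => ?_
        rw [mul_one_div]; exact Nat.cast_div_le
    _ ≤ _ := by
        rw [← Finset.mul_sum]
        gcongr
        exact sum_primes_le M


def PP (M z : ℕ) : Finset ℕ := (Finset.Icc 1 z).filter (fun p => p.Prime ∧ M < p)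
def uu (M z n : ℕ) : ℕ := ((PP M z).filter (fun p => p ∣ n)).card
def tt (w : ℕ → ℕ) (M T n : ℕ) : ℕ := if w (Nat.gcd n M.factorial) ≤ T then w (Nat.gcd n M.factorial) else 0

lemma win (X : Finset ℕ) (c : ℝ) (H : ℕ) : ((X.filter fun x : ℕ => |c - x| ≤ H).card : ℝ) ≤ 2 * H + 1 := by
  have h1 : ((X.filter fun x : ℕ => |c - x| ≤ H).card) ≤ (Finset.Icc ⌈c - H⌉ ⌊c + H⌋).card := by
    apply Finset.card_le_card_of_injOn (fun x : ℕ => (x : ℤ))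
    · intro x hx
      have := (abs_le.1 (Finset.mem_filter.1 (Finset.mem_coe.1 hx)).2)
      simp only [Finset.coe_Icc, Set.mem_Icc, Int.ceil_le, Int.le_floor]
      push_cast
      constructor <;> linarith
    · intro x _ y _ h
      simpa using h
  rw [Int.card_Icc] at h1
  have h2 : ⌊c + H⌋ - ⌈c - H⌉ ≤ 2 * H := by
    have a1 := Int.floor_le (c + H)
    have a2 := Int.le_ceil (c - H)
    have : ((⌊c + H⌋ - ⌈c - H⌉ : ℤ) : ℝ) ≤ ((2 * H : ℤ) : ℝ) := by push_cast; linarith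
    exact_mod_cast this
  have h3 : ((X.filter fun x : ℕ => |c - x| ≤ H).card) ≤ 2 * H + 1 := by omega
  exact_mod_cast h3

lemma win2 (X : Finset ℕ) (c1 c2 : ℝ) (H : ℕ) (f : ℕ → ℝ) (δ : ℝ) (hδ : 0 ≤ δ) (h1 : ∀ x, |f x| ≤ δ)
    (h2 : ∀ x : ℕ, (H:ℝ) < |c1 - x| → (H:ℝ) < |c2 - x| → f x = 0) :
    ∑ x ∈ X, |f x| ≤ 2 * (2 * H + 1) * δ := by
  calc _ ≤ ∑ x ∈ X, ((if |c1 - x| ≤ H then δ else 0) + (if |c2 - x| ≤ H then δ else 0)) := by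
        refine Finset.sum_le_sum fun x _ => ?_
        have := h1 x
        split_ifs with a b b
        · linarith
        · linarith
        · linarith
        · rw [h2 x (not_le.1 a) (not_le.1 b)]; simp
    _ = (X.filter fun x : ℕ => |c1 - x| ≤ H).card * δ + (X.filter fun x : ℕ => |c2 - x| ≤ H).card * δ := by
        rw [Finset.sum_add_distrib, ← Finset.sum_filter, ← Finset.sum_filter, Finset.sum_const, Finset.sum_const, nsmul_eq_mul, nsmul_eq_mul]
    _ ≤ (2 * H + 1) * δ + (2 * H + 1) * δ := by
        gcongr <;> exact win _ _ _
    _ = _ := by ring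

lemma uu_add (M z n : ℕ) (hn : 1 ≤ n) (hMz : M ≤ z) : (n.primeFactors.filter (fun p => M < p)).card = 
    uu M z n + (n.primeFactors.filter (fun p => z < p)).card := by
  classical
  unfold uu PP
  rw [← Finset.card_union_of_disjoint]
  · congr 1
    ext p
    simp only [Finset.mem_filter, Finset.mem_union, Nat.mem_primeFactors, Finset.mem_Icc]
    constructor
    · rintro ⟨⟨a, b, c⟩, d⟩
      rcases le_or_gt p z with h | h
      · exact Or.inl ⟨⟨⟨a.one_lt.le, h⟩, a, d⟩, b⟩
      · exact Or.inr ⟨⟨a, b, c⟩, h⟩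
    · rintro (⟨⟨⟨a, b⟩, c, d⟩, e⟩ | ⟨⟨a, b, c⟩, d⟩)
      · exact ⟨⟨c, e, by omega⟩, d⟩
      · exact ⟨⟨a, b, c⟩, by omega⟩
  · rw [Finset.disjoint_left]
    intro p h1 h2
    simp only [Finset.mem_filter, Finset.mem_Icc] at h1 h2
    omega

lemma good_n (w : ℕ → ℕ) (hw : ∀ m n : ℕ, 1 ≤ m → 1 ≤ n → Nat.Coprime m n → w (m * n) = w m + w n)
    (hq : ∀ q : ℕ, q.Prime → w q = 1) (C ε : ℝ) (hC : 0 < C) (hε : 0 < ε) (hε1 : ε < 1)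
    (hb : ∀ n : ℕ, 1 ≤ n → (w n : ℝ) ≤ C * (n:ℝ) ^ ε) (N B M T z : ℕ) (J : ℝ) (hB : 1 ≤ B) (hBM : B ^ 3 ≤ M)
    (hMz : M ≤ z) (hT : J * (1 + C * (B:ℝ)^3) ≤ T) (hz : N < (z+1)^16) (n : ℕ) (hn : 1 ≤ n) (hnN : n ≤ N)
    (h1 : ¬ ∃ d, B < d ∧ d ^ 2 ∣ n) (h2 : ¬ J < ((n.primeFactors.filter (fun p => p ≤ M)).card : ℝ)) :
    ∃ t, t ≤ 15 ∧ w n = tt w M T n + uu M z n + t := by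
  have hsq : ∀ d, B < d → ¬ d ^ 2 ∣ n := fun d hd h => h1 ⟨d, hd, h⟩
  refine ⟨_, card_big n z N hn hnN hz, ?_⟩
  rw [w_decomp w hw hq n B M hn hsq hB hBM, uu_add M z n hn hMz]
  have : tt w M T n = w (Nat.gcd n M.factorial) := by
    unfold tt
    rw [if_pos]
    have h3 := w_le w hw hq C ε hC hε hε1 hb (Nat.gcd n M.factorial) B (Nat.gcd_pos_of_pos_left _ hn) 
      (fun d hd h => hsq d hd (h.trans (Nat.gcd_dvd_left _ _)))
    have h4 : (Nat.gcd n M.factorial).primeFactors ⊆ n.primeFactors.filter (fun p => p ≤ M) := by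
      intro p hp
      rw [Nat.primeFactors_gcd (by omega) (Nat.factorial_ne_zero _), Finset.mem_inter] at hp
      rw [Finset.mem_filter]
      exact ⟨hp.1, ((Nat.prime_of_mem_primeFactors hp.1).dvd_factorial).1 (Nat.dvd_of_mem_primeFactors hp.2)⟩
    have h5 : ((Nat.gcd n M.factorial).primeFactors.card : ℝ) ≤ J := by
      refine le_trans ?_ (not_lt.1 h2)
      exact_mod_cast Finset.card_le_card h4
    have : (w (Nat.gcd n M.factorial) : ℝ) ≤ T := by
      refine h3.trans (le_trans ?_ hT)
      gcongr
    exact_mod_cast this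
  rw [this]; ring

set_option maxHeartbeats 1000000 in
open Classical in
lemma F_compare (w : ℕ → ℕ) (hw : ∀ m n : ℕ, 1 ≤ m → 1 ≤ n → Nat.Coprime m n → w (m * n) = w m + w n)
    (hq : ∀ q : ℕ, q.Prime → w q = 1) (C ε : ℝ) (hC : 0 < C) (hε : 0 < ε) (hε1 : ε < 1)
    (hb : ∀ n : ℕ, 1 ≤ n → (w n : ℝ) ≤ C * (n:ℝ) ^ ε) (N H M T z : ℕ) (hH : 1 ≤ H) (hBM : H ^ 3 ≤ M)
    (hMz : M ≤ z) (hT : (H:ℝ) ^ 2 * (1 + C * (H:ℝ)^3) ≤ T) (hz : N < (z+1)^16) (hlog : 1 + Real.log M ≤ H)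
    (Ψ : ℝ → ℝ) (b1 : ℝ) (hb1 : 0 ≤ b1) (hΨ1 : ∀ t, |Ψ t| ≤ 1) (hΨ0 : ∀ t, 1 < |t| → Ψ t = 0) 
    (hΨl : ∀ s t, |Ψ s - Ψ t| ≤ b1 * |s - t|) (X : Finset ℕ) :
    ∑ x ∈ X, |∑ n ∈ Finset.Icc 1 N, Ψ (((n:ℝ) + w n - x) / H) - 
      ∑ n ∈ Finset.Icc 1 N, Ψ (((n:ℝ) + tt w M T n + uu M z n - x) / H)| ≤ (90 * b1 + 24) * N := by
  have hH' : (1:ℝ) ≤ H := by exact_mod_cast hH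
  have hH0 : (0:ℝ) < H := by linarith
  have supp : ∀ c : ℝ, ∀ x : ℕ, (H:ℝ) < |c - x| → Ψ ((c - x) / H) = 0 := by
    intro c x h
    apply hΨ0
    rw [abs_div, abs_of_pos hH0, lt_div_iff₀ hH0]; linarith
  set b1set := (Finset.Icc 1 N).filter fun n => ∃ d, H < d ∧ d ^ 2 ∣ n with hbs1
  set b2set := (Finset.Icc 1 N).filter fun n => (H:ℝ)^2 < ((n.primeFactors.filter (fun p => p ≤ M)).card : ℝ) with hbs2
  have c1 : (b1set.card : ℝ) ≤ N / H := count_sq N H hH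
  have c2 : (b2set.card : ℝ) ≤ N / H := by
    refine (count_omega N M ((H:ℝ)^2) (by positivity)).trans ?_
    rw [div_le_div_iff₀ (by positivity) hH0]
    calc (N:ℝ) * (1 + Real.log M) * H ≤ N * H * H := by gcongr
      _ = _ := by ring
  calc _ ≤ ∑ x ∈ X, ∑ n ∈ Finset.Icc 1 N, |Ψ (((n:ℝ) + w n - x) / H) - Ψ (((n:ℝ) + tt w M T n + uu M z n - x) / H)| := by
        refine Finset.sum_le_sum fun x _ => ?_
        rw [← Finset.sum_sub_distrib]
        exact Finset.abs_sum_le_sum_abs _ _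
    _ = ∑ n ∈ Finset.Icc 1 N, ∑ x ∈ X, |Ψ (((n:ℝ) + w n - x) / H) - Ψ (((n:ℝ) + tt w M T n + uu M z n - x) / H)| := Finset.sum_comm
    _ ≤ ∑ n ∈ Finset.Icc 1 N, (90 * b1 + (if n ∈ b1set then 12 * (H:ℝ) else 0) + (if n ∈ b2set then 12 * (H:ℝ) else 0)) := by
        refine Finset.sum_le_sum fun n hn => ?_
        obtain ⟨hn1, hn2⟩ := Finset.mem_Icc.1 hn
        by_cases hbad : n ∈ b1set ∨ n ∈ b2set
        · have : ∑ x ∈ X, |Ψ (((n:ℝ) + w n - x) / H) - Ψ (((n:ℝ) + tt w M T n + uu M z n - x) / H)| ≤ 2 * (2 * H + 1) * 2 := by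
            refine win2 X (n + w n) (n + tt w M T n + uu M z n) H _ 2 (by norm_num) (fun x => ?_) (fun x h1 h2 => ?_)
            · refine (abs_sub _ _).trans ?_
              linarith [hΨ1 (((n:ℝ) + w n - x) / H), hΨ1 (((n:ℝ) + tt w M T n + uu M z n - x) / H)]
            · rw [supp _ x h1, supp _ x h2, sub_zero]
          refine this.trans ?_
          rcases hbad with h | h
          · rw [if_pos h]
            split_ifs <;> linarith
          · rw [if_pos h]
            split_ifs <;> linarith
        · push Not at hbad
          rw [if_neg hbad.1, if_neg hbad.2]
          obtain ⟨t, ht, hwt⟩ := good_n w hw hq C ε hC hε hε1 hb N H M T z ((H:ℝ)^2) hH hBM hMz hT hz n hn1 hn2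
            (fun h => hbad.1 (Finset.mem_filter.2 ⟨hn, h⟩)) (fun h => hbad.2 (Finset.mem_filter.2 ⟨hn, h⟩))
          have ht' : (t:ℝ) ≤ 15 := by exact_mod_cast ht
          have : ∑ x ∈ X, |Ψ (((n:ℝ) + w n - x) / H) - Ψ (((n:ℝ) + tt w M T n + uu M z n - x) / H)| ≤ 2 * (2 * H + 1) * (b1 * (15 / H)) := by
            refine win2 X (n + w n) (n + tt w M T n + uu M z n) H _ _ (by positivity) (fun x => ?_) (fun x h1 h2 => ?_)
            · refine (hΨl _ _).trans ?_
              have : (((n:ℝ) + w n - x) / H) - (((n:ℝ) + tt w M T n + uu M z n - x) / H) = t / H := by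
                rw [hwt]; push_cast; ring
              rw [this, abs_of_nonneg (div_nonneg (Nat.cast_nonneg t) hH0.le)]
              exact mul_le_mul_of_nonneg_left (div_le_div_of_nonneg_right ht' hH0.le) hb1
            · rw [supp _ x h1, supp _ x h2, sub_zero]
          refine this.trans ?_
          have : 2 * (2 * (H:ℝ) + 1) * (b1 * (15 / H)) = b1 * (30 * (2 * H + 1) / H) := by field_simp; ring
          rw [this, add_zero, add_zero, mul_comm 90 b1]
          gcongr
          rw [div_le_iff₀ hH0]; linarith
    _ = 90 * b1 * N + b1set.card * (12 * H) + b2set.card * (12 * H) := by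
        rw [Finset.sum_add_distrib, Finset.sum_add_distrib, Finset.sum_const, nsmul_eq_mul, Nat.card_Icc, ← Finset.sum_filter, ← Finset.sum_filter,
          Finset.sum_const, Finset.sum_const, nsmul_eq_mul, nsmul_eq_mul,
          Finset.filter_mem_eq_inter, Finset.filter_mem_eq_inter, 
          Finset.inter_eq_right.2 (Finset.filter_subset _ _), Finset.inter_eq_right.2 (Finset.filter_subset _ _)]
        simp only [add_tsub_cancel_right]
        ring
    _ ≤ 90 * b1 * N + N / H * (12 * H) + N / H * (12 * H) := by gcongr
    _ = _ := by field_simp; ring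


lemma int_bound (f f' : ℝ → ℝ) (hf : ∀ t, HasDerivAt f (f' t) t) (h0 : f 0 = 0) (b : ℝ) (k : ℕ) (hb : 0 ≤ b)
    (hb' : ∀ t, |f' t| ≤ b * |t| ^ k) (h : ℝ) : |f h| ≤ b * |h| ^ (k+1) := by
  have := (convex_uIcc 0 h).norm_image_sub_le_of_norm_hasDerivWithin_le (f := f) (f' := f') (C := b * |h|^k) (x := 0) (y := h)
    (fun x _ => (hf x).hasDerivWithinAt) (fun x hx => by
      rw [Real.norm_eq_abs]
      refine (hb' x).trans ?_
      have := Set.abs_sub_left_of_mem_uIcc hx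
      rw [sub_zero, sub_zero] at this
      exact mul_le_mul_of_nonneg_left (pow_le_pow_left₀ (abs_nonneg x) this k) hb) Set.left_mem_uIcc Set.right_mem_uIcc
  rw [h0, sub_zero, sub_zero, Real.norm_eq_abs, Real.norm_eq_abs] at this
  rw [pow_succ, ← mul_assoc]; exact this

lemma exists_bump : ∃ (Ψ Ψ1 Ψ2 : ℝ → ℝ) (b c2 α β : ℝ), 1 ≤ b ∧ 0 < c2 ∧ α < β ∧ (∀ t, |Ψ t| ≤ 1) ∧
    (∀ t, 1 < |t| → Ψ t = 0 ∧ Ψ1 t = 0 ∧ Ψ2 t = 0) ∧ (∀ s t, |Ψ s - Ψ t| ≤ b * |s - t|) ∧ 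
    (∀ t, |Ψ1 t| ≤ b ∧ |Ψ2 t| ≤ b) ∧ 
    (∀ s h, |Ψ (s + h) - Ψ s - h * Ψ1 s - h ^ 2 / 2 * Ψ2 s| ≤ b * |h| ^ 3) ∧
    (∀ t, α ≤ t → t ≤ β → c2 ≤ |Ψ1 t|) := by
  let f : ContDiffBump (0:ℝ) := ⟨1/2, 1, by norm_num, by norm_num⟩
  have hf : ContDiff ℝ ((3:ℕ):WithTop ℕ∞) (f : ℝ → ℝ) := f.contDiff
  have h3 : ContDiff ℝ ((2:ℕ):WithTop ℕ∞) (deriv f) := by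
    have := (contDiff_succ_iff_deriv (n := ((2:ℕ):WithTop ℕ∞)) (f := (f:ℝ → ℝ))).1 (by exact_mod_cast hf)
    exact this.2.2
  have h2 : ContDiff ℝ ((1:ℕ):WithTop ℕ∞) (deriv (deriv f)) := by
    have := (contDiff_succ_iff_deriv (n := ((1:ℕ):WithTop ℕ∞)) (f := deriv (f:ℝ → ℝ))).1 (by exact_mod_cast h3)
    exact this.2.2
  have h1 : ContDiff ℝ ((0:ℕ):WithTop ℕ∞) (deriv (deriv (deriv f))) := by
    have := (contDiff_succ_iff_deriv (n := ((0:ℕ):WithTop ℕ∞)) (f := deriv (deriv (f:ℝ → ℝ)))).1 (by exact_mod_cast h2)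
    exact this.2.2
  have c0 : HasCompactSupport (f:ℝ → ℝ) := f.hasCompactSupport
  have c1 := c0.deriv
  have c2 := c1.deriv
  have c3 := c2.deriv
  have d0 : ∀ t, HasDerivAt f (deriv f t) t := fun t => (hf.differentiable (by norm_num) t).hasDerivAt
  have d1 : ∀ t, HasDerivAt (deriv f) (deriv (deriv f) t) t := fun t => (h3.differentiable (by norm_num) t).hasDerivAt
  have d2 : ∀ t, HasDerivAt (deriv (deriv f)) (deriv (deriv (deriv f)) t) t := fun t => (h2.differentiable (by norm_num) t).hasDerivAt
  obtain ⟨B1, hB1⟩ := c1.exists_bound_of_continuous h3.continuous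
  obtain ⟨B2, hB2⟩ := c2.exists_bound_of_continuous h2.continuous
  obtain ⟨B3, hB3⟩ := c3.exists_bound_of_continuous h1.continuous
  set b := max 1 (max B1 (max B2 B3)) with hb
  have hb1 : B1 ≤ b := le_max_of_le_right (le_max_left _ _)
  have hb2 : B2 ≤ b := le_max_of_le_right (le_max_of_le_right (le_max_left _ _))
  have hb3 : B3 ≤ b := le_max_of_le_right (le_max_of_le_right (le_max_right _ _))
  have hb0 : 1 ≤ b := le_max_left _ _
  -- nonzero derivative
  have hf0 : f 0 = 1 := f.one_of_mem_closedBall (by simp [f])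
  have hf2 : f 2 = 0 := f.zero_of_le_dist (by simp [f])
  have hex : ∃ t0, deriv f t0 ≠ 0 := by
    by_contra h
    push Not at h
    have := is_const_of_deriv_eq_zero (hf.differentiable (by norm_num)) h 0 2
    rw [hf0, hf2] at this; norm_num at this
  obtain ⟨t0, ht0⟩ := hex
  have hpos : 0 < |deriv f t0| := abs_pos.2 ht0
  have hcont : Continuous (fun t => |deriv f t|) := h3.continuous.abs
  obtain ⟨δ, hδ, hδ'⟩ := Metric.continuous_iff.1 hcont t0 (|deriv f t0| / 2) (by linarith)
  have ts1 : tsupport (f:ℝ → ℝ) = Metric.closedBall 0 1 := f.tsupport_eq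
  have ts2 : tsupport (deriv (f:ℝ → ℝ)) ⊆ Metric.closedBall 0 1 := 
    closure_minimal (support_deriv_subset.trans ts1.subset) Metric.isClosed_closedBall
  refine ⟨f, deriv f, deriv (deriv f), b, |deriv f t0| / 2, t0, t0 + δ / 2, hb0, by linarith, by linarith, ?_, ?_, ?_, ?_, ?_, ?_⟩
  · intro t; rw [abs_of_nonneg f.nonneg]; exact f.le_one
  · intro t ht
    have ht' : t ∉ Metric.closedBall (0:ℝ) 1 := by simp [ht]
    refine ⟨f.zero_of_le_dist (by simpa [f] using ht.le), ?_, ?_⟩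
    · by_contra h
      exact ht' (ts1.subset (support_deriv_subset (Function.mem_support.2 h)))
    · by_contra h
      exact ht' (ts2 (support_deriv_subset (Function.mem_support.2 h)))
  · intro s t
    have := convex_univ.norm_image_sub_le_of_norm_hasDerivWithin_le (f := (f:ℝ → ℝ)) (f' := deriv f) (C := b) (x := t) (y := s)
      (fun x _ => (d0 x).hasDerivWithinAt) (fun x _ => (hB1 x).trans hb1) (Set.mem_univ _) (Set.mem_univ _)
    simpa only [Real.norm_eq_abs] using this
  · intro t; exact ⟨(hB1 t).trans hb1, (hB2 t).trans hb2⟩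
  · intro s
    have a2 : ∀ h, |deriv (deriv f) (s + h) - deriv (deriv f) s| ≤ b * |h| ^ 1 := by
      refine int_bound (fun h => deriv (deriv f) (s + h) - deriv (deriv f) s) (fun h => deriv (deriv (deriv f)) (s + h)) ?_ (by simp) b 0 (by linarith) ?_
      · intro t; exact ((d2 (s+t)).comp_const_add s t).sub_const _
      · intro t; rw [pow_zero, mul_one]; exact (hB3 _).trans hb3
    have a1 : ∀ h, |deriv f (s + h) - deriv f s - h * deriv (deriv f) s| ≤ b * |h| ^ 2 := by
      refine int_bound (fun h => deriv f (s + h) - deriv f s - h * deriv (deriv f) s) (fun h => deriv (deriv f) (s + h) - deriv (deriv f) s) ?_ (by simp) b 1 (by linarith) a2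
      intro t
      have := (((d1 (s+t)).comp_const_add s t).sub_const (deriv f s)).sub ((hasDerivAt_id t).mul_const (deriv (deriv f) s))
      refine this.congr_deriv ?_
      simp
    refine int_bound (fun h => f (s + h) - f s - h * deriv f s - h^2/2 * deriv (deriv f) s) (fun h => deriv f (s + h) - deriv f s - h * deriv (deriv f) s) ?_ (by simp) b 2 (by linarith) a1
    intro t
    have := ((((d0 (s+t)).comp_const_add s t).sub_const (f s)).sub ((hasDerivAt_id t).mul_const (deriv f s))).sub 
      ((((hasDerivAt_id t).pow 2).div_const 2).mul_const (deriv (deriv f) s))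
    refine this.congr_deriv ?_
    simp
  · intro t h1 h2
    have := hδ' t (by rw [Real.dist_eq, abs_lt]; constructor <;> linarith)
    rw [Real.dist_eq, abs_lt] at this
    linarith [this.1]


lemma uu_eq (M z n : ℕ) : (uu M z n : ℝ) - ∑ p ∈ PP M z, 1 / (p:ℝ) = ∑ p ∈ PP M z, xi 0 1 p n := by
  classical
  unfold xi
  rw [Finset.sum_sub_distrib]
  congr 1
  unfold uu
  rw [← Finset.sum_filter, Finset.sum_const, nsmul_eq_mul, mul_one]
  congr 2
  ext p
  simp [Int.natCast_dvd_natCast]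

lemma xi_shift (a : ℤ) (D p y n : ℕ) (h : (n:ℤ) = a + D * y) : xi 0 1 p n = xi a D p y := by
  unfold xi
  rw [← h]; simp

lemma tt_periodic (w : ℕ → ℕ) (M T n m : ℕ) : tt w M T (n + M.factorial * m) = tt w M T n := by
  unfold tt
  rw [Nat.gcd_add_mul_left_left]

/-- Taylor main part. -/
noncomputable def G0 (w : ℕ → ℕ) (M T z N H : ℕ) (lam : ℝ) (Ψ Ψ1 Ψ2 : ℝ → ℝ) (x : ℕ) : ℝ :=
  ∑ n ∈ Finset.Icc 1 N, (Ψ (((n:ℝ) + tt w M T n + lam - x) / H) + 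
    ((uu M z n - lam) / H) * Ψ1 (((n:ℝ) + tt w M T n + lam - x) / H) + 
    ((uu M z n - lam) / H) ^ 2 / 2 * Ψ2 (((n:ℝ) + tt w M T n + lam - x) / H))

lemma F_taylor (w : ℕ → ℕ) (M T z N H : ℕ) (hH : 1 ≤ H) (lam : ℝ) (hlam : lam = ∑ p ∈ PP M z, 1 / (p:ℝ)) (Ψ Ψ1 Ψ2 : ℝ → ℝ) (b : ℝ) (hb : 1 ≤ b)
    (hΨ0 : ∀ t, 1 < |t| → Ψ t = 0 ∧ Ψ1 t = 0 ∧ Ψ2 t = 0)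
    (hT : ∀ s h, |Ψ (s + h) - Ψ s - h * Ψ1 s - h ^ 2 / 2 * Ψ2 s| ≤ b * |h| ^ 3) (X : Finset ℕ) :
    ∑ x ∈ X, |∑ n ∈ Finset.Icc 1 N, Ψ (((n:ℝ) + tt w M T n + uu M z n - x) / H) - G0 w M T z N H lam Ψ Ψ1 Ψ2 x| ≤ 
      (6 * b / H ^ 2) * ∑ n ∈ Finset.range (N + 1), |∑ p ∈ PP M z, xi 0 1 p n| ^ 3 := by
  have hH' : (1:ℝ) ≤ H := by exact_mod_cast hH
  have hH0 : (0:ℝ) < H := by linarith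
  have supp : ∀ c : ℝ, ∀ x : ℕ, (H:ℝ) < |c - x| → 1 < |(c - x) / H| := by
    intro c x h
    rw [abs_div, abs_of_pos hH0, lt_div_iff₀ hH0]; linarith
  calc _ ≤ ∑ x ∈ X, ∑ n ∈ Finset.Icc 1 N, |Ψ (((n:ℝ) + tt w M T n + uu M z n - x) / H) - (Ψ (((n:ℝ) + tt w M T n + lam - x) / H) + 
    ((uu M z n - lam) / H) * Ψ1 (((n:ℝ) + tt w M T n + lam - x) / H) + 
    ((uu M z n - lam) / H) ^ 2 / 2 * Ψ2 (((n:ℝ) + tt w M T n + lam - x) / H))| := by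
        refine Finset.sum_le_sum fun x _ => ?_
        unfold G0
        rw [← Finset.sum_sub_distrib]
        exact Finset.abs_sum_le_sum_abs _ _
    _ = ∑ n ∈ Finset.Icc 1 N, ∑ x ∈ X, |Ψ (((n:ℝ) + tt w M T n + uu M z n - x) / H) - (Ψ (((n:ℝ) + tt w M T n + lam - x) / H) + 
    ((uu M z n - lam) / H) * Ψ1 (((n:ℝ) + tt w M T n + lam - x) / H) + 
    ((uu M z n - lam) / H) ^ 2 / 2 * Ψ2 (((n:ℝ) + tt w M T n + lam - x) / H))| := Finset.sum_comm
    _ ≤ ∑ n ∈ Finset.Icc 1 N, (6 * b / H ^ 2) * |∑ p ∈ PP M z, xi 0 1 p n| ^ 3 := by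
        refine Finset.sum_le_sum fun n hn => ?_
        have hU : (uu M z n : ℝ) - lam = ∑ p ∈ PP M z, xi 0 1 p n := by rw [hlam]; exact uu_eq M z n
        rw [← hU]
        set U := (uu M z n : ℝ) - lam with hUdef
        have : ∑ x ∈ X, |Ψ (((n:ℝ) + tt w M T n + uu M z n - x) / H) - (Ψ (((n:ℝ) + tt w M T n + lam - x) / H) + 
          (U / H) * Ψ1 (((n:ℝ) + tt w M T n + lam - x) / H) + 
          (U / H) ^ 2 / 2 * Ψ2 (((n:ℝ) + tt w M T n + lam - x) / H))| ≤ 2 * (2 * H + 1) * (b * |U / H| ^ 3) := by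
          refine win2 X (n + tt w M T n + uu M z n) (n + tt w M T n + lam) H _ _ (by positivity) (fun x => ?_) (fun x h1 h2 => ?_)
          · have := hT (((n:ℝ) + tt w M T n + lam - x) / H) (U / H)
            have e : ((n:ℝ) + tt w M T n + lam - x) / H + U / H = ((n:ℝ) + tt w M T n + uu M z n - x) / H := by
              rw [hUdef]; ring
            rw [e] at this
            refine le_trans (le_of_eq ?_) this
            congr 1; ring
          · have a := (hΨ0 _ (supp _ x h1)).1
            obtain ⟨c, d, e⟩ := (hΨ0 _ (supp _ x h2))
            rw [a, c, d, e]; ring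
        refine this.trans ?_
        rw [abs_div, abs_of_pos hH0, div_pow]
        have : 2 * (2 * (H:ℝ) + 1) * (b * (|U| ^ 3 / H ^ 3)) = (2 * (2 * H + 1) / H * b) / H ^ 2 * |U| ^ 3 := by field_simp
        rw [this]
        have h6 : 2 * (2 * (H:ℝ) + 1) / H ≤ 6 := by rw [div_le_iff₀ hH0]; linarith
        gcongr
    _ = (6 * b / H ^ 2) * ∑ n ∈ Finset.Icc 1 N, |∑ p ∈ PP M z, xi 0 1 p n| ^ 3 := by rw [Finset.mul_sum]
    _ ≤ _ := by
        refine mul_le_mul_of_nonneg_left ?_ (by positivity)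
        refine Finset.sum_le_sum_of_subset_of_nonneg ?_ (fun _ _ _ => by positivity)
        intro n hn
        simp only [Finset.mem_Icc, Finset.mem_range] at *; omega

/-- sampling points -/
noncomputable def sk (w : ℕ → ℕ) (M T H : ℕ) (lam : ℝ) (a : ℕ) (k : ℤ) : ℝ :=
  ((k:ℝ) + tt w M T ((a:ℤ) + k).toNat + lam) / H

lemma G0_eq (w : ℕ → ℕ) (M T z N H R : ℕ) (hH : 1 ≤ H) (lam : ℝ) (hlam : lam = ∑ p ∈ PP M z, 1 / (p:ℝ)) (Ψ Ψ1 Ψ2 : ℝ → ℝ)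
    (hΨ0 : ∀ t, 1 < |t| → Ψ t = 0 ∧ Ψ1 t = 0 ∧ Ψ2 t = 0) (hR : (T:ℝ) + lam + H ≤ R)
    (a y : ℕ) (ha : R + 1 ≤ a) (hN : a + M.factorial * y + R ≤ N) :
    G0 w M T z N H lam Ψ Ψ1 Ψ2 (a + M.factorial * y) = 
     (∑ k ∈ Finset.Icc (-(R:ℤ)) R, Ψ (sk w M T H lam a k)) + 
     (∑ p ∈ PP M z, Yp a M.factorial R (fun k => Ψ1 (sk w M T H lam a k) / H) p y) +
     Zs a M.factorial R (fun k => Ψ2 (sk w M T H lam a k) / (2 * H ^ 2)) (PP M z) y := by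
  have hH' : (1:ℝ) ≤ H := by exact_mod_cast hH
  have hH0 : (0:ℝ) < H := by linarith
  have hl0 : 0 ≤ lam := by rw [hlam]; exact Finset.sum_nonneg fun _ _ => by positivity
  set x := a + M.factorial * y with hx
  have hT' : ∀ n, (tt w M T n : ℝ) ≤ T := by
    intro n; unfold tt; split_ifs with h
    · exact_mod_cast h
    · simp
  unfold G0
  have h1 : ∀ n ∈ Finset.Icc 1 N, n ∉ Finset.Icc (x - R) (x + R) → 1 < |((n:ℝ) + tt w M T n + lam - x) / H| := by
    intro n _ hn
    rw [abs_div, abs_of_pos hH0, lt_div_iff₀ hH0, one_mul]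
    simp only [Finset.mem_Icc, not_and, not_le] at hn
    have ht := hT' n
    have ht0 : (0:ℝ) ≤ tt w M T n := by positivity
    have hT0 : (0:ℝ) ≤ T := by positivity
    by_cases h : x - R ≤ n
    · have h2 : ((x + R : ℕ) : ℝ) < n := by exact_mod_cast hn h
      push_cast at h2
      rw [lt_abs]; left; linarith
    · have h2 : ((n + R : ℕ) : ℝ) < (x:ℝ) := by exact_mod_cast (by omega : n + R < x)
      push_cast at h2
      rw [lt_abs]; right; linarith
  have h2 : Finset.Icc (x - R) (x + R) ⊆ Finset.Icc 1 N := Finset.Icc_subset_Icc (by omega) hN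
  rw [← Finset.sum_subset h2 (fun n hn hn' => by
    obtain ⟨c, d, e⟩ := hΨ0 _ (h1 n hn hn')
    rw [c, d, e]; ring)]
  have h3 : ∀ f : ℕ → ℝ, ∑ n ∈ Finset.Icc (x - R) (x + R), f n = ∑ k ∈ Finset.Icc (-(R:ℤ)) R, f ((x:ℤ) + k).toNat := by
    intro f
    refine Finset.sum_bij' (fun n _ => (n:ℤ) - x) (fun k _ => ((x:ℤ) + k).toNat) ?_ ?_ ?_ ?_ ?_
    · intro v hv; simp only [Finset.mem_Icc] at *; omega
    · intro v hv; simp only [Finset.mem_Icc] at *; omega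
    · intro v hv; simp only [Finset.mem_Icc] at *; omega
    · intro v hv; simp only [Finset.mem_Icc] at *; omega
    · intro v hv; congr 1; simp only [Finset.mem_Icc] at *; omega
  rw [h3]
  unfold Zs Yp
  rw [Finset.sum_comm, ← Finset.sum_add_distrib, ← Finset.sum_add_distrib]
  refine Finset.sum_congr rfl fun k hk => ?_
  have hk' := Finset.mem_Icc.1 hk
  set n := ((x:ℤ) + k).toNat with hn
  have hnk : (n:ℤ) = (x:ℤ) + k := by omega
  have hxz : (x:ℤ) = a + (M.factorial:ℤ) * y := by rw [hx]; push_cast; ring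
  have hnk2 : (n:ℤ) = ((a:ℤ) + k) + (M.factorial:ℤ) * y := by rw [hnk, hxz]; ring
  have hnat : n = ((a:ℤ) + k).toNat + M.factorial * y := by
    have hq : (n:ℤ) = ((((a:ℤ) + k).toNat + M.factorial * y : ℕ) : ℤ) := by
      rw [Nat.cast_add, Nat.cast_mul, Int.toNat_of_nonneg (by omega : (0:ℤ) ≤ (a:ℤ) + k)]; exact hnk2
    exact_mod_cast hq
  have hnR : (n:ℝ) - x = k := by
    have : ((n:ℤ):ℝ) = ((x:ℤ):ℝ) + (k:ℝ) := by exact_mod_cast hnk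
    push_cast at this; linarith
  have htt : tt w M T n = tt w M T ((a:ℤ) + k).toNat := by rw [hnat, tt_periodic]
  have hs : ((n:ℝ) + tt w M T n + lam - x) / H = sk w M T H lam a k := by
    unfold sk
    rw [htt, ← hnR]; ring
  rw [hs]
  have hU : (uu M z n : ℝ) - lam = ∑ p ∈ PP M z, xi ((a:ℤ) + k) M.factorial p y := by
    rw [hlam, uu_eq]
    exact Finset.sum_congr rfl fun p _ => xi_shift _ _ _ _ _ hnk2
  rw [hU, ← Finset.mul_sum]
  field_simp


lemma sum_shift {α : Type*} [AddCommGroup α] (D : ℕ) (f : ℕ → α) (hf : ∀ n, f (n + D) = f n) (c : ℕ) :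
    ∑ i ∈ Finset.range D, f (c + i) = ∑ i ∈ Finset.range D, f i := by
  induction c with
  | zero => simp
  | succ c ih =>
    rw [← ih]
    have h1 := Finset.sum_range_succ (fun i => f (c + i)) D
    have h2 := Finset.sum_range_succ' (fun i => f (c + i)) D
    rw [h1, hf c] at h2
    simp only [add_zero] at h2
    have h3 := add_right_cancel h2
    rw [h3]
    exact Finset.sum_congr rfl fun i _ => by congr 1; ring

lemma tt_per (w : ℕ → ℕ) (M T n : ℕ) : tt w M T (n + M.factorial) = tt w M T n := by
  simpa using tt_periodic w M T n 1

lemma sum_two_shift (w : ℕ → ℕ) (M T R : ℕ) (g : ℤ → ℕ → ℝ) :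
    ∑ x0 ∈ Finset.range M.factorial, ∑ k ∈ Finset.Icc (-(R:ℤ)) R, g k (tt w M T (((R + 1 + x0 : ℕ) : ℤ) + k).toNat)
    = ∑ n ∈ Finset.range M.factorial, ∑ k ∈ Finset.Icc (-(R:ℤ)) R, g k (tt w M T n) := by
  rw [Finset.sum_comm]
  conv_rhs => rw [Finset.sum_comm]
  refine Finset.sum_congr rfl fun k hk => ?_
  have hk' := Finset.mem_Icc.1 hk
  rw [← sum_shift M.factorial (fun n => g k (tt w M T n)) (fun n => by simp only [tt_per]) ((R:ℤ) + 1 + k).toNat]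
  refine Finset.sum_congr rfl fun x _ => ?_
  congr 2
  push_cast
  omega

lemma tt_small_count (w : ℕ → ℕ) (hw : ∀ m n : ℕ, 1 ≤ m → 1 ≤ n → Nat.Coprime m n → w (m * n) = w m + w n)
    (hq : ∀ q : ℕ, q.Prime → w q = 1) (C ε : ℝ) (hC : 0 < C) (hε : 0 < ε) (hε1 : ε < 1)
    (hb : ∀ n : ℕ, 1 ≤ n → (w n : ℝ) ≤ C * (n:ℝ) ^ ε) (M T H : ℕ) (hM : 1 ≤ M)
    (hlog : 4 * (1 + Real.log M) * (1 + 64 * C) ≤ H) :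
    (M.factorial : ℝ) / 2 ≤ ∑ n ∈ Finset.range M.factorial, if tt w M T n ≤ H then (1:ℝ) else 0 := by
  classical
  set D := M.factorial with hD
  have hlogM : 0 ≤ Real.log M := Real.log_natCast_nonneg M
  rw [← sum_shift D (fun n => if tt w M T n ≤ H then (1:ℝ) else 0) (fun n => by simp only [hD, tt_per]) 1]
  have e1 : ∑ i ∈ Finset.range D, (if tt w M T (1 + i) ≤ H then (1:ℝ) else 0) = 
      ∑ n ∈ Finset.Icc 1 D, if tt w M T n ≤ H then (1:ℝ) else 0 := by
    rw [Finset.range_eq_Ico, Finset.sum_Ico_add (fun n => if tt w M T n ≤ H then (1:ℝ) else 0) 0 D 1]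
    rfl
  rw [e1]
  have h1 := count_sq D 4 (by norm_num)
  have h2 := count_omega D M (4 * (1 + Real.log M)) (by positivity)
  have h2' : (D:ℝ) * (1 + Real.log M) / (4 * (1 + Real.log M)) = D / 4 := by field_simp
  rw [h2'] at h2
  rw [Finset.card_filter] at h1 h2
  push_cast at h1 h2
  have h3 : ∑ n ∈ Finset.Icc 1 D, (1:ℝ) = D := by simp
  have key : ∑ n ∈ Finset.Icc 1 D, (1:ℝ) ≤ ∑ n ∈ Finset.Icc 1 D, ((if tt w M T n ≤ H then (1:ℝ) else 0) + 
     (if ∃ d, 4 < d ∧ d ^ 2 ∣ n then (1:ℝ) else 0) + 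
     (if 4 * (1 + Real.log M) < ((n.primeFactors.filter (fun p => p ≤ M)).card : ℝ) then (1:ℝ) else 0)) := by
    refine Finset.sum_le_sum fun n hn => ?_
    have hn1 := (Finset.mem_Icc.1 hn).1
    by_cases c2 : ∃ d, 4 < d ∧ d ^ 2 ∣ n
    · rw [if_pos c2]; split_ifs <;> norm_num
    by_cases c3 : 4 * (1 + Real.log M) < ((n.primeFactors.filter (fun p => p ≤ M)).card : ℝ)
    · rw [if_pos c3]; split_ifs <;> norm_num
    have c1 : tt w M T n ≤ H := by
      have a1 : tt w M T n ≤ w (Nat.gcd n D) := by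
        unfold tt; split_ifs
        · exact le_rfl
        · exact Nat.zero_le _
      have a2 : (w (Nat.gcd n D) : ℝ) ≤ H := by
        refine le_trans (w_le w hw hq C ε hC hε hε1 hb (Nat.gcd n D) 4 (Nat.gcd_pos_of_pos_left _ hn1) ?_) ?_
        · intro d hd hdd
          exact c2 ⟨d, hd, hdd.trans (Nat.gcd_dvd_left _ _)⟩
        · have sub : (Nat.gcd n D).primeFactors ⊆ n.primeFactors.filter (fun p => p ≤ M) := by
            intro p hp
            rw [Nat.mem_primeFactors] at hp
            simp only [Finset.mem_filter, Nat.mem_primeFactors]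
            refine ⟨⟨hp.1, hp.2.1.trans (Nat.gcd_dvd_left _ _), by omega⟩, ?_⟩
            exact (hp.1.dvd_factorial).1 (hp.2.1.trans (Nat.gcd_dvd_right _ _))
          have cc : ((Nat.gcd n D).primeFactors.card : ℝ) ≤ 4 * (1 + Real.log M) := 
            le_trans (by exact_mod_cast Finset.card_le_card sub) (not_lt.1 c3)
          refine le_trans (mul_le_mul_of_nonneg_right cc (by positivity)) ?_
          refine le_trans (le_of_eq ?_) hlog
          norm_num; left; ring
      have a2' : w (Nat.gcd n D) ≤ H := by exact_mod_cast a2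
      exact a1.trans a2'
    rw [if_pos c1]; split_ifs <;> norm_num
  rw [Finset.sum_add_distrib, Finset.sum_add_distrib, h3] at key
  linarith

lemma card_int_le (J : Finset ℤ) (p q : ℝ) (hpq : p ≤ q) : ((J.filter fun k : ℤ => p ≤ k ∧ k ≤ q).card : ℝ) ≤ q - p + 1 := by
  have h1 : (J.filter fun k : ℤ => p ≤ k ∧ k ≤ q).card ≤ (Finset.Icc ⌈p⌉ ⌊q⌋).card := by
    apply Finset.card_le_card
    intro k hk
    have := (Finset.mem_filter.1 hk).2
    rw [Finset.mem_Icc, Int.ceil_le, Int.le_floor]; exact this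
  rw [Int.card_Icc] at h1
  have a1 := Int.floor_le q
  have a2 := Int.le_ceil p
  have h2 : ((J.filter fun k : ℤ => p ≤ k ∧ k ≤ q).card : ℝ) ≤ ((⌊q⌋ + 1 - ⌈p⌉).toNat : ℝ) := by exact_mod_cast h1
  refine h2.trans ?_
  by_cases h : 0 ≤ ⌊q⌋ + 1 - ⌈p⌉
  · have : ((⌊q⌋ + 1 - ⌈p⌉).toNat : ℝ) = ((⌊q⌋ + 1 - ⌈p⌉ : ℤ) : ℝ) := by
      exact_mod_cast congrArg (fun t : ℤ => (t:ℝ)) (Int.toNat_of_nonneg h)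
    rw [this]; push_cast; linarith
  · rw [Int.toNat_of_nonpos (by omega)]; simp; linarith

lemma card_int_ge (R : ℕ) (p q : ℝ) (hp : -(R:ℝ) ≤ p) (hq : q ≤ R) : 
    q - p - 1 ≤ (((Finset.Icc (-(R:ℤ)) R).filter fun k : ℤ => p ≤ k ∧ k ≤ q).card : ℝ) := by
  have h1 : (Finset.Icc ⌈p⌉ ⌊q⌋).card ≤ ((Finset.Icc (-(R:ℤ)) R).filter fun k : ℤ => p ≤ k ∧ k ≤ q).card := by
    apply Finset.card_le_card
    intro k hk
    rw [Finset.mem_Icc, Int.ceil_le, Int.le_floor] at hk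
    rw [Finset.mem_filter, Finset.mem_Icc]
    refine ⟨⟨?_, ?_⟩, hk⟩
    · have : ((-(R:ℤ) : ℤ) : ℝ) ≤ k := by push_cast; linarith
      exact_mod_cast this
    · have : (k:ℝ) ≤ ((R:ℤ):ℝ) := by push_cast; linarith
      exact_mod_cast this
  rw [Int.card_Icc] at h1
  have a1 := Int.lt_floor_add_one q
  have a2 := Int.ceil_lt_add_one p
  have h2 : (((⌊q⌋ + 1 - ⌈p⌉ : ℤ)) : ℝ) ≤ ((⌊q⌋ + 1 - ⌈p⌉).toNat : ℝ) := by
    exact_mod_cast Int.self_le_toNat _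
  have h3 : ((⌊q⌋ + 1 - ⌈p⌉).toNat : ℝ) ≤ (((Finset.Icc (-(R:ℤ)) R).filter fun k : ℤ => p ≤ k ∧ k ≤ q).card : ℝ) := by exact_mod_cast h1
  push_cast at h2
  linarith

lemma chi_bound (w : ℕ → ℕ) (M T H R : ℕ) (hH : 1 ≤ H) (lam : ℝ) (Ψ2 : ℝ → ℝ) (b : ℝ) (hb : 1 ≤ b)
    (h0 : ∀ t, 1 < |t| → Ψ2 t = 0) (h1 : ∀ t, |Ψ2 t| ≤ b) :
    ∑ x0 ∈ Finset.range M.factorial, ∑ k ∈ Finset.Icc (-(R:ℤ)) R, (Ψ2 (sk w M T H lam (R + 1 + x0) k) / (2 * H ^ 2)) ^ 2 ≤ 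
     M.factorial * (b ^ 2 / H ^ 3) := by
  have hH' : (1:ℝ) ≤ H := by exact_mod_cast hH
  have hH0 : (0:ℝ) < H := by linarith
  unfold sk
  rw [sum_two_shift w M T R (fun k t => (Ψ2 (((k:ℝ) + t + lam) / H) / (2 * H ^ 2)) ^ 2)]
  refine le_trans (Finset.sum_le_card_nsmul _ _ (b ^ 2 / H ^ 3) ?_) (by simp)
  intro n _
  set t := tt w M T n
  calc _ ≤ ∑ k ∈ Finset.Icc (-(R:ℤ)) R, (if -(t:ℝ) - lam - H ≤ k ∧ k ≤ -(t:ℝ) - lam + H then b ^ 2 / (4 * H ^ 4) else 0) := by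
        refine Finset.sum_le_sum fun k _ => ?_
        split_ifs with h
        · have := h1 (((k:ℝ) + t + lam) / H)
          rw [div_pow, ← sq_abs]
          have e : (2 * (H:ℝ) ^ 2) ^ 2 = 4 * H ^ 4 := by ring
          rw [e]; gcongr
        · rw [h0]; simp
          rw [abs_div, abs_of_pos hH0, lt_div_iff₀ hH0, one_mul]
          by_contra hc
          rw [not_lt, abs_le] at hc
          exact h ⟨by linarith [hc.1], by linarith [hc.2]⟩
    _ ≤ (2 * H + 1) * (b ^ 2 / (4 * H ^ 4)) := by
        rw [← Finset.sum_filter, Finset.sum_const, nsmul_eq_mul]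
        refine mul_le_mul_of_nonneg_right ?_ (by positivity)
        refine (card_int_le _ _ _ (by linarith)).trans (by linarith)
    _ ≤ (3 * H) * (b ^ 2 / (4 * H ^ 4)) := by gcongr; linarith
    _ = (3 / 4) * (b ^ 2 / H ^ 3) := by field_simp
    _ ≤ _ := by
      have : 0 ≤ b ^ 2 / (H:ℝ) ^ 3 := by positivity
      linarith

lemma S_lower (w : ℕ → ℕ) (hw : ∀ m n : ℕ, 1 ≤ m → 1 ≤ n → Nat.Coprime m n → w (m * n) = w m + w n)
    (hq : ∀ q : ℕ, q.Prime → w q = 1) (C ε : ℝ) (hC : 0 < C) (hε : 0 < ε) (hε1 : ε < 1)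
    (hb : ∀ n : ℕ, 1 ≤ n → (w n : ℝ) ≤ C * (n:ℝ) ^ ε) (M T H R : ℕ) (hM : 1 ≤ M) (hH : 1 ≤ H)
    (hlog : 4 * (1 + Real.log M) * (1 + 64 * C) ≤ H) (lam : ℝ) (hl0 : 0 ≤ lam) (hR : (T:ℝ) + lam + H ≤ R)
    (Ψ1 : ℝ → ℝ) (c2 α β : ℝ) (hc2 : 0 < c2) (hαβ : α < β) (h0 : ∀ t, 1 < |t| → Ψ1 t = 0)
    (hl : ∀ t, α ≤ t → t ≤ β → c2 ≤ |Ψ1 t|) (hHβ : 2 ≤ H * (β - α)) :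
    M.factorial * (c2 * (β - α) / 8 * √(lam / H)) ≤ 
    ∑ x0 ∈ Finset.range M.factorial, √(lam * ∑ k ∈ Finset.Icc (-(R:ℤ)) R, (Ψ1 (sk w M T H lam (R + 1 + x0) k) / H) ^ 2) := by
  classical
  have hH' : (1:ℝ) ≤ H := by exact_mod_cast hH
  have hH0 : (0:ℝ) < H := by linarith
  have hin : ∀ t, α ≤ t → t ≤ β → |t| ≤ 1 := by
    intro t h1 h2
    by_contra hc
    have := hl t h1 h2
    rw [h0 t (not_le.1 hc)] at this
    simp at this; linarith
  have hα := abs_le.1 (hin α le_rfl hαβ.le)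
  have hβ := abs_le.1 (hin β hαβ.le le_rfl)
  set J := Finset.Icc (-(R:ℤ)) R with hJ
  let g : ℤ → ℕ → ℝ := fun k t => if (t ≤ H ∧ α ≤ ((k:ℝ) + t + lam) / H ∧ ((k:ℝ) + t + lam) / H ≤ β) then 1 else 0
  -- pointwise
  have hpt : ∀ x0 ∈ Finset.range M.factorial, 
      √lam * (c2 / H) * (1 / (2 * √H)) * ∑ k ∈ J, g k (tt w M T (((R + 1 + x0 : ℕ) : ℤ) + k).toNat) ≤ 
      √(lam * ∑ k ∈ J, (Ψ1 (sk w M T H lam (R + 1 + x0) k) / H) ^ 2) := by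
    intro x0 _
    set A := ∑ k ∈ J, g k (tt w M T (((R + 1 + x0 : ℕ) : ℤ) + k).toNat) with hA
    have hA0 : 0 ≤ A := Finset.sum_nonneg fun k _ => by simp only [g]; split_ifs <;> norm_num
    have hS : (c2 / H) ^ 2 * A ≤ ∑ k ∈ J, (Ψ1 (sk w M T H lam (R + 1 + x0) k) / H) ^ 2 := by
      rw [hA, Finset.mul_sum]
      refine Finset.sum_le_sum fun k _ => ?_
      simp only [g]
      split_ifs with h
      · rw [mul_one, ← sq_abs (Ψ1 _ / _), abs_div, abs_of_pos hH0]
        have := hl _ h.2.1 h.2.2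
        unfold sk
        gcongr
      · simp; positivity
    have hA4 : A ≤ 4 * H := by
      calc A ≤ ∑ k ∈ J, (if -lam - 2 * H ≤ k ∧ k ≤ -lam + H then (1:ℝ) else 0) := by
            refine Finset.sum_le_sum fun k _ => ?_
            simp only [g]
            split_ifs with h h' h'
            · exact le_rfl
            · exfalso
              apply h'
              obtain ⟨h1, h2, h3⟩ := h
              rw [le_div_iff₀ hH0] at h2
              rw [div_le_iff₀ hH0] at h3
              have h1' : ((tt w M T (((R + 1 + x0 : ℕ) : ℤ) + k).toNat : ℕ) : ℝ) ≤ H := by exact_mod_cast h1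
              have h4 : (0:ℝ) ≤ ((tt w M T (((R + 1 + x0 : ℕ) : ℤ) + k).toNat : ℕ) : ℝ) := by positivity
              constructor <;> nlinarith
            · norm_num
            · exact le_rfl
        _ ≤ (-lam + H) - (-lam - 2 * H) + 1 := by
            rw [← Finset.sum_filter, Finset.sum_const, nsmul_eq_mul, mul_one]
            exact card_int_le _ _ _ (by linarith)
        _ ≤ 4 * H := by linarith
    apply Real.le_sqrt_of_sq_le
    have e : (√lam * (c2 / H) * (1 / (2 * √H)) * A) ^ 2 = lam * ((c2 / H) ^ 2 * (A * (A / (4 * H)))) := by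
      rw [mul_pow, mul_pow, mul_pow, Real.sq_sqrt hl0, div_pow 1, mul_pow 2, Real.sq_sqrt hH0.le]
      field_simp; ring
    rw [e]
    refine mul_le_mul_of_nonneg_left (le_trans ?_ hS) hl0
    refine mul_le_mul_of_nonneg_left ?_ (by positivity)
    have : A / (4 * H) ≤ 1 := by rw [div_le_one (by positivity)]; exact hA4
    nlinarith
  refine le_trans ?_ (Finset.sum_le_sum hpt)
  rw [← Finset.mul_sum, sum_two_shift w M T R g]
  have hcount : (M.factorial : ℝ) / 2 * (H * (β - α) - 1) ≤ ∑ n ∈ Finset.range M.factorial, ∑ k ∈ J, g k (tt w M T n) := by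
    have h1 := tt_small_count w hw hq C ε hC hε hε1 hb M T H hM hlog
    refine le_trans (mul_le_mul_of_nonneg_right h1 (by linarith)) ?_
    rw [Finset.sum_mul]
    refine Finset.sum_le_sum fun n _ => ?_
    have hT' : (tt w M T n : ℝ) ≤ T := by
      unfold tt; split_ifs with h
      · exact_mod_cast h
      · simp
    have ht0 : (0:ℝ) ≤ tt w M T n := by positivity
    split_ifs with h
    · rw [one_mul]
      have := card_int_ge R (H * α - tt w M T n - lam) (H * β - tt w M T n - lam) (by nlinarith) (by nlinarith)
      refine le_trans (by linarith) (this.trans ?_)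
      rw [Finset.card_filter]; push_cast
      refine Finset.sum_le_sum fun k _ => ?_
      simp only [g]
      split_ifs with h1 h2 h2
      · exact le_rfl
      · exfalso; apply h2
        refine ⟨h, ?_, ?_⟩
        · rw [le_div_iff₀ hH0]; linarith
        · rw [div_le_iff₀ hH0]; linarith
      · norm_num
      · exact le_rfl
    · rw [zero_mul]
      exact Finset.sum_nonneg fun k _ => by simp only [g]; split_ifs <;> norm_num
  refine le_trans ?_ (mul_le_mul_of_nonneg_left hcount (by positivity))
  rw [Real.sqrt_div hl0]
  have hsH : 0 < √(H:ℝ) := Real.sqrt_pos.2 hH0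
  have e : √lam * (c2 / H) * (1 / (2 * √H)) * ((M.factorial : ℝ) / 2 * (H * (β - α) - 1)) = 
      M.factorial * (c2 / 4 * ((H * (β - α) - 1) / H) * (√lam / √H)) := by field_simp; ring
  rw [e]
  refine mul_le_mul_of_nonneg_left ?_ (by positivity)
  refine mul_le_mul_of_nonneg_right ?_ (by positivity)
  have : (β - α) / 2 ≤ (H * (β - α) - 1) / H := by rw [le_div_iff₀ hH0]; linarith
  nlinarith


lemma mert_lower (n : ℕ) (hn : 2 ≤ n) : Real.log (Real.log n) ≤ (∑ p ∈ (Finset.Icc 1 n).filter Nat.Prime, 1 / (p:ℝ)) + 1 := by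
  classical
  let f : ℕ →* ℝ := 
    { toFun := fun m => (m:ℝ)⁻¹, map_one' := by simp, map_mul' := fun a b => by simp [mul_comm] }
  have hf : ∀ m, f m = (m:ℝ)⁻¹ := fun m => rfl
  have h := (EulerProduct.summable_and_hasSum_smoothNumbers_prod_primesBelow_geometric (f := f) (fun {p} hp => by
    change ‖(p:ℝ)⁻¹‖ < 1
    rw [norm_inv, Real.norm_natCast]
    exact inv_lt_one_of_one_lt₀ (by exact_mod_cast hp.one_lt)) (n+1)).2
  have e0 : Nat.primesBelow (n+1) = (Finset.Icc 1 n).filter Nat.Prime := by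
    ext p; simp only [Nat.mem_primesBelow, Finset.mem_filter, Finset.mem_Icc]
    constructor
    · rintro ⟨a, b⟩; exact ⟨⟨b.one_lt.le, by omega⟩, b⟩
    · rintro ⟨a, b⟩; exact ⟨by omega, b⟩
  rw [e0] at h
  set P := (Finset.Icc 1 n).filter Nat.Prime with hP
  have hPp : ∀ p ∈ P, p.Prime := fun p hp => (Finset.mem_filter.1 hp).2
  have h2 := (hasSum_subtype_iff_indicator (f := fun m : ℕ => f m) (s := Nat.smoothNumbers (n+1))).1 h
  have h3 := sum_le_hasSum (Finset.Icc 1 n) (fun i _ => by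
    apply Set.indicator_nonneg; intro m _; rw [hf]; positivity) h2
  have h4 : ∑ i ∈ Finset.Icc 1 n, (Nat.smoothNumbers (n+1)).indicator (fun m : ℕ => f m) i = (harmonic n : ℝ) := by
    rw [harmonic_eq_sum_Icc]; push_cast
    refine Finset.sum_congr rfl fun i hi => ?_
    have := Finset.mem_Icc.1 hi
    rw [Set.indicator_of_mem (Nat.mem_smoothNumbers_of_lt (by omega) (by omega)), hf]
  rw [h4] at h3
  have h5 := (log_add_one_le_harmonic n).trans h3
  have hn' : (2:ℝ) ≤ n := by exact_mod_cast hn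
  have h6 : Real.log n ≤ ∏ p ∈ P, (1 - f p)⁻¹ := le_trans (Real.log_le_log (by linarith) (by simp)) h5
  have hpos : ∀ p ∈ P, 0 < (1 - f p)⁻¹ := by
    intro p hp
    have : f p < 1 := by rw [hf]; exact inv_lt_one_of_one_lt₀ (by exact_mod_cast (hPp p hp).one_lt)
    exact inv_pos.2 (by linarith)
  have h7 := Real.log_le_log (Real.log_pos (by linarith)) h6
  rw [Real.log_prod (fun p hp => (hpos p hp).ne')] at h7
  refine h7.trans ?_
  have h8 : ∀ p ∈ P, Real.log ((1 - f p)⁻¹) ≤ 1 / (p:ℝ) + (1 / ((p:ℝ) - 1) - 1 / p) := by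
    intro p hp
    have hp2 : (2:ℝ) ≤ p := by exact_mod_cast (hPp p hp).two_le
    have := Real.log_le_sub_one_of_pos (hpos p hp)
    refine this.trans (le_of_eq ?_)
    rw [hf]
    have : (p:ℝ) - 1 ≠ 0 := by linarith
    have : (p:ℝ) ≠ 0 := by linarith
    have e : 1 - (p:ℝ)⁻¹ = ((p:ℝ) - 1) / p := by field_simp
    rw [e, inv_div]
    field_simp; ring
  refine (Finset.sum_le_sum h8).trans ?_
  rw [Finset.sum_add_distrib]
  have h9 : ∑ p ∈ P, (1 / ((p:ℝ) - 1) - 1 / p) ≤ ∑ p ∈ Finset.Ico 2 (n+1), (1 / ((p:ℝ) - 1) - 1 / p) := by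
    refine Finset.sum_le_sum_of_subset_of_nonneg ?_ ?_
    · intro p hp
      have h1 := (hPp p hp).two_le
      have h2 := (Finset.mem_Icc.1 (Finset.mem_filter.1 hp).1).2
      simp; omega
    · intro p hp _
      have : (2:ℝ) ≤ p := by exact_mod_cast (Finset.mem_Ico.1 hp).1
      have := one_div_le_one_div_of_le (by linarith : (0:ℝ) < p - 1) (by linarith : (p:ℝ) - 1 ≤ p)
      linarith
  have h10 : ∑ p ∈ Finset.Ico 2 (n+1), (1 / ((p:ℝ) - 1) - 1 / p) = 1 - 1 / n := by
    induction n, hn using Nat.le_induction with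
    | base => norm_num [Finset.sum_Ico_succ_top]
    | succ k hk ih => 
      rw [Finset.sum_Ico_succ_top (by omega)]
      clear * - hk
      have : ∑ p ∈ Finset.Ico 2 (k+1), (1 / ((p:ℝ) - 1) - 1 / p) = 1 - 1 / k := by
        induction k, hk using Nat.le_induction with
        | base => norm_num [Finset.sum_Ico_succ_top]
        | succ k hk ih => 
          rw [Finset.sum_Ico_succ_top (by omega), ih]; push_cast; ring
      rw [this]; push_cast; ring
  have : 0 ≤ 1 / (n:ℝ) := by positivity
  linarith

lemma mert_upper (n : ℕ) (hn : 2 ≤ n) : ∑ p ∈ (Finset.Icc 1 n).filter Nat.Prime, 1 / (p:ℝ) ≤ 4 * (2 + Real.log (Real.log n)) := by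
  classical
  set P := (Finset.Icc 1 n).filter Nat.Prime with hP
  have hPp : ∀ p ∈ P, p.Prime := fun p hp => (Finset.mem_filter.1 hp).2
  have hl2 : 0 < Real.log 2 := Real.log_pos (by norm_num)
  have hmap : ∀ p ∈ P, Nat.log 2 p ∈ Finset.Icc 1 (Nat.log 2 n) := by
    intro p hp
    have h2 := (Finset.mem_Icc.1 (Finset.mem_filter.1 hp).1).2
    exact Finset.mem_Icc.2 ⟨Nat.log_pos (by norm_num) (hPp p hp).two_le, Nat.log_mono_right h2⟩
  rw [← Finset.sum_fiberwise_of_maps_to hmap]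
  have hj : ∀ j ∈ Finset.Icc 1 (Nat.log 2 n), ∑ p ∈ P with Nat.log 2 p = j, 1 / (p:ℝ) ≤ 4 * ((j:ℝ)⁻¹) := by
    intro j hj
    have hj1 := (Finset.mem_Icc.1 hj).1
    have hj0 : (0:ℝ) < j := by exact_mod_cast hj1
    have hth := Chebyshev.theta_le_log4_mul_x (x := (2:ℝ) ^ (j+1)) (by positivity)
    rw [Chebyshev.theta_eq_sum_Icc] at hth
    have hfl : ⌊(2:ℝ) ^ (j+1)⌋₊ = 2 ^ (j+1) := by
      have : ((2:ℝ) ^ (j+1)) = ((2 ^ (j+1) : ℕ) : ℝ) := by push_cast; rfl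
      rw [this, Nat.floor_natCast]
    rw [hfl] at hth
    have h1 : ∀ p ∈ P.filter (fun p => Nat.log 2 p = j), 1 / (p:ℝ) ≤ Real.log p * (1 / (2 ^ j * (j * Real.log 2))) := by
      intro p hp
      obtain ⟨hpP, hpj⟩ := Finset.mem_filter.1 hp
      have hle : 2 ^ j ≤ p := by rw [← hpj]; exact Nat.pow_log_le_self 2 (hPp p hpP).ne_zero
      have hle' : (2:ℝ) ^ j ≤ p := by exact_mod_cast hle
      have hlog := Real.log_le_log (by positivity) hle'
      rw [Real.log_pow] at hlog
      have hp0 : (0:ℝ) < p := by exact_mod_cast (hPp p hpP).pos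
      rw [mul_one_div, div_le_div_iff₀ hp0 (by positivity), one_mul, mul_comm]
      exact mul_le_mul hlog hle' (by positivity) (by linarith [mul_pos hj0 hl2])
    refine (Finset.sum_le_sum h1).trans ?_
    rw [← Finset.sum_mul]
    have h2 : ∑ p ∈ P.filter (fun p => Nat.log 2 p = j), Real.log p ≤ Real.log 4 * 2 ^ (j+1) := by
      refine le_trans (Finset.sum_le_sum_of_subset_of_nonneg ?_ ?_) hth
      · intro p hp
        obtain ⟨hpP, hpj⟩ := Finset.mem_filter.1 hp
        have := Nat.lt_pow_succ_log_self (b := 2) (by norm_num) p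
        rw [hpj] at this
        simp only [Finset.mem_filter, Finset.mem_Icc]
        exact ⟨⟨by omega, this.le⟩, hPp p hpP⟩
      · intro p _ _; exact Real.log_natCast_nonneg p
    refine (mul_le_mul_of_nonneg_right h2 (by positivity)).trans (le_of_eq ?_)
    have : Real.log 4 = 2 * Real.log 2 := by
      rw [show (4:ℝ) = 2 ^ 2 by norm_num, Real.log_pow]; norm_num
    rw [this, pow_succ]; field_simp; norm_num
  refine (Finset.sum_le_sum hj).trans ?_
  rw [← Finset.mul_sum]
  have h1 := harmonic_le_one_add_log (Nat.log 2 n)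
  rw [harmonic_eq_sum_Icc] at h1; push_cast at h1
  refine mul_le_mul_of_nonneg_left (h1.trans ?_) (by norm_num)
  have hk : 1 ≤ Nat.log 2 n := Nat.log_pos (by norm_num) hn
  have hn' : (2:ℝ) ≤ n := by exact_mod_cast hn
  have h3 : (2:ℝ) ^ (Nat.log 2 n) ≤ n := by exact_mod_cast Nat.pow_log_le_self 2 (by omega)
  have h4 := Real.log_le_log (by positivity) h3
  rw [Real.log_pow] at h4
  have h5 : (Nat.log 2 n : ℝ) ≤ 2 * Real.log n := by
    have : 1/2 ≤ Real.log 2 := by linarith [Real.log_two_gt_d9]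
    have h0 : (0:ℝ) ≤ Nat.log 2 n := by positivity
    nlinarith
  have hlogn : 0 < Real.log n := Real.log_pos (by linarith)
  have h6 := Real.log_le_log (by exact_mod_cast hk) h5
  rw [Real.log_mul (by norm_num) hlogn.ne'] at h6
  have := Real.log_two_lt_d9
  linarith


lemma sum_range_mul_split (D N1 : ℕ) (f : ℕ → ℝ) :
    ∑ i ∈ Finset.range (D * N1), f i = ∑ x0 ∈ Finset.range D, ∑ y ∈ Finset.range N1, f (x0 + D * y) := by
  induction N1 with
  | zero => simp
  | succ k ih =>
    rw [Nat.mul_succ, Finset.sum_range_add, ih, ← Finset.sum_add_distrib]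
    refine Finset.sum_congr rfl fun x _ => ?_
    rw [Finset.sum_range_succ, add_comm x (D * k)]

set_option maxHeartbeats 1000000 in
lemma main_det (w : ℕ → ℕ) (hw : ∀ m n : ℕ, 1 ≤ m → 1 ≤ n → Nat.Coprime m n → w (m * n) = w m + w n)
    (hq : ∀ q : ℕ, q.Prime → w q = 1) (C ε : ℝ) (hC : 0 < C) (hε : 0 < ε) (hε1 : ε < 1)
    (hwb : ∀ n : ℕ, 1 ≤ n → (w n : ℝ) ≤ C * (n:ℝ) ^ ε)
    (Ψ Ψ1 Ψ2 : ℝ → ℝ) (b c2 α β : ℝ) (hb : 1 ≤ b) (hc2 : 0 < c2) (hαβ : α < β) (hΨ1 : ∀ t, |Ψ t| ≤ 1)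
    (hΨ0 : ∀ t, 1 < |t| → Ψ t = 0 ∧ Ψ1 t = 0 ∧ Ψ2 t = 0) (hΨl : ∀ s t, |Ψ s - Ψ t| ≤ b * |s - t|)
    (hΨb : ∀ t, |Ψ1 t| ≤ b ∧ |Ψ2 t| ≤ b)
    (hΨT : ∀ s h, |Ψ (s + h) - Ψ s - h * Ψ1 s - h ^ 2 / 2 * Ψ2 s| ≤ b * |h| ^ 3)
    (hΨc : ∀ t, α ≤ t → t ≤ β → c2 ≤ |Ψ1 t|)
    (N H M T R z E N1 : ℕ) (hH : 1 ≤ H) (hBM : H ^ 3 ≤ M) (hMz : M ≤ z) (hT : (H:ℝ) ^ 2 * (1 + C * (H:ℝ)^3) ≤ T)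
    (hz : N < (z+1)^16) (hlog1 : 1 + Real.log M ≤ H) (hlog2 : 4 * (1 + Real.log M) * (1 + 64 * C) ≤ H)
    (lam : ℝ) (hlam : lam = ∑ p ∈ PP M z, 1 / (p:ℝ)) (hR : (T:ℝ) + lam + H ≤ R) (hRM : 2 * (2 * R + 1) ≤ M + 1)
    (hN1 : 0 < N1) (hNN : R + 1 + M.factorial * N1 + R ≤ N) (hE : ∀ n ∈ Finset.Icc 1 N, n + w n ≤ N + E)
    (hbH : b ≤ H) (hHβ : 2 ≤ H * (β - α)) :
    (N1:ℝ) * M.factorial * (5 / 64 * (c2 * (β - α) / 8 * √(lam / H)) - 2 - b ^ 2 / H ^ 3 * (8 * lam ^ 2 + lam)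
      - 5 * (32 * (2 * R + 1) ^ 2 * z ^ 8 / N1) / (b / H) ^ 3) ≤ 
    (2 * H + 1) * (2 * G w N + E) + (90 * b + 24) * N + (6 * b / H ^ 2) * ((N + 1) * 
      ((√H / 2) * (lam + 32 * z ^ 8 / (N + 1)) + (1 / (2 * √H)) * (3 * lam ^ 2 + 4 * lam + 32 * z ^ 8 / (N + 1)))) := by
  classical
  have fc := fun X : Finset ℕ => F_compare w hw hq C ε hC hε hε1 hwb N H M T z hH hBM hMz hT hz hlog1 Ψ b (by linarith) hΨ1 (fun t ht => (hΨ0 t ht).1) hΨl X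
  clear hz
  have hH' : (1:ℝ) ≤ H := by exact_mod_cast hH
  have hH0 : (0:ℝ) < H := by linarith
  have hl0 : 0 ≤ lam := by rw [hlam]; exact Finset.sum_nonneg fun _ _ => by positivity
  have hM1 : 1 ≤ M := le_trans (Nat.one_le_pow _ _ hH) hBM
  have hz1 : 1 ≤ z := hM1.trans hMz
  have hRH : H ≤ R := by
    have : (H:ℝ) ≤ R := by
      have h0 : (0:ℝ) ≤ T := Nat.cast_nonneg T
      clear * - h0 hR hl0
      linarith
    exact_mod_cast this
  set D := M.factorial with hD
  set P := PP M z with hP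
  have hPp : ∀ p ∈ P, p.Prime := fun p hp => (Finset.mem_filter.1 hp).2.1
  have hPM : ∀ p ∈ P, M < p := fun p hp => (Finset.mem_filter.1 hp).2.2
  have hPz : ∀ p ∈ P, p ≤ z := fun p hp => (Finset.mem_Icc.1 (Finset.mem_filter.1 hp).1).2
  set X := Finset.Ico (R + 1) (R + 1 + D * N1) with hX
  set c0 := ∑ k ∈ Finset.Icc (-(H:ℤ)) H, Ψ ((k:ℝ) / H) with hc0
  let F : ℕ → ℝ := fun x => ∑ n ∈ Finset.Icc 1 N, Ψ (((n:ℝ) + w n - x) / H)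
  let F2 : ℕ → ℝ := fun x => ∑ n ∈ Finset.Icc 1 N, Ψ (((n:ℝ) + tt w M T n + uu M z n - x) / H)
  let G1 : ℕ → ℝ := fun x => G0 w M T z N H lam Ψ Ψ1 Ψ2 x
  -- upper bounds
  have u1 : ∑ x ∈ X, |F x - c0| ≤ (2 * H + 1) * (2 * G w N + E) := by
    have := F_sum w N H E (fun k => Ψ ((k:ℝ) / H)) (fun k hk => by
      apply (hΨ0 _ _).1
      rw [abs_div, abs_of_pos hH0, lt_div_iff₀ hH0, one_mul]
      exact_mod_cast hk) (fun k => hΨ1 _) hE X (fun x hx => by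
        have := Finset.mem_Ico.1 hx
        constructor <;> omega)
    refine le_trans (le_of_eq ?_) this
    refine Finset.sum_congr rfl fun x _ => ?_
    simp only [F, hc0]
    congr 2
    refine Finset.sum_congr rfl fun n _ => ?_
    push_cast; rfl
  have u2 : ∑ x ∈ X, |F x - F2 x| ≤ (90 * b + 24) * N := 
    fc X
  have u3 : ∑ x ∈ X, |F2 x - G1 x| ≤ (6 * b / H ^ 2) * ((N + 1) * 
      ((√H / 2) * (lam + 32 * z ^ 8 / (N + 1)) + (1 / (2 * √H)) * (3 * lam ^ 2 + 4 * lam + 32 * z ^ 8 / (N + 1)))) := by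
    refine (F_taylor w M T z N H hH lam hlam Ψ Ψ1 Ψ2 b hb hΨ0 hΨT X).trans ?_
    refine mul_le_mul_of_nonneg_left ?_ (by positivity)
    have := U3 P hPp z (N+1) hPz hz1 (by omega) (√H) (Real.sqrt_pos.2 hH0)
    rw [← hlam] at this
    unfold avg at this
    rw [div_le_iff₀ (by positivity), mul_comm] at this
    push_cast at this
    exact this
  have u4 : ∑ x ∈ X, |G1 x - c0| ≤ ∑ x ∈ X, |F x - c0| + ∑ x ∈ X, |F x - F2 x| + ∑ x ∈ X, |F2 x - G1 x| := by
    rw [← Finset.sum_add_distrib, ← Finset.sum_add_distrib]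
    refine Finset.sum_le_sum fun x _ => ?_
    have e : G1 x - c0 = (F x - c0) - (F x - F2 x) - (F2 x - G1 x) := by ring
    rw [e]
    refine (abs_sub _ _).trans ?_
    have := abs_sub (F x - c0) (F x - F2 x)
    linarith
  -- lower bound
  have l1 : ∑ x ∈ X, |G1 x - c0| = ∑ x0 ∈ Finset.range D, ∑ y ∈ Finset.range N1, |G1 (R + 1 + x0 + D * y) - c0| := by
    rw [hX, Finset.sum_Ico_eq_sum_range, Nat.add_sub_cancel_left, sum_range_mul_split]
    refine Finset.sum_congr rfl fun x _ => Finset.sum_congr rfl fun y _ => ?_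
    rw [add_assoc (R+1)]
  let ψ : ℕ → ℤ → ℝ := fun x0 k => Ψ1 (sk w M T H lam (R + 1 + x0) k) / H
  let χ : ℕ → ℤ → ℝ := fun x0 k => Ψ2 (sk w M T H lam (R + 1 + x0) k) / (2 * H ^ 2)
  have hN1' : (0:ℝ) < N1 := by exact_mod_cast hN1
  have l2 : ∀ x0 ∈ Finset.range D, (N1:ℝ) * (5 / 64 * √(lam * (∑ k ∈ Finset.Icc (-(R:ℤ)) R, ψ x0 k ^ 2)) - 2
     - (∑ k ∈ Finset.Icc (-(R:ℤ)) R, χ x0 k ^ 2) * (8 * lam ^ 2 + lam)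
     - 5 * (32 * (2 * R + 1) ^ 2 * z ^ 8 / N1) / (b / H) ^ 3) ≤ ∑ y ∈ Finset.range N1, |G1 (R + 1 + x0 + D * y) - c0| := by
    intro x0 hx0
    have hx0' := Finset.mem_range.1 hx0
    have := Y_lower P hPp ((R + 1 + x0 : ℕ) : ℤ) D R z N1 (fun p hp => by
        rw [hD, Nat.Prime.coprime_iff_not_dvd (hPp p hp), (hPp p hp).dvd_factorial, not_le]; exact hPM p hp) 
      (fun p hp => by have := hPM p hp; omega) hPz hz1 hN1 (ψ x0) (χ x0) (b / H) (by positivity) 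
      (by rw [div_le_one hH0]; exact hbH) (fun k => by
        simp only [ψ]
        rw [abs_div, abs_of_pos hH0]
        have := (hΨb (sk w M T H lam (R + 1 + x0) k)).1
        gcongr) (fun k => by
        simp only [χ]
        rw [abs_div, abs_of_pos (by positivity : (0:ℝ) < 2 * H ^ 2)]
        have := (hΨb (sk w M T H lam (R + 1 + x0) k)).2
        have h2 : (H:ℝ) ≤ 2 * H ^ 2 := by nlinarith
        gcongr) 
      ((∑ k ∈ Finset.Icc (-(R:ℤ)) R, Ψ (sk w M T H lam (R + 1 + x0) k)) - c0)
    rw [← hlam] at this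
    unfold avg at this
    rw [le_div_iff₀ hN1', mul_comm] at this
    refine this.trans (le_of_eq ?_)
    refine Finset.sum_congr rfl fun y hy => ?_
    have hy' := Finset.mem_range.1 hy
    have hDy : D * y + D ≤ D * N1 := by
      rw [← Nat.mul_succ]; exact Nat.mul_le_mul_left D hy'
    simp only [G1]
    rw [G0_eq w M T z N H R hH lam hlam Ψ Ψ1 Ψ2 hΨ0 hR (R + 1 + x0) y (by omega) (by rw [← hD]; omega)]
    congr 1
    simp only [ψ, χ]
    ring
  have l3 := Finset.sum_le_sum l2
  rw [← l1, ← Finset.mul_sum, Finset.sum_sub_distrib, Finset.sum_sub_distrib, Finset.sum_sub_distrib, ← Finset.mul_sum, 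
    ← Finset.sum_mul] at l3
  simp only [Finset.sum_const, Finset.card_range, nsmul_eq_mul] at l3
  have s1 := S_lower w hw hq C ε hC hε hε1 hwb M T H R hM1 hH hlog2 lam hl0 hR Ψ1 c2 α β hc2 hαβ (fun t ht => (hΨ0 t ht).2.1) hΨc hHβ
  have s2 := chi_bound w M T H R hH lam Ψ2 b hb (fun t ht => (hΨ0 t ht).2.2) (fun t => (hΨb t).2)
  have s3 := mul_le_mul_of_nonneg_right s2 (by positivity : 0 ≤ 8 * lam ^ 2 + lam)
  refine le_trans ?_ (l3.trans (u4.trans (by linarith)))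
  rw [mul_assoc]
  refine mul_le_mul_of_nonneg_left ?_ hN1'.le
  simp only [ψ, χ]
  rw [← hD] at s1 s3
  linarith


lemma ev_log (A B c : ℝ) (hB : 0 ≤ B) (hc : 0 < c) : ∀ᶠ H : ℕ in Filter.atTop, A + B * Real.log H ≤ c * H := by
  have h1 := (Real.isLittleO_log_id_atTop.def (c := c / (2 * (B + 1))) (by positivity))
  have h2 := tendsto_natCast_atTop_atTop.eventually h1
  filter_upwards [h2, tendsto_natCast_atTop_atTop.eventually (Filter.eventually_ge_atTop (2 * A / c)), Filter.eventually_ge_atTop 1] with H h h3 h4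
  have h5 : (0:ℝ) ≤ H := by positivity
  simp only [Real.norm_eq_abs, id] at h
  rw [abs_of_nonneg h5] at h
  have h6 := (le_abs_self _).trans h
  rw [div_le_iff₀ hc] at h3
  have h7 : B * Real.log H ≤ B * (c / (2 * (B + 1)) * H) := mul_le_mul_of_nonneg_left h6 hB
  have h8 : B * (c / (2 * (B + 1)) * H) ≤ c * H / 2 := by
    have : B * (c / (2 * (B + 1)) * H) = (B / (B + 1)) * (c * H / 2) := by field_simp
    rw [this]
    have h9 : B / (B + 1) ≤ 1 := by rw [div_le_one (by positivity)]; linarith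
    have h10 : 0 ≤ c * H / 2 := by positivity
    nlinarith
  linarith

lemma ev_exp : ∀ᶠ H : ℕ in Filter.atTop, (2880 * (H:ℝ) ^ 19 * ((H ^ 10).factorial : ℝ)) ^ 2 ≤ Real.exp (Real.exp H) ∧
    (((H:ℝ)) ^ 10 + 1) ^ 16 ≤ Real.exp (Real.exp H) := by
  have h1 := (Real.isLittleO_pow_exp_atTop (n := 11)).def (c := 1 / 6000) (by norm_num)
  have h2 := tendsto_natCast_atTop_atTop.eventually h1
  filter_upwards [h2, Filter.eventually_ge_atTop 1] with H h h4
  have hH : (1:ℝ) ≤ H := by exact_mod_cast h4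
  have hH0 : (0:ℝ) < H := by linarith
  rw [Real.norm_of_nonneg (by positivity), Real.norm_of_nonneg (by positivity)] at h
  have hlog : Real.log H ≤ H := (Real.log_le_sub_one_of_pos hH0).trans (by linarith)
  have hHH : (H:ℝ) ≤ H ^ 11 := le_self_pow₀ hH (by norm_num)
  have hH1 : (1:ℝ) ≤ H ^ 11 := one_le_pow₀ hH
  constructor
  · have hfac : ((H ^ 10).factorial : ℝ) ≤ ((H:ℝ) ^ 10) ^ (H ^ 10) := by
      exact_mod_cast Nat.factorial_le_pow (H ^ 10)
    have hfp : (0:ℝ) < ((H ^ 10).factorial : ℝ) := by exact_mod_cast Nat.factorial_pos _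
    rw [← Real.log_le_iff_le_exp (by positivity), Real.log_pow, Real.log_mul (by positivity) (by positivity), 
      Real.log_mul (by positivity) (by positivity), Real.log_pow]
    have a1 := Real.log_le_log hfp hfac
    rw [Real.log_pow, Real.log_pow] at a1
    push_cast at a1
    have a2 : Real.log 2880 ≤ 2879 := (Real.log_le_sub_one_of_pos (by norm_num)).trans (by norm_num)
    have a3 : (H:ℝ) ^ 10 * (10 * Real.log H) ≤ 10 * H ^ 11 := by
      have : (H:ℝ) ^ 10 * (10 * Real.log H) ≤ H ^ 10 * (10 * H) := by gcongr
      refine this.trans (le_of_eq (by ring))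
    push_cast
    linarith
  · rw [← Real.log_le_iff_le_exp (by positivity), Real.log_pow]
    have a1 : (H:ℝ) ^ 10 + 1 ≤ 2 * H ^ 10 := by linarith [one_le_pow₀ hH (n := 10)]
    have a2 := Real.log_le_log (by positivity) a1
    rw [Real.log_mul (by norm_num) (by positivity), Real.log_pow] at a2
    have a3 : Real.log 2 ≤ 1 := by linarith [Real.log_two_lt_d9]
    push_cast at *
    linarith

lemma ev_ge (A : ℝ) : ∀ᶠ H : ℕ in Filter.atTop, A ≤ H := 
  tendsto_natCast_atTop_atTop.eventually (Filter.eventually_ge_atTop A)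

lemma H_conds (C C' : ℝ) (hC : 0 < C) (hC' : 0 < C') (b : ℝ) (hb : 1 ≤ b) (H : ℕ) (h1 : 1 + C ≤ H) (h2 : 2 + C' ≤ H) (h3 : 3 ≤ H)
    (h4 : b ^ 2 * (8 * C' ^ 2 + C') ≤ H) (h5 : (6 * b * ((C' + 1) + (3 * C' ^ 2 + 4 * C' + 1))) ^ 2 ≤ H) 
    (lam : ℝ) (hl0 : 0 ≤ lam) (hl : lam ≤ C' * H) :
    (H:ℝ) ^ 2 * (1 + C * (H:ℝ)^3) ≤ (H ^ 6 : ℕ) ∧ ((H ^ 6 : ℕ) : ℝ) + lam + H ≤ (H ^ 8 : ℕ) ∧ 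
    2 * (2 * H ^ 8 + 1) ≤ H ^ 10 + 1 ∧ b ^ 2 / H ^ 3 * (8 * lam ^ 2 + lam) ≤ 1 ∧
    (6 * b / H ^ 2) * ((√H / 2) * (lam + 1) + (1 / (2 * √H)) * (3 * lam ^ 2 + 4 * lam + 1)) ≤ 1 / 2 := by
  have hH3 : (3:ℝ) ≤ H := by exact_mod_cast h3
  have hH0 : (0:ℝ) < H := by linarith
  have hH1 : (1:ℝ) ≤ H := by linarith
  refine ⟨?_, ?_, ?_, ?_, ?_⟩
  · push_cast
    calc (H:ℝ) ^ 2 * (1 + C * (H:ℝ)^3) ≤ (H:ℝ) ^ 2 * (H ^ 3 + C * (H:ℝ)^3) := by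
          gcongr; exact one_le_pow₀ hH1
      _ = H ^ 5 * (1 + C) := by ring
      _ ≤ H ^ 5 * H := by gcongr
      _ = _ := by ring
  · push_cast
    have : (H:ℝ) ≤ H ^ 6 := le_self_pow₀ hH1 (by norm_num)
    calc (H:ℝ) ^ 6 + lam + H ≤ H ^ 6 + C' * H + H := by linarith
      _ ≤ H ^ 6 + C' * H ^ 6 + H ^ 6 := by gcongr
      _ = H ^ 6 * (2 + C') := by ring
      _ ≤ H ^ 6 * H := by gcongr
      _ = H ^ 7 := by ring
      _ ≤ H ^ 8 := pow_le_pow_right₀ hH1 (by norm_num)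
  · have e1 : 1 ≤ H ^ 8 := Nat.one_le_pow _ _ (by omega)
    have e2 : 9 ≤ H ^ 2 := by nlinarith
    have e3 : H ^ 10 = H ^ 8 * H ^ 2 := by ring
    rw [e3]; nlinarith
  · calc b ^ 2 / H ^ 3 * (8 * lam ^ 2 + lam) ≤ b ^ 2 / H ^ 3 * (8 * (C' * H) ^ 2 + (C' * H)) := by gcongr
      _ ≤ b ^ 2 / H ^ 3 * (8 * (C' * H) ^ 2 + (C' * (H * H))) := by gcongr; nlinarith
      _ = b ^ 2 * (8 * C' ^ 2 + C') / H := by field_simp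
      _ ≤ 1 := by rw [div_le_one hH0]; exact h4
  · have hs : 0 < √(H:ℝ) := Real.sqrt_pos.2 hH0
    have hss : √(H:ℝ) ^ 2 = H := Real.sq_sqrt hH0.le
    have hs2 := Real.le_sqrt_of_sq_le h5
    have m1 : lam + 1 ≤ (C' + 1) * H := by linarith
    have m2 : 3 * lam ^ 2 + 4 * lam + 1 ≤ (3 * C' ^ 2 + 4 * C' + 1) * H ^ 2 := by
      have : lam ^ 2 ≤ (C' * H) ^ 2 := by gcongr
      have : lam ≤ C' * H ^ 2 := by nlinarith
      nlinarith
    calc _ ≤ (6 * b / H ^ 2) * ((√H / 2) * ((C' + 1) * H) + (1 / (2 * √H)) * ((3 * C' ^ 2 + 4 * C' + 1) * H ^ 2)) := by gcongr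
      _ = (6 * b * ((C' + 1) + (3 * C' ^ 2 + 4 * C' + 1))) / (2 * √H) := by
        generalize √(H:ℝ) = s at *; rw [← hss]; field_simp
      _ ≤ 1 / 2 := by rw [div_le_div_iff₀ (by positivity) (by norm_num)]; linarith

/-- Bounds for the sum over medium primes. -/
lemma lam_bounds (M z N : ℕ) (hz2 : 2 ≤ z) (hzN : z ≤ N) (hN : N < (z+1) ^ 16) :
    Real.log (Real.log N) - 6 - Real.log M ≤ ∑ p ∈ PP M z, 1 / (p:ℝ) ∧ 
    ∑ p ∈ PP M z, 1 / (p:ℝ) ≤ 4 * (2 + Real.log (Real.log N)) := by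
  have hz' : (2:ℝ) ≤ z := by exact_mod_cast hz2
  have hzN' : (z:ℝ) ≤ N := by exact_mod_cast hzN
  have h4 : (N:ℝ) ≤ (z:ℝ) ^ 32 := by
    have a : (N:ℝ) < ((z:ℝ)+1) ^ 16 := by exact_mod_cast hN
    clear hN
    have b : ((z:ℝ)+1) ^ 16 ≤ ((z:ℝ) ^ 2) ^ 16 := by
      apply pow_le_pow_left₀ (by linarith); nlinarith
    rw [← pow_mul] at b
    exact a.le.trans b
  clear hN
  have hlz : 0 < Real.log z := Real.log_pos (by linarith)
  constructor
  · have h1 := mert_lower z hz2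
    have h2 := sum_primes_le M
    have h3 : ∑ p ∈ (Finset.Icc 1 z).filter Nat.Prime, 1 / (p:ℝ) ≤ 
        ∑ p ∈ PP M z, 1 / (p:ℝ) + ∑ p ∈ (Finset.Icc 1 M).filter Nat.Prime, 1 / (p:ℝ) := by
      have hsub : (Finset.Icc 1 z).filter Nat.Prime ⊆ PP M z ∪ (Finset.Icc 1 M).filter Nat.Prime := by
        intro p hp
        simp only [PP, Finset.mem_union, Finset.mem_filter, Finset.mem_Icc] at *
        by_cases h : M < p
        · left; exact ⟨hp.1, hp.2, h⟩
        · right; exact ⟨⟨hp.1.1, by omega⟩, hp.2⟩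
      refine (Finset.sum_le_sum_of_subset_of_nonneg hsub (fun _ _ _ => by positivity)).trans ?_
      have := Finset.sum_union_inter (s₁ := PP M z) (s₂ := (Finset.Icc 1 M).filter Nat.Prime) (f := fun p : ℕ => 1 / (p:ℝ))
      have h0 : 0 ≤ ∑ p ∈ PP M z ∩ (Finset.Icc 1 M).filter Nat.Prime, 1 / (p:ℝ) := Finset.sum_nonneg fun _ _ => by positivity
      linarith
    have h5 := Real.log_le_log (by linarith) h4
    rw [Real.log_pow] at h5; push_cast at h5
    have h6 := Real.log_le_log (Real.log_pos (by linarith)) h5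
    rw [Real.log_mul (by norm_num) hlz.ne'] at h6
    have h7 : Real.log 32 ≤ 4 := by
      rw [show (32:ℝ) = 2 ^ 5 by norm_num, Real.log_pow]; push_cast; linarith [Real.log_two_lt_d9]
    linarith
  · have h1 := mert_upper z hz2
    have h2 := Real.log_le_log hlz (Real.log_le_log (by linarith) hzN')
    have h3 : ∑ p ∈ PP M z, 1 / (p:ℝ) ≤ ∑ p ∈ (Finset.Icc 1 z).filter Nat.Prime, 1 / (p:ℝ) := by
      refine Finset.sum_le_sum_of_subset_of_nonneg ?_ (fun _ _ _ => by positivity)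
      intro p hp
      simp only [PP, Finset.mem_filter] at *
      exact ⟨hp.1, hp.2.1⟩
    linarith

lemma ev_E (C ε : ℝ) (hC : 0 < C) (hε : 0 < ε) (hε1 : ε < 1) : 
    ∀ᶠ N : ℕ in Filter.atTop, (2 * Real.log (Real.log N) + 1) * (C * (N:ℝ) ^ ε + 1) ≤ N / 2 := by
  set δ := (1 - ε) / 2 with hδ
  have hδ0 : 0 < δ := by rw [hδ]; linarith
  have h1 := (tendsto_rpow_atTop hδ0).comp (tendsto_natCast_atTop_atTop (R := ℝ))
  filter_upwards [h1.eventually (Filter.eventually_ge_atTop (2 * ((2 / δ + 1) * (C + 1)))), Filter.eventually_ge_atTop 3] with N h2 h3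
  simp only [Function.comp] at h2
  have hN : (3:ℝ) ≤ N := by exact_mod_cast h3
  have hN0 : (0:ℝ) < N := by linarith
  have hlog : 0 < Real.log N := Real.log_pos (by linarith)
  have a1 : Real.log (Real.log N) ≤ Real.log N := (Real.log_le_sub_one_of_pos hlog).trans (by linarith)
  have a2 := Real.log_le_rpow_div hN0.le hδ0
  have a3 : 1 ≤ (N:ℝ) ^ δ := Real.one_le_rpow (by linarith) hδ0.le
  have a4 : 1 ≤ (N:ℝ) ^ ε := Real.one_le_rpow (by linarith) hε.le
  have e : (N:ℝ) ^ δ * (N:ℝ) ^ ε * (N:ℝ) ^ δ = N := by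
    rw [← Real.rpow_add hN0, ← Real.rpow_add hN0, hδ]
    have : (1 - ε) / 2 + ε + (1 - ε) / 2 = 1 := by ring
    rw [this, Real.rpow_one]
  calc (2 * Real.log (Real.log N) + 1) * (C * (N:ℝ) ^ ε + 1) ≤ (2 * ((N:ℝ) ^ δ / δ) + (N:ℝ) ^ δ) * (C * (N:ℝ) ^ ε + (N:ℝ) ^ ε) := by
        gcongr; linarith
    _ = (N:ℝ) ^ δ * (N:ℝ) ^ ε * ((2 / δ + 1) * (C + 1)) := by field_simp
    _ ≤ (N:ℝ) ^ δ * (N:ℝ) ^ ε * ((N:ℝ) ^ δ / 2) := by gcongr; linarith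
    _ = N / 2 := by rw [← mul_div_assoc, e]


lemma root16 (N : ℕ) : ∃ z : ℕ, (z:ℝ) ^ 8 * (z:ℝ) ^ 8 ≤ N ∧ z ≤ N ∧ Fact (N < (z+1)^16) := by
  set r : ℝ := (N:ℝ) ^ (((16:ℕ):ℝ)⁻¹) with hr
  have hr0 : 0 ≤ r := by positivity
  have hr16 : r ^ 16 = N := Real.rpow_inv_natCast_pow (by positivity) (by norm_num)
  have h1 : ((⌊r⌋₊ : ℕ) : ℝ) ^ 16 ≤ N := by
    rw [← hr16]; exact pow_le_pow_left₀ (by positivity) (Nat.floor_le hr0) 16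
  refine ⟨⌊r⌋₊, ?_, ?_, ⟨?_⟩⟩
  · rw [← pow_add]; exact h1
  · have h2 : ⌊r⌋₊ ^ 16 ≤ N := by exact_mod_cast h1
    exact (Nat.le_self_pow (by norm_num) _).trans h2
  · have h2 : (N:ℝ) < (((⌊r⌋₊ : ℕ) : ℝ) + 1) ^ 16 := by
      rw [← hr16]; exact pow_lt_pow_left₀ (Nat.lt_floor_add_one r) hr0 (by norm_num)
    exact_mod_cast h2

set_option maxHeartbeats 1000000 in
lemma core (w : ℕ → ℕ) (hw : ∀ m n : ℕ, 1 ≤ m → 1 ≤ n → Nat.Coprime m n → w (m * n) = w m + w n)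
    (hq : ∀ q : ℕ, q.Prime → w q = 1) (C ε : ℝ) (hC : 0 < C) (hε : 0 < ε) (hε1 : ε < 1)
    (hwb : ∀ n : ℕ, 1 ≤ n → (w n : ℝ) ≤ C * (n:ℝ) ^ ε)
    (Ψ Ψ1 Ψ2 : ℝ → ℝ) (b c2 α β : ℝ) (hb : 1 ≤ b) (hc2 : 0 < c2) (hαβ : α < β) (hΨ1 : ∀ t, |Ψ t| ≤ 1)
    (hΨ0 : ∀ t, 1 < |t| → Ψ t = 0 ∧ Ψ1 t = 0 ∧ Ψ2 t = 0) (hΨl : ∀ s t, |Ψ s - Ψ t| ≤ b * |s - t|)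
    (hΨb : ∀ t, |Ψ1 t| ≤ b ∧ |Ψ2 t| ≤ b)
    (hΨT : ∀ s h, |Ψ (s + h) - Ψ s - h * Ψ1 s - h ^ 2 / 2 * Ψ2 s| ≤ b * |h| ^ 3)
    (hΨc : ∀ t, α ≤ t → t ≤ β → c2 ≤ |Ψ1 t|)
    (K : ℝ) (hK1 : 1 ≤ K) (hK : 4 + 2 * (90 * b + 26) ≤ 5 / 64 * (c2 * (β - α) / 8 * √(K / 2)))
    (N H : ℕ) (hHL : K * H ≤ Real.log (Real.log N)) (hLH : Real.log (Real.log N) ≤ 2 * K * H)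
    (h1 : 1 + C ≤ H) (h2 : 2 + 16 * K ≤ H) (h3 : 3 ≤ H)
    (h4 : b ^ 2 * (8 * (16 * K) ^ 2 + 16 * K) ≤ H) 
    (h5 : (6 * b * ((16 * K + 1) + (3 * (16 * K) ^ 2 + 4 * (16 * K) + 1))) ^ 2 ≤ H) 
    (hbH : b ≤ H) (hHβ : 2 ≤ H * (β - α)) (g1 : 1 + 10 * Real.log H ≤ 1 * H) 
    (g2 : 4 * (1 + 64 * C) + (4 * (1 + 64 * C) * 10) * Real.log H ≤ 1 * H) (g3 : 6 + 10 * Real.log H ≤ (1 / 2) * H)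
    (x1 : (2880 * (H:ℝ) ^ 19 * ((H ^ 10).factorial : ℝ)) ^ 2 ≤ Real.exp (Real.exp H))
    (x2 : (((H:ℝ)) ^ 10 + 1) ^ 16 ≤ Real.exp (Real.exp H))
    (hEE : (2 * Real.log (Real.log N) + 1) * (C * (N:ℝ) ^ ε + 1) ≤ N / 2) :
    (1 / 12) * N / Real.log (Real.log N) ≤ (G w N : ℝ) := by
  set L := Real.log (Real.log N) with hL
  have hH3 : (3:ℝ) ≤ H := by exact_mod_cast h3
  have hH0 : (0:ℝ) < H := by linarith
  have hH1 : (1:ℝ) ≤ H := by linarith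
  have hKH : (H:ℝ) ≤ K * H := by nlinarith
  have hHL' : (H:ℝ) ≤ L := hKH.trans hHL
  have hL0 : 0 < L := by linarith
  have hlogN : 0 < Real.log N := by
    rcases (Real.log_natCast_nonneg N).lt_or_eq with h | h
    · exact h
    · rw [hL, ← h] at hL0; simp at hL0
  have hN0 : (0:ℝ) < N := by
    rcases Nat.eq_zero_or_pos N with h | h
    · rw [h] at hlogN; simp at hlogN
    · exact_mod_cast h
  have hNexp : Real.exp (Real.exp H) ≤ N := by
    have : Real.exp (Real.exp L) = N := by rw [hL, Real.exp_log hlogN, Real.exp_log hN0]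
    rw [← this]; gcongr
  replace x1 := x1.trans hNexp
  replace x2 := x2.trans hNexp
  clear hNexp
  obtain ⟨z, hz16, hzN, hzF⟩ := root16 N
  have hMz : H ^ 10 ≤ z := by
    have a := hzF.out
    have a' : (N:ℝ) < ((z:ℝ) + 1) ^ 16 := by exact_mod_cast a
    have := lt_of_pow_lt_pow_left₀ 16 (by positivity) (x2.trans_lt a')
    have : (H:ℝ) ^ 10 < z := by linarith
    exact_mod_cast this.le
  have hz2 : 2 ≤ z := by
    have : H ≤ H ^ 10 := Nat.le_self_pow (by norm_num) _
    omega
  obtain ⟨lb1, lb2⟩ := lam_bounds (H ^ 10) z N hz2 hzN hzF.out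
  rw [← hL] at lb1 lb2
  set lam := ∑ p ∈ PP (H ^ 10) z, 1 / (p:ℝ) with hlam
  have hlogM : Real.log ((H ^ 10 : ℕ) : ℝ) = 10 * Real.log H := by push_cast; rw [Real.log_pow]; norm_num
  rw [hlogM] at lb1
  have hl0 : 0 ≤ lam := Finset.sum_nonneg fun _ _ => by positivity
  have hlup : lam ≤ 16 * K * H := by linarith
  have hllo : K / 2 ≤ lam / H := by rw [le_div_iff₀ hH0]; linarith
  obtain ⟨t1, t2, t3, t4, t5⟩ := H_conds C (16 * K) hC (by positivity) b hb H h1 h2 h3 h4 h5 lam hl0 hlup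
  have hDpos : 0 < (H ^ 10).factorial := Nat.factorial_pos _
  set D := (H ^ 10).factorial with hD
  set N1 := (N - (2 * H ^ 8 + 1)) / D with hN1def
  have hD1 : (1:ℝ) ≤ D := by exact_mod_cast hDpos
  set q := 2880 * (H:ℝ) ^ 19 * D with hqdef
  have hp19 : (1:ℝ) ≤ (H:ℝ) ^ 19 := one_le_pow₀ hH1
  have hq1 : 2880 ≤ q := by
    have hmul := mul_le_mul hp19 hD1 (by norm_num) (by linarith)
    rw [hqdef, mul_assoc]
    linarith only [hmul]
  have hqs : q ≤ √N := Real.le_sqrt_of_sq_le x1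
  have hss : √(N:ℝ) * √N = N := Real.mul_self_sqrt hN0.le
  have hzs : (z:ℝ) ^ 8 ≤ √N := Real.le_sqrt_of_sq_le (by rw [sq]; exact hz16)
  have hR19 : (H:ℝ) ^ 8 ≤ H ^ 19 := pow_le_pow_right₀ hH1 (by norm_num)
  have hbig : 2 * (2 * (H:ℝ) ^ 8 + 1 + D) ≤ N := by
    have a1 : (H:ℝ) ^ 19 ≤ H ^ 19 * D := le_mul_of_one_le_right (by positivity) hD1
    have a2 : (D:ℝ) ≤ H ^ 19 * D := le_mul_of_one_le_left (by positivity) hp19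
    have a3 : q ≤ N := by
      have := le_mul_of_one_le_left (Real.sqrt_nonneg (N:ℝ)) (by linarith only [hq1, hqs] : 1 ≤ √(N:ℝ))
      linarith only [hqs, this, hss]
    have a4 : 2 * (2 * (H:ℝ) ^ 8 + 1 + D) ≤ q := by rw [hqdef, mul_assoc]; linarith only [a1, a2, hR19, hp19]
    exact a4.trans a3
  have hbigN : 2 * (2 * H ^ 8 + 1 + D) ≤ N := by exact_mod_cast hbig
  have hdm1 : D * N1 ≤ N - (2 * H ^ 8 + 1) := Nat.mul_div_le _ _
  have hdm2 : N - (2 * H ^ 8 + 1) < D * N1 + D := by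
    have := Nat.lt_mul_div_succ (N - (2 * H ^ 8 + 1)) hDpos
    rw [Nat.mul_succ] at this; exact this
  have hNN : H ^ 8 + 1 + D * N1 + H ^ 8 ≤ N := by omega
  have hDN : (N:ℝ) / 2 ≤ N1 * D := by
    have : N ≤ 2 * (D * N1) := by omega
    have h : (N:ℝ) ≤ 2 * (D * N1) := by exact_mod_cast this
    linarith
  have hN1pos : 0 < N1 := by
    rcases Nat.eq_zero_or_pos N1 with h | h
    · rw [h] at hDN; simp at hDN; linarith
    · exact h
  have hN1' : (0:ℝ) < N1 := by exact_mod_cast hN1pos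
  set E := ⌈C * (N:ℝ) ^ ε⌉₊ with hE
  have hEb : ∀ n ∈ Finset.Icc 1 N, n + w n ≤ N + E := by
    intro n hn
    obtain ⟨n1, n2⟩ := Finset.mem_Icc.1 hn
    have a1 := hwb n n1
    have n2' : (n:ℝ) ≤ N := by exact_mod_cast n2
    have a2 : C * (n:ℝ) ^ ε ≤ C * (N:ℝ) ^ ε := by gcongr
    have a3 : (w n : ℝ) ≤ E := a1.trans (a2.trans (Nat.le_ceil _))
    have a4 : w n ≤ E := by exact_mod_cast a3
    omega
  have hE1 : (E:ℝ) ≤ C * (N:ℝ) ^ ε + 1 := (Nat.ceil_lt_add_one (by positivity)).le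
  have md := main_det w hw hq C ε hC hε hε1 hwb Ψ Ψ1 Ψ2 b c2 α β hb hc2 hαβ hΨ1 hΨ0 hΨl hΨb hΨT hΨc N H (H ^ 10) (H ^ 6) (H ^ 8) z E N1
    (by omega) (Nat.pow_le_pow_right (by omega) (by norm_num)) hMz t1 hzF.out (by rw [hlogM]; linarith) (by rw [hlogM]; linarith) lam hlam t2 t3 hN1pos 
    hNN hEb hbH hHβ
  rw [← hD] at md
  -- the four error terms
  have r1 : 5 / 64 * (c2 * (β - α) / 8 * √(K / 2)) ≤ 5 / 64 * (c2 * (β - α) / 8 * √(lam / H)) := by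
    have : 0 ≤ c2 * (β - α) / 8 := by
      have := mul_pos hc2 (sub_pos.2 hαβ); linarith
    have hs := Real.sqrt_le_sqrt hllo
    gcongr
  have r2 : 5 * (32 * (2 * ((H ^ 8 : ℕ) : ℝ) + 1) ^ 2 * (z:ℝ) ^ 8 / N1) / (b / H) ^ 3 ≤ 1 := by
    have e : 5 * (32 * (2 * ((H ^ 8 : ℕ) : ℝ) + 1) ^ 2 * (z:ℝ) ^ 8 / N1) / (b / H) ^ 3 = 
      (160 * (2 * (H:ℝ) ^ 8 + 1) ^ 2 * z ^ 8 * H ^ 3) / (b ^ 3 * N1) := by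
      push_cast; field_simp; ring
    rw [e, div_le_one (by positivity)]
    have hb3 : 1 ≤ b ^ 3 := one_le_pow₀ hb
    have p8 : (1:ℝ) ≤ (H:ℝ) ^ 8 := one_le_pow₀ hH1
    have k1 : 160 * (2 * (H:ℝ) ^ 8 + 1) ^ 2 * z ^ 8 * H ^ 3 ≤ 160 * (3 * (H:ℝ) ^ 8) ^ 2 * √N * H ^ 3 := by
      gcongr; linarith
    have k2 : (160 * (3 * (H:ℝ) ^ 8) ^ 2 * √N * H ^ 3) * D = q * √N / 2 := by rw [hqdef]; ring
    have k3 : q * √N / 2 ≤ N1 * D := by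
      have : q * √N ≤ √N * √N := by gcongr
      linarith
    have k4 : (160 * (3 * (H:ℝ) ^ 8) ^ 2 * √N * H ^ 3) ≤ N1 := by
      rw [← k2] at k3
      exact le_of_mul_le_mul_right k3 (by linarith)
    have k5 : (N1:ℝ) ≤ b ^ 3 * N1 := le_mul_of_one_le_left hN1'.le hb3
    linarith
  have r3 : 32 * (z:ℝ) ^ 8 / (N + 1) ≤ 1 := by
    rw [div_le_one (by linarith)]
    have := mul_le_mul_of_nonneg_right (by linarith only [hq1, hqs] : 32 ≤ √(N:ℝ)) (Real.sqrt_nonneg (N:ℝ))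
    linarith only [hzs, this, hss]
  have hN1r : (1:ℝ) ≤ N := by linarith only [hbig, hR19, hD1, pow_nonneg hH0.le 8]
  have r4 : (6 * b / (H:ℝ) ^ 2) * (((N:ℝ) + 1) * 
      ((√H / 2) * (lam + 32 * (z:ℝ) ^ 8 / (N + 1)) + (1 / (2 * √H)) * (3 * lam ^ 2 + 4 * lam + 32 * (z:ℝ) ^ 8 / (N + 1)))) ≤ N := by
    calc _ ≤ (6 * b / (H:ℝ) ^ 2) * (((N:ℝ) + 1) * ((√H / 2) * (lam + 1) + (1 / (2 * √H)) * (3 * lam ^ 2 + 4 * lam + 1))) := by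
          gcongr
      _ = ((N:ℝ) + 1) * ((6 * b / H ^ 2) * ((√H / 2) * (lam + 1) + (1 / (2 * √H)) * (3 * lam ^ 2 + 4 * lam + 1))) := by ring
      _ ≤ ((N:ℝ) + 1) * (1 / 2) := by gcongr
      _ ≤ N := by linarith only [hN1r]
  have r5 : (N:ℝ) / 2 * (2 * (90 * b + 26)) ≤ (N1:ℝ) * D * (5 / 64 * (c2 * (β - α) / 8 * √(lam / H)) - 2 - b ^ 2 / H ^ 3 * (8 * lam ^ 2 + lam)
      - 5 * (32 * (2 * ((H ^ 8 : ℕ) : ℝ) + 1) ^ 2 * (z:ℝ) ^ 8 / N1) / (b / H) ^ 3) := by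
    refine mul_le_mul hDN (by linarith) (by linarith) (by positivity)
  have r6 : (N:ℝ) ≤ (2 * H + 1) * (2 * G w N + E) := by linarith
  have r7 : (2 * (H:ℝ) + 1) * E ≤ N / 2 := by
    refine le_trans ?_ hEE
    have : 0 ≤ 2 * L + 1 := by linarith
    gcongr
  have hG0 : (0:ℝ) ≤ G w N := by positivity
  have r8 : (N:ℝ) / 2 ≤ 2 * (3 * H) * G w N := by
    have : (2 * (H:ℝ) + 1) * (2 * G w N) ≤ (3 * H) * (2 * G w N) := by gcongr; linarith
    linarith
  rw [div_le_iff₀ hL0]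
  have : (H:ℝ) * G w N ≤ L * G w N := by gcongr
  linarith

theorem G_lower_bound (w : ℕ → ℕ)
    (hw_add : ∀ m n : ℕ, 1 ≤ m → 1 ≤ n → Nat.Coprime m n → w (m * n) = w m + w n)
    (hw_prime : ∀ q : ℕ, Nat.Prime q → w q = 1)
    (C ε : ℝ) (hC : 0 < C) (hε : 0 < ε) (hε1 : ε < 1)
    (hw_bound : ∀ n : ℕ, 1 ≤ n → (w n : ℝ) ≤ C * (n : ℝ) ^ ε) :
    ∃ c : ℝ, 0 < c ∧ ∀ᶠ N : ℕ in Filter.atTop,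
      c * N / Real.log (Real.log N) ≤ (G w N : ℝ) := by
  obtain ⟨Ψ, Ψ1, Ψ2, b, c2, α, β, hb, hc2, hαβ, k1, k2, k3, k4, k5, k6⟩ := exists_bump
  refine ⟨1 / 12, by norm_num, ?_⟩
  set c3 := 5 / 64 * (c2 * (β - α) / 8) with hc3
  have hc30 : 0 < c3 := by
    have := mul_pos hc2 (sub_pos.2 hαβ); rw [hc3]; linarith
  set Q := (4 + 2 * (90 * b + 26)) / c3 with hQ
  have hQ0 : 0 < Q := div_pos (by linarith) hc30
  set K := 2 * Q ^ 2 + 1 with hKdef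
  have hK1 : 1 ≤ K := by rw [hKdef]; nlinarith
  have hK0 : 0 < K := by linarith
  have hK : 4 + 2 * (90 * b + 26) ≤ 5 / 64 * (c2 * (β - α) / 8 * √(K / 2)) := by
    have h1 : Q ≤ √(K / 2) := Real.le_sqrt_of_sq_le (by rw [hKdef]; linarith)
    have h2 : c3 * Q = 4 + 2 * (90 * b + 26) := by rw [hQ]; field_simp
    rw [← mul_assoc, ← hc3, ← h2]
    gcongr
  have tL : Filter.Tendsto (fun N : ℕ => Real.log (Real.log N) / K) Filter.atTop Filter.atTop := 
    ((Real.tendsto_log_atTop.comp (Real.tendsto_log_atTop.comp (tendsto_natCast_atTop_atTop (R := ℝ))))).atTop_div_const hK0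
  have tH : Filter.Tendsto (fun N : ℕ => ⌊Real.log (Real.log N) / K⌋₊) Filter.atTop Filter.atTop := tendsto_nat_floor_atTop.comp tL
  have hC64 : 0 < 1 + 64 * C := by linarith
  filter_upwards [tH.eventually (ev_ge (1 + C)), tH.eventually (ev_ge (2 + 16 * K)), tH.eventually (Filter.eventually_ge_atTop 3),
    tH.eventually (ev_ge (b ^ 2 * (8 * (16 * K) ^ 2 + 16 * K))), 
    tH.eventually (ev_ge ((6 * b * ((16 * K + 1) + (3 * (16 * K) ^ 2 + 4 * (16 * K) + 1))) ^ 2)),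
    tH.eventually (ev_ge b), tH.eventually (ev_ge (2 / (β - α))), tH.eventually (ev_log 1 10 1 (by norm_num) (by norm_num)),
    tH.eventually (ev_log (4 * (1 + 64 * C)) (4 * (1 + 64 * C) * 10) 1 (by positivity) (by norm_num)), 
    tH.eventually (ev_log 6 10 (1/2) (by norm_num) (by norm_num)), tH.eventually ev_exp, ev_E C ε hC hε hε1,
    tL.eventually (Filter.eventually_ge_atTop 0)] with N h1 h2 h3 h4 h5 h6 h7 h8 h9 h10 h11 h12 h13
  have f1 := Nat.floor_le h13
  have f2 := Nat.lt_floor_add_one (Real.log (Real.log N) / K)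
  generalize ⌊Real.log (Real.log N) / K⌋₊ = H at *
  rw [le_div_iff₀ hK0] at f1
  rw [div_lt_iff₀ hK0] at f2
  have hH1 : (1:ℝ) ≤ H := by exact_mod_cast (by omega : 1 ≤ H)
  refine core w hw_add hw_prime C ε hC hε hε1 hw_bound Ψ Ψ1 Ψ2 b c2 α β hb hc2 hαβ k1 k2 k3 k4 k5 k6 K hK1 hK N H (by linarith) 
    (by nlinarith) h1 h2 h3 h4 h5 h6 ?_ h8 h9 h10 h11.1 h11.2 h12
  rw [div_le_iff₀ (sub_pos.2 hαβ)] at h7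
  exact h7
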